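/- Let n,m ≥ 1 and 0 < q < 1, 0 < t < 1. Then for all P,Q ∈ Λ_{n,m;q,t}: (i) for all admissible radii ξ,ξ′ > 0 one has ⟨P,Q⟩′_{n,m;q,t}(ξ,ξ′) = conj(⟨Q,P⟩′_{n,m;q,t}(ξ,ξ′)); and (ii) for any two admissible pairs of radii (ξ₁,ξ₁′) and (ξ₂,ξ₂′) one has ⟨P,Q⟩′_{n,m;q,t}(ξ₁,ξ₁′) = ⟨P,Q⟩′_{n,m;q,t}(ξ₂,ξ₂′); in particular the value is the same in the two regions ξ/ξ′ > M(q,t) and ξ/ξ′ < 1/M(q,t). -/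

import Mathlib

open Complex MeasureTheory Finset

noncomputable section

/-- The infinite q-Pochhammer symbol `(a;q)_∞`. -/
def qPochInf (a q : ℂ) : ℂ := ∏' k : ℕ, (1 - a * q ^ k)

/-- The weight function `Δ_N(z;q,t)`. -/
def DeltaW {N : ℕ} (q t : ℂ) (z : Fin N → ℂ) : ℂ :=
  ∏ i : Fin N, ∏ j : Fin N,
    if i ≠ j then qPochInf (z i / z j) q / qPochInf (t * (z i / z j)) q else 1

/-- The weight function `Δ_{n,m}(x,y;q,t)` for real parameters `0 < q,t < 1`. -/
def DeltaNM (n m : ℕ) (q t : ℝ) (x : Fin n → ℂ) (y : Fin m → ℂ) : ℂ :=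
  DeltaW (q : ℂ) (t : ℂ) x * DeltaW (t : ℂ) (q : ℂ) y /
    ∏ i : Fin n, ∏ j : Fin m,
      ((1 - (Real.sqrt q : ℂ)⁻¹ * (Real.sqrt t : ℂ) * (x i / y j)) *
        (1 - (Real.sqrt q : ℂ)⁻¹ * (Real.sqrt t : ℂ) * (y j / x i)))

/-- Membership in the algebra `Λ_{n,m;q,t}`: `P` is (the evaluation of) a polynomial in
`x_1,…,x_n,y_1,…,y_m`, symmetric in each set of variables separately, and satisfying the
symmetry condition `T_{q,x_i} P = T_{t⁻¹,y_j} P` at `q^{1/2} x_i = t^{-1/2} y_j`. -/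
def InLambda (n m : ℕ) (q t : ℝ) (P : (Fin n → ℂ) → (Fin m → ℂ) → ℂ) : Prop :=
  (∃ p : MvPolynomial (Fin n ⊕ Fin m) ℂ,
      ∀ (x : Fin n → ℂ) (y : Fin m → ℂ), P x y = MvPolynomial.eval (Sum.elim x y) p) ∧
    (∀ (σ : Equiv.Perm (Fin n)) (τ : Equiv.Perm (Fin m)) (x : Fin n → ℂ) (y : Fin m → ℂ),
      P (x ∘ σ) (y ∘ τ) = P x y) ∧
    ∀ (i : Fin n) (j : Fin m) (x : Fin n → ℂ) (y : Fin m → ℂ),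
      (Real.sqrt q : ℂ) * x i = (Real.sqrt t : ℂ)⁻¹ * y j →
        P (Function.update x i ((q : ℂ) * x i)) y = P x (Function.update y j ((t : ℂ)⁻¹ * y j))

/-- The conjugate `Q*(x,y) = conj (Q(1/conj x, 1/conj y))`. -/
def starFun {n m : ℕ} (Q : (Fin n → ℂ) → (Fin m → ℂ) → ℂ) :
    (Fin n → ℂ) → (Fin m → ℂ) → ℂ := fun x y =>
  starRingEnd ℂ (Q (fun i => (starRingEnd ℂ (x i))⁻¹) (fun j => (starRingEnd ℂ (y j))⁻¹))

/-- The sesquilinear pairing `⟨P,Q⟩′_{n,m;q,t}(ξ,ξ′)`, as an iterated torus integral. -/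
def pairingNM (n m : ℕ) (q t : ℝ) (P Q : (Fin n → ℂ) → (Fin m → ℂ) → ℂ) (ξ ξ' : ℝ) : ℂ :=
  (1 / ((n.factorial : ℂ) * (m.factorial : ℂ))) * (1 / (2 * (Real.pi : ℂ)) ^ (n + m)) *
    ∫ θ in Set.univ.pi fun _ : Fin n => Set.Ioc (0 : ℝ) (2 * Real.pi),
      ∫ φ in Set.univ.pi fun _ : Fin m => Set.Ioc (0 : ℝ) (2 * Real.pi),
        DeltaNM n m q t (fun i => (ξ : ℂ) * Complex.exp (Complex.I * (θ i : ℂ)))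
            (fun j => (ξ' : ℂ) * Complex.exp (Complex.I * (φ j : ℂ))) *
          P (fun i => (ξ : ℂ) * Complex.exp (Complex.I * (θ i : ℂ)))
            (fun j => (ξ' : ℂ) * Complex.exp (Complex.I * (φ j : ℂ))) *
          starFun Q (fun i => (ξ : ℂ) * Complex.exp (Complex.I * (θ i : ℂ)))
            (fun j => (ξ' : ℂ) * Complex.exp (Complex.I * (φ j : ℂ)))

/-- `M(q,t) = max(q^{1/2} t^{-1/2}, q^{-1/2} t^{1/2})`. -/
def Mmax (q t : ℝ) : ℝ := max (Real.sqrt q / Real.sqrt t) (Real.sqrt t / Real.sqrt q)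

/-- Radii `ξ, ξ′ > 0` are admissible if `ξ/ξ′ > M(q,t)` or `ξ/ξ′ < 1/M(q,t)`. -/
def Admissible (q t ξ ξ' : ℝ) : Prop := ξ / ξ' > Mmax q t ∨ ξ / ξ' < (Mmax q t)⁻¹

section QPochhammer

open Filter Topology

lemma summable_qPoch {q : ℂ} (hq : ‖q‖ < 1) (a : ℂ) : Summable fun k : ℕ => ‖-(a * q ^ k)‖ := by
  simpa [norm_mul, norm_pow] using (summable_geometric_of_lt_one (norm_nonneg q) hq).mul_left ‖a‖

lemma qPochInf_step {q : ℂ} (hq : ‖q‖ < 1) (a : ℂ) :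
    qPochInf a q = (1 - a) * qPochInf (q * a) q := by
  have h : Multipliable fun k : ℕ => (1 - (q * a) * q ^ k) := by
    simpa [sub_eq_add_neg] using multipliable_one_add_of_summable (summable_qPoch hq (q * a))
  unfold qPochInf
  rw [tprod_eq_zero_mul']
  · simp [pow_succ, mul_assoc, mul_comm, mul_left_comm]
  · simpa [pow_succ, mul_assoc, mul_comm, mul_left_comm] using h

lemma qPochInf_ne_zero {q a : ℂ} (hq : ‖q‖ < 1) (ha : ‖a‖ < 1) : qPochInf a q ≠ 0 := by
  have := tprod_one_add_ne_zero_of_summable (f := fun k : ℕ => -(a * q ^ k)) ?_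
    (summable_qPoch hq a)
  · simpa [qPochInf, sub_eq_add_neg] using this
  · intro k h
    have h1 : a * q ^ k = 1 := by linear_combination -h
    have h2 : ‖a * q ^ k‖ < 1 := by
      rw [norm_mul, norm_pow]
      exact lt_of_le_of_lt (mul_le_of_le_one_right (norm_nonneg _)
        (pow_le_one₀ (norm_nonneg _) hq.le)) ha
    rw [h1] at h2
    simp at h2

lemma continuousOn_qPochInf :
    ContinuousOn (fun p : ℂ × ℂ => qPochInf p.1 p.2) {p | ‖p.2‖ < 1} := by
  intro p hp
  obtain ⟨r, hr, hr1⟩ := exists_between (show ‖p.2‖ < 1 from hp)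
  obtain ⟨R, hR⟩ := exists_gt ‖p.1‖
  have hr0 : 0 ≤ r := (norm_nonneg _).trans hr.le
  let U : Set (ℂ × ℂ) := {p | ‖p.1‖ < R ∧ ‖p.2‖ < r}
  have hU : IsOpen U := by
    have h1 : IsOpen {p : ℂ × ℂ | ‖p.1‖ < R} := isOpen_lt (by fun_prop) (by fun_prop)
    have h2 : IsOpen {p : ℂ × ℂ | ‖p.2‖ < r} := isOpen_lt (by fun_prop) (by fun_prop)
    exact h1.inter h2
  have hc : ContinuousOn (fun p : ℂ × ℂ => ∏' k : ℕ, (1 + -(p.1 * p.2 ^ k))) U := by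
    have h1 := ((summable_geometric_of_lt_one hr0 hr1).mul_left
      R).hasProdLocallyUniformlyOn_nat_one_add (K := U) (f := fun k p => -(p.1 * p.2 ^ k)) hU
      (Eventually.of_forall fun k x hx => by
        rw [norm_neg, norm_mul, norm_pow]
        have := hx.1
        have := hx.2
        gcongr
        exact (norm_nonneg _).trans hx.1.le) (fun k => by fun_prop)
    exact (hasProdLocallyUniformlyOn_iff_tendstoLocallyUniformlyOn.1 h1).continuousOn
      (Eventually.of_forall fun s => by fun_prop).frequently
  have : ContinuousAt (fun p : ℂ × ℂ => qPochInf p.1 p.2) p := by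
    have := hc.continuousAt (hU.mem_nhds ⟨hR, hr⟩)
    simpa [qPochInf, sub_eq_add_neg] using this
  exact this.continuousWithinAt

lemma differentiable_qPochInf {q : ℂ} (hq : ‖q‖ < 1) : Differentiable ℂ fun a => qPochInf a q := by
  intro a
  obtain ⟨R, hR⟩ := exists_gt ‖a‖
  let U : Set ℂ := {a | ‖a‖ < R}
  have hU : IsOpen U := isOpen_lt (by fun_prop) (by fun_prop)
  have h1 := ((summable_geometric_of_lt_one (norm_nonneg q) hq).mul_left
    R).hasProdLocallyUniformlyOn_nat_one_add (K := U) (f := fun k a => -(a * q ^ k)) hU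
    (Eventually.of_forall fun k x hx => by
      rw [norm_neg, norm_mul, norm_pow]
      have : ‖x‖ < R := hx
      gcongr) (fun k => by fun_prop)
  have h2 := (hasProdLocallyUniformlyOn_iff_tendstoLocallyUniformlyOn.1 h1).differentiableOn
    (Eventually.of_forall fun s => by fun_prop) hU
  have := h2.differentiableAt (hU.mem_nhds hR)
  simpa [qPochInf, sub_eq_add_neg] using this

lemma conj_qPochInf (a q : ℂ) :
    starRingEnd ℂ (qPochInf a q) = qPochInf (starRingEnd ℂ a) (starRingEnd ℂ q) := by
  unfold qPochInf
  rw [Function.LeftInverse.map_tprod (g := starRingEnd ℂ) (g' := starRingEnd ℂ) _ continuous_conj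
    continuous_conj (fun x => by simp)]
  simp

end QPochhammer

section Torus

open Filter Topology

instance fact_two_pi_pos : Fact (0 < 2 * Real.pi) := ⟨Real.two_pi_pos⟩

/-- The parameter space of the torus `|x_i| = ξ`, `|y_j| = ξ′`. -/
abbrev TorusParam (n m : ℕ) : Type :=
  (Fin n → AddCircle (2 * Real.pi)) × (Fin m → AddCircle (2 * Real.pi))

instance isAddHaarMeasure_torusParam (n m : ℕ) :
    (volume : Measure (TorusParam n m)).IsAddHaarMeasure :=
  Measure.prod.instIsAddHaarMeasure _ _

instance isNegInvariant_addCircle :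
    (volume : Measure (AddCircle (2 * Real.pi))).IsNegInvariant :=
  Measure.IsAddHaarMeasure.isNegInvariant_of_regular _

instance isNegInvariant_pi_addCircle (n : ℕ) :
    (volume : Measure (Fin n → AddCircle (2 * Real.pi))).IsNegInvariant :=
  Measure.pi.isNegInvariant _

instance isNegInvariant_torusParam (n m : ℕ) :
    (volume : Measure (TorusParam n m)).IsNegInvariant where
  neg_eq_self := ((Measure.measurePreserving_neg
    (volume : Measure (Fin n → AddCircle (2 * Real.pi)))).prod (Measure.measurePreserving_neg
      (volume : Measure (Fin m → AddCircle (2 * Real.pi))))).map_eq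

/-- The point of the torus of radius `ξ` with given angles. -/
def torusPt {n : ℕ} (ξ : ℝ) (g : Fin n → AddCircle (2 * Real.pi)) : Fin n → ℂ :=
  fun i => (ξ : ℂ) * (AddCircle.toCircle (g i) : ℂ)

/-- The (unnormalized) integral over the torus `|x_i| = ξ`, `|y_j| = ξ′`. -/
def torusInt {n m : ℕ} (ξ ξ' : ℝ) (F : (Fin n → ℂ) → (Fin m → ℂ) → ℂ) : ℂ :=
  ∫ g : TorusParam n m, F (torusPt ξ g.1) (torusPt ξ' g.2)

/-- The torus `|x_i| = ξ`, `|y_j| = ξ′`. -/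
def torusSet (n m : ℕ) (ξ ξ' : ℝ) : Set ((Fin n → ℂ) × (Fin m → ℂ)) :=
  {p | (∀ i, ‖p.1 i‖ = ξ) ∧ ∀ j, ‖p.2 j‖ = ξ'}

/-- Multiply the coordinates in `s` by `u`. -/
def scaleOn {n : ℕ} (s : Finset (Fin n)) (u : ℂ) (x : Fin n → ℂ) : Fin n → ℂ :=
  fun i => if i ∈ s then u * x i else x i

variable {n m : ℕ} {ξ ξ' : ℝ}

lemma continuous_torusPt : Continuous (torusPt ξ : (Fin n → AddCircle (2 * Real.pi)) → _) := by
  unfold torusPt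
  have : Continuous fun g : AddCircle (2 * Real.pi) => (AddCircle.toCircle g : ℂ) :=
    continuous_subtype_val.comp AddCircle.continuous_toCircle
  fun_prop

lemma norm_torusPt (hξ : 0 < ξ) (g : Fin n → AddCircle (2 * Real.pi)) (i : Fin n) :
    ‖torusPt ξ g i‖ = ξ := by
  rw [torusPt, norm_mul, Circle.norm_coe, mul_one, Complex.norm_real, Real.norm_of_nonneg hξ.le]

lemma torusPt_mem (hξ : 0 < ξ) (hξ' : 0 < ξ') (g : TorusParam n m) :
    (torusPt ξ g.1, torusPt ξ' g.2) ∈ torusSet n m ξ ξ' :=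
  ⟨norm_torusPt hξ _, norm_torusPt hξ' _⟩

lemma continuous_torus_comp (hξ : 0 < ξ) (hξ' : 0 < ξ') {F : (Fin n → ℂ) → (Fin m → ℂ) → ℂ}
    (hF : ContinuousOn (Function.uncurry F) (torusSet n m ξ ξ')) :
    Continuous fun g : TorusParam n m => F (torusPt ξ g.1) (torusPt ξ' g.2) :=
  hF.comp_continuous (f := fun g : TorusParam n m => (torusPt ξ g.1, torusPt ξ' g.2))
    ((continuous_torusPt.comp continuous_fst).prodMk (continuous_torusPt.comp continuous_snd))
    (torusPt_mem hξ hξ')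

lemma integrable_torus (hξ : 0 < ξ) (hξ' : 0 < ξ') {F : (Fin n → ℂ) → (Fin m → ℂ) → ℂ}
    (hF : ContinuousOn (Function.uncurry F) (torusSet n m ξ ξ')) :
    Integrable fun g : TorusParam n m => F (torusPt ξ g.1) (torusPt ξ' g.2) := by
  rw [← integrableOn_univ]
  exact (continuous_torus_comp hξ hξ' hF).continuousOn.integrableOn_compact isCompact_univ

lemma integral_pi_Ioc (f : (Fin n → AddCircle (2 * Real.pi)) → ℂ) (hf : Continuous f) :
    ∫ θ in Set.univ.pi fun _ : Fin n => Set.Ioc (0 : ℝ) (2 * Real.pi), f (fun i => (θ i : AddCircle (2 * Real.pi)))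
      = ∫ g, f g := by
  have h1 : MeasurePreserving (fun (θ : Fin n → ℝ) i => (θ i : AddCircle (2 * Real.pi)))
      (Measure.pi fun _ : Fin n => volume.restrict (Set.Ioc (0 : ℝ) (0 + 2 * Real.pi)))
      (Measure.pi fun _ => volume) :=
    measurePreserving_pi _ _ fun _ => AddCircle.measurePreserving_mk _ _
  rw [volume_pi (α := fun _ : Fin n => AddCircle (2 * Real.pi)), ← h1.map_eq, integral_map h1.aemeasurable
    hf.aestronglyMeasurable, volume_pi, Measure.restrict_pi_pi]
  simp

lemma torusInt_eq_iterated (hξ : 0 < ξ) (hξ' : 0 < ξ') {F : (Fin n → ℂ) → (Fin m → ℂ) → ℂ}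
    (hF : ContinuousOn (Function.uncurry F) (torusSet n m ξ ξ')) :
    (∫ θ in Set.univ.pi fun _ : Fin n => Set.Ioc (0 : ℝ) (2 * Real.pi),
      ∫ φ in Set.univ.pi fun _ : Fin m => Set.Ioc (0 : ℝ) (2 * Real.pi),
        F (fun i => (ξ : ℂ) * Complex.exp (Complex.I * (θ i : ℂ)))
            (fun j => (ξ' : ℂ) * Complex.exp (Complex.I * (φ j : ℂ)))) = torusInt ξ ξ' F := by
  have key : ∀ {k : ℕ} (η : ℝ) (θ : Fin k → ℝ),
      (fun i => (η : ℂ) * Complex.exp (Complex.I * (θ i : ℂ))) =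
      torusPt η (fun i => (θ i : AddCircle (2 * Real.pi))) := by
    intro k η θ
    ext i
    simp [torusPt, AddCircle.toCircle_apply_mk, Circle.coe_exp, mul_comm, Real.pi_ne_zero]
  simp only [key]
  have hc := continuous_torus_comp hξ hξ' hF
  unfold torusInt
  rw [show (volume : Measure (TorusParam n m)) = volume.prod volume from rfl,
    integral_prod _ (integrable_torus hξ hξ' hF)]
  rw [← integral_pi_Ioc]
  · congr 1
    ext θ
    rw [← integral_pi_Ioc]
    exact hc.comp (by fun_prop : Continuous fun g : Fin m → AddCircle (2 * Real.pi) => ((fun i => (θ i : AddCircle (2 * Real.pi))), g))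
  · have := continuous_parametric_integral_of_continuous
      (μ := (volume : Measure (Fin m → AddCircle (2 * Real.pi)))) (s := Set.univ)
      (f := fun g h => F (torusPt ξ g) (torusPt ξ' h)) hc isCompact_univ
    simpa using this

lemma torusInt_swap (F : (Fin n → ℂ) → (Fin m → ℂ) → ℂ) :
    torusInt ξ ξ' F = torusInt ξ' ξ (fun y x => F x y) := by
  unfold torusInt
  exact (integral_prod_swap (μ := (volume : Measure (Fin n → AddCircle (2 * Real.pi))))
    (ν := (volume : Measure (Fin m → AddCircle (2 * Real.pi))))
    (fun g => F (torusPt ξ g.1) (torusPt ξ' g.2))).symm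

lemma torusPt_neg (g : Fin n → AddCircle (2 * Real.pi)) :
    torusPt ξ (-g) = fun i => (torusPt ξ⁻¹ g i)⁻¹ := by
  ext i
  simp [torusPt, AddCircle.toCircle_neg, mul_comm]

lemma torusInt_inv (F : (Fin n → ℂ) → (Fin m → ℂ) → ℂ) :
    torusInt ξ ξ' (fun x y => F (fun i => (x i)⁻¹) (fun j => (y j)⁻¹)) =
      torusInt ξ⁻¹ ξ'⁻¹ F := by
  unfold torusInt
  rw [← integral_neg_eq_self]
  simp only [Prod.fst_neg, Prod.snd_neg, torusPt_neg, inv_inv]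

lemma conj_torusPt (g : Fin n → AddCircle (2 * Real.pi)) (i : Fin n) :
    starRingEnd ℂ (torusPt ξ g i) = torusPt ξ (-g) i := by
  simp [torusPt, AddCircle.toCircle_neg, ← Circle.coe_inv_eq_conj]

lemma conj_torusInt (F : (Fin n → ℂ) → (Fin m → ℂ) → ℂ)
    (hF : ∀ x y, starRingEnd ℂ (F x y) =
      F (fun i => starRingEnd ℂ (x i)) (fun j => starRingEnd ℂ (y j))) :
    starRingEnd ℂ (torusInt ξ ξ' F) = torusInt ξ ξ' F := by
  unfold torusInt
  rw [← integral_conj, ← integral_neg_eq_self]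
  simp only [Prod.fst_neg, Prod.snd_neg, hF, conj_torusPt, neg_neg]

lemma torusInt_rot {F : (Fin n → ℂ) → (Fin m → ℂ) → ℂ} (s : Finset (Fin n))
    (φ : AddCircle (2 * Real.pi)) :
    torusInt ξ ξ' (fun x y => F (scaleOn s (AddCircle.toCircle φ) x) y) = torusInt ξ ξ' F := by
  unfold torusInt
  rw [← integral_add_right_eq_self (μ := (volume : Measure (TorusParam n m)))
    (fun g => F (torusPt ξ g.1) (torusPt ξ' g.2)) ((fun i => if i ∈ s then φ else 0), 0)]
  refine integral_congr_ae (Eventually.of_forall fun g => ?_)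
  have h1 : torusPt ξ (g + ((fun i => if i ∈ s then φ else 0), 0)).1 =
      scaleOn s (AddCircle.toCircle φ) (torusPt ξ g.1) := by
    ext i
    simp only [scaleOn, torusPt, Prod.fst_add, Pi.add_apply]
    split_ifs
    · simp [AddCircle.toCircle_add]
      ring
    · simp
  simp only [h1, Prod.snd_add, add_zero]

lemma scaleOn_mul (s : Finset (Fin n)) (u v : ℂ) (x : Fin n → ℂ) :
    scaleOn s (u * v) x = scaleOn s u (scaleOn s v x) := by
  ext i
  simp only [scaleOn]
  split_ifs <;> ring

lemma integral_circle_eq {f : ℂ → ℂ} {r : ℝ} (hr : 0 < r) :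
    (∮ z in C(0, r), (z - 0)⁻¹ • f z) =
      I * ∫ φ : AddCircle (2 * Real.pi), f (r * AddCircle.toCircle φ) := by
  rw [← AddCircle.intervalIntegral_preimage (2 * Real.pi) 0, zero_add, circleIntegral,
    ← intervalIntegral.integral_const_mul]
  congr 1
  ext θ
  have h1 : circleMap 0 r θ = r * (AddCircle.toCircle (θ : AddCircle (2 * Real.pi)) : ℂ) := by
    simp [circleMap, AddCircle.toCircle_apply_mk, Circle.coe_exp, Real.pi_ne_zero]
  have h2 : circleMap 0 r θ ≠ 0 := circleMap_ne_center hr.ne'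
  rw [deriv_circleMap, sub_zero, smul_eq_mul, smul_eq_mul, ← h1]
  field_simp

lemma torusInt_scaleOn (hξ : 0 < ξ) (hξ' : 0 < ξ') {F : (Fin n → ℂ) → (Fin m → ℂ) → ℂ}
    (s : Finset (Fin n)) {r : ℝ} (hr : 0 < r) (hr1 : r ≤ 1)
    (hF : ∀ p ∈ torusSet n m ξ ξ', ∀ u : ℂ, r ≤ ‖u‖ → ‖u‖ ≤ 1 →
      DifferentiableAt ℂ (Function.uncurry F) (scaleOn s u p.1, p.2)) :
    torusInt ξ ξ' F = torusInt ξ ξ' (fun x y => F (scaleOn s r x) y) := by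
  have hsc : ∀ x : Fin n → ℂ, Differentiable ℂ fun u : ℂ => scaleOn s u x := by
    intro x
    rw [differentiable_pi]
    intro i
    unfold scaleOn
    split_ifs <;> fun_prop
  have hsc' : Continuous fun p : ℂ × (Fin n → ℂ) => scaleOn s p.1 p.2 := by
    refine continuous_pi fun i => ?_
    unfold scaleOn
    split_ifs <;> fun_prop
  have key : ∀ ρ : ℝ, 0 < ρ → r ≤ ρ → ρ ≤ 1 →
      (∫ g : TorusParam n m, ∫ φ : AddCircle (2 * Real.pi),
        F (scaleOn s (ρ * AddCircle.toCircle φ) (torusPt ξ g.1)) (torusPt ξ' g.2)) =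
      (2 * Real.pi) • torusInt ξ ξ' (fun x y => F (scaleOn s ρ x) y) := by
    intro ρ hρ0 hρ hρ1
    have hc : Continuous fun p : TorusParam n m × AddCircle (2 * Real.pi) =>
        F (scaleOn s (ρ * AddCircle.toCircle p.2) (torusPt ξ p.1.1)) (torusPt ξ' p.1.2) := by
      rw [continuous_iff_continuousAt]
      intro p
      have h0 : ‖(ρ : ℂ) * AddCircle.toCircle p.2‖ = ρ := by
        rw [norm_mul, Circle.norm_coe, Complex.norm_real, Real.norm_of_nonneg hρ0.le, mul_one]
      have h1 := (hF _ (torusPt_mem hξ hξ' p.1) (ρ * AddCircle.toCircle p.2)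
        (h0.symm ▸ hρ) (h0.symm ▸ hρ1)).continuousAt
      have h2 : Continuous fun p : TorusParam n m × AddCircle (2 * Real.pi) =>
          (scaleOn s (ρ * AddCircle.toCircle p.2) (torusPt ξ p.1.1), torusPt ξ' p.1.2) := by
        refine Continuous.prodMk (hsc'.comp (Continuous.prodMk (continuous_const.mul
          (continuous_subtype_val.comp (AddCircle.continuous_toCircle.comp continuous_snd))) ?_)) ?_
        · exact continuous_torusPt.comp (by fun_prop)
        · exact continuous_torusPt.comp (by fun_prop)
      exact ContinuousAt.comp (g := Function.uncurry F) (f := fun p : TorusParam n m × AddCircle (2 * Real.pi) =>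
          (scaleOn s (ρ * AddCircle.toCircle p.2) (torusPt ξ p.1.1), torusPt ξ' p.1.2)) h1 h2.continuousAt
    rw [integral_integral_swap]
    · have : ∀ φ : AddCircle (2 * Real.pi), (∫ g : TorusParam n m,
          F (scaleOn s (ρ * AddCircle.toCircle φ) (torusPt ξ g.1)) (torusPt ξ' g.2)) =
          torusInt ξ ξ' (fun x y => F (scaleOn s ρ x) y) := by
        intro φ
        rw [← torusInt_rot s φ]
        simp only [torusInt, scaleOn_mul]
      simp only [this, integral_const]
      simp [Measure.real, Real.pi_pos.le]
    · rw [← integrableOn_univ]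
      exact hc.continuousOn.integrableOn_compact isCompact_univ
  have hann : ∀ g : TorusParam n m,
      (∫ φ : AddCircle (2 * Real.pi),
        F (scaleOn s ((1 : ℝ) * AddCircle.toCircle φ) (torusPt ξ g.1)) (torusPt ξ' g.2)) =
      ∫ φ : AddCircle (2 * Real.pi),
        F (scaleOn s (r * AddCircle.toCircle φ) (torusPt ξ g.1)) (torusPt ξ' g.2) := by
    intro g
    have hd : ∀ u : ℂ, r ≤ ‖u‖ → ‖u‖ ≤ 1 →
        DifferentiableAt ℂ (fun u => F (scaleOn s u (torusPt ξ g.1)) (torusPt ξ' g.2)) u := by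
      intro u h1 h2
      exact DifferentiableAt.comp (g := Function.uncurry F)
        (f := fun u => (scaleOn s u (torusPt ξ g.1), torusPt ξ' g.2)) u
        (hF _ (torusPt_mem hξ hξ' g) u h1 h2)
        ((hsc _ u).prodMk (differentiableAt_const _))
    have := Complex.circleIntegral_sub_center_inv_smul_eq_of_differentiable_on_annulus_off_countable
      (c := 0) hr hr1 (s := ∅) Set.countable_empty
      (f := fun u => F (scaleOn s u (torusPt ξ g.1)) (torusPt ξ' g.2))
      (fun u hu => (hd u (by simpa using hu.2) (by simpa using hu.1)).continuousAt.continuousWithinAt)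
      (fun u hu => hd u (by have := hu.1.2; simp at this; exact this.le)
        (by have := hu.1.1; simp at this; exact this.le))
    rw [integral_circle_eq hr, integral_circle_eq one_pos] at this
    exact mul_left_cancel₀ I_ne_zero this
  have h1 := key 1 one_pos hr1 le_rfl
  have h2 := key r hr le_rfl hr1
  simp only [hann] at h1
  rw [h1] at h2
  have h3 : (2 * Real.pi) ≠ 0 := by positivity
  have h4 := (smul_right_injective ℂ h3) h2
  rw [← h4]
  congr 1
  ext x y
  congr 1
  ext i
  simp [scaleOn]

lemma torusInt_congr (hξ : 0 < ξ) (hξ' : 0 < ξ') {F F' : (Fin n → ℂ) → (Fin m → ℂ) → ℂ}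
    (h : ∀ p ∈ torusSet n m ξ ξ', F p.1 p.2 = F' p.1 p.2) : torusInt ξ ξ' F = torusInt ξ ξ' F' :=
  integral_congr_ae (Eventually.of_forall fun g => h _ (torusPt_mem hξ hξ' g))

lemma volume_diagonal_eq_zero {i k : Fin n} (hik : i ≠ k) :
    volume {g : Fin n → AddCircle (2 * Real.pi) | g i = g k} = 0 := by
  by_contra h0
  have hm : MeasurableSet {g : Fin n → AddCircle (2 * Real.pi) | g i = g k} :=
    (isClosed_eq (by fun_prop) (by fun_prop)).measurableSet
  let e : AddCircle (2 * Real.pi) → (Fin n → AddCircle (2 * Real.pi)) := fun a => Pi.single i a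
  have hset : ∀ a, (fun g => g + e a) ⁻¹' {g | g i = g k} = {g | g i + a = g k} := by
    intro a
    ext g
    simp [e, Pi.single_eq_of_ne hik.symm]
  have hvol : ∀ a, volume {g : Fin n → AddCircle (2 * Real.pi) | g i + a = g k} =
      volume {g : Fin n → AddCircle (2 * Real.pi) | g i = g k} := by
    intro a
    rw [← hset, measure_preimage_add_right]
  have hfin := Measure.finite_const_le_meas_of_disjoint_iUnion
    (volume : Measure (Fin n → AddCircle (2 * Real.pi))) (pos_iff_ne_zero.2 h0)
    (As := fun a : AddCircle (2 * Real.pi) => {g | g i + a = g k})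
    (fun a => (isClosed_eq (by fun_prop) (by fun_prop)).measurableSet)
    (fun a b hab => Set.disjoint_left.2 fun g h1 h2 =>
      hab (add_left_cancel ((show g i + a = g k from h1).trans (show g i + b = g k from h2).symm)))
    (measure_ne_top _ _)
  simp only [hvol, le_refl, Set.ofPred_true] at hfin
  have : Infinite (AddCircle (2 * Real.pi)) :=
    Infinite.of_injective (fun k : ℕ => (((2 * Real.pi) / (k + 2) : ℝ) : AddCircle (2 * Real.pi))) (by
      intro a b hab
      simp only at hab
      rw [AddCircle.coe_eq_coe_iff_of_mem_Ico (a := 0)] at hab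
      · have := Real.pi_pos
        field_simp at hab
        exact_mod_cast (by linarith : (a : ℝ) = b)
      all_goals
        refine ⟨by positivity, ?_⟩
        rw [zero_add, div_lt_iff₀ (by positivity)]
        nlinarith [Real.pi_pos]
      )
  exact Set.infinite_univ hfin

lemma ae_injective_angles :
    ∀ᵐ g : Fin n → AddCircle (2 * Real.pi), Function.Injective g := by
  have : ∀ᵐ g : Fin n → AddCircle (2 * Real.pi), ∀ i k, i ≠ k → g i ≠ g k := by
    simp only [ae_all_iff]
    intro i k hik
    rw [ae_iff]
    simpa using volume_diagonal_eq_zero hik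
  filter_upwards [this] with g hg i k h
  by_contra hik
  exact hg i k hik h

lemma ae_injective_torusPt (hξ : 0 < ξ) (hξ' : 0 < ξ') : ∀ᵐ g : TorusParam n m,
    Function.Injective (torusPt ξ g.1) ∧ Function.Injective (torusPt ξ' g.2) := by
  have key : ∀ {k : ℕ} {η : ℝ}, 0 < η → ∀ g : Fin k → AddCircle (2 * Real.pi),
      Function.Injective g → Function.Injective (torusPt η g) := by
    intro k η hη g hg i j hij
    apply hg
    apply AddCircle.injective_toCircle (by positivity)
    have : (η : ℂ) ≠ 0 := by exact_mod_cast hη.ne'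
    exact Circle.ext (mul_left_cancel₀ this hij)
  have h1 : ∀ᵐ g : TorusParam n m, Function.Injective g.1 :=
    Measure.quasiMeasurePreserving_fst.ae ae_injective_angles
  have h2 : ∀ᵐ g : TorusParam n m, Function.Injective g.2 :=
    Measure.quasiMeasurePreserving_snd.ae ae_injective_angles
  filter_upwards [h1, h2] with g h1 h2
  exact ⟨key hξ _ h1, key hξ' _ h2⟩

lemma torusInt_congr_ae (hξ : 0 < ξ) (hξ' : 0 < ξ') {F F' : (Fin n → ℂ) → (Fin m → ℂ) → ℂ}
    (h : ∀ p ∈ torusSet n m ξ ξ', Function.Injective p.1 → Function.Injective p.2 →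
      F p.1 p.2 = F' p.1 p.2) : torusInt ξ ξ' F = torusInt ξ ξ' F' := by
  refine integral_congr_ae ?_
  filter_upwards [ae_injective_torusPt hξ hξ'] with g hg
  exact h _ (torusPt_mem hξ hξ' g) hg.1 hg.2

lemma torusInt_const_mul (c : ℂ) (F : (Fin n → ℂ) → (Fin m → ℂ) → ℂ) :
    torusInt ξ ξ' (fun x y => c * F x y) = c * torusInt ξ ξ' F :=
  integral_const_mul _ _

lemma torusInt_sum (hξ : 0 < ξ) (hξ' : 0 < ξ') {ι : Type*} (s : Finset ι)
    {F : ι → (Fin n → ℂ) → (Fin m → ℂ) → ℂ}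
    (hF : ∀ i ∈ s, ContinuousOn (Function.uncurry (F i)) (torusSet n m ξ ξ')) :
    torusInt ξ ξ' (fun x y => ∑ i ∈ s, F i x y) = ∑ i ∈ s, torusInt ξ ξ' (F i) :=
  integral_finsetSum _ fun i hi => integrable_torus hξ hξ' (hF i hi)

end Torus

section Weight

/-- Real parameters `0 < q, t < 1` together with `c = (t/q)^{1/2}`. -/
structure IsParam (q t c : ℝ) : Prop where
  q_pos : 0 < q
  q_lt : q < 1
  t_pos : 0 < t
  t_lt : t < 1
  c_pos : 0 < c
  rel : q * c ^ 2 = t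

lemma IsParam.swap {q t c : ℝ} (h : IsParam q t c) : IsParam t q c⁻¹ where
  q_pos := h.t_pos
  q_lt := h.t_lt
  t_pos := h.q_pos
  t_lt := h.q_lt
  c_pos := inv_pos.2 h.c_pos
  rel := by rw [← h.rel]; have := h.c_pos; field_simp

/-- The ratio `(v;q)_∞ / (tv;q)_∞`. -/
def wRatio (q t v : ℂ) : ℂ := qPochInf v q / qPochInf (t * v) q

/-- The weight `Δ_N` with the argument `z_a/z_b` twisted by `e_b`. -/
def twistWeight {N : ℕ} (q t : ℂ) (e z : Fin N → ℂ) : ℂ :=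
  ∏ a, ∏ b, if a ≠ b then wRatio q t (e b * (z a / z b)) else 1

/-- The mixed denominator with parameters depending on the `x`-index. -/
def mixedDen {n m : ℕ} (c c' : Fin n → ℂ) (x : Fin n → ℂ) (y : Fin m → ℂ) : ℂ :=
  ∏ i, ∏ j, ((1 - c i * (x i / y j)) * (1 - c' i * (y j / x i)))

/-- The weight `Δ_{n,m}` with twisted parameters. -/
def twistNM {n m : ℕ} (q t : ℂ) (e c c' : Fin n → ℂ) (x : Fin n → ℂ) (y : Fin m → ℂ) : ℂ :=
  twistWeight q t e x * twistWeight t q 1 y / mixedDen c c' x y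

/-- The weight `Δ_{n,m}` as a function of the parameters `q`, `t` and `c`. -/
def wt {n m : ℕ} (q t c : ℂ) (x : Fin n → ℂ) (y : Fin m → ℂ) : ℂ :=
  twistNM q t 1 (fun _ => c) (fun _ => c) x y

lemma deltaNM_eq_wt (n m : ℕ) (q t : ℝ) :
    DeltaNM n m q t = wt (q : ℂ) (t : ℂ) (((Real.sqrt q)⁻¹ * Real.sqrt t : ℝ) : ℂ) := by
  funext x y
  simp [DeltaNM, wt, twistNM, twistWeight, DeltaW, wRatio, mixedDen]

variable {N n m : ℕ} {q t c : ℝ} {ξ ξ' : ℝ}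

lemma differentiableAt_div {E : Type*} [NormedAddCommGroup E] [NormedSpace ℂ E] {f g : E → ℂ} {x : E}
    (hf : DifferentiableAt ℂ f x) (hg : DifferentiableAt ℂ g x) (h : g x ≠ 0) :
    DifferentiableAt ℂ (fun y => f y / g y) x := by
  fun_prop (disch := assumption)

lemma differentiableAt_finsetProd {E : Type*} [NormedAddCommGroup E] [NormedSpace ℂ E] {ι : Type*}
    {s : Finset ι} {f : ι → E → ℂ} {x : E} (hf : ∀ i ∈ s, DifferentiableAt ℂ (f i) x) :
    DifferentiableAt ℂ (fun y => ∏ i ∈ s, f i y) x := by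
  induction s using Finset.cons_induction with
  | empty => simp
  | cons a s ha ih =>
    simp only [Finset.prod_cons]
    exact (hf a (by simp)).mul (ih fun i hi => hf i (by simp [hi]))

lemma differentiableAt_wRatio {q t v : ℂ} (hq : ‖q‖ < 1) (hv : ‖t * v‖ < 1) :
    DifferentiableAt ℂ (wRatio q t) v := by
  unfold wRatio
  refine DifferentiableAt.div (differentiable_qPochInf hq v) ?_ (qPochInf_ne_zero hq hv)
  exact (differentiable_qPochInf hq (t * v)).comp v (by fun_prop)

lemma differentiableAt_twistWeight {q t : ℂ} (hq : ‖q‖ < 1) {e z : Fin N → ℂ}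
    (hz : ∀ i, z i ≠ 0) (h : ∀ a b, a ≠ b → ‖t * (e b * (z a / z b))‖ < 1) :
    DifferentiableAt ℂ (twistWeight q t e) z := by
  unfold twistWeight
  refine differentiableAt_finsetProd fun a _ =>
    differentiableAt_finsetProd fun b _ => ?_
  by_cases hab : a = b
  · simp [hab]
  · simp only [ne_eq, hab, not_false_eq_true, if_true]
    refine DifferentiableAt.comp z (differentiableAt_wRatio hq (h a b hab)) ?_
    refine DifferentiableAt.const_mul (differentiableAt_div (f := fun z : Fin N → ℂ => z a)
      (g := fun z : Fin N → ℂ => z b) ?_ ?_ (hz b)) _ <;> fun_prop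

lemma differentiableAt_mixedDen {c c' : Fin n → ℂ} {p : (Fin n → ℂ) × (Fin m → ℂ)}
    (hx : ∀ i, p.1 i ≠ 0) (hy : ∀ j, p.2 j ≠ 0) :
    DifferentiableAt ℂ (Function.uncurry (mixedDen c c')) p := by
  unfold mixedDen Function.uncurry
  refine differentiableAt_finsetProd fun i _ =>
    differentiableAt_finsetProd fun j _ => ?_
  refine DifferentiableAt.mul ?_ ?_ <;>
  refine DifferentiableAt.const_sub (DifferentiableAt.const_mul
    (differentiableAt_div ?_ ?_ (by first | exact hx i | exact hy j)) _) _ <;> fun_prop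

lemma mixedDen_ne_zero {c c' : Fin n → ℂ} {x : Fin n → ℂ} {y : Fin m → ℂ}
    (h : ∀ i j, c i * (x i / y j) ≠ 1) (h' : ∀ i j, c' i * (y j / x i) ≠ 1) :
    mixedDen c c' x y ≠ 0 := by
  refine prod_ne_zero_iff.2 fun i _ => prod_ne_zero_iff.2 fun j _ => mul_ne_zero ?_ ?_
  · exact sub_ne_zero.2 (h i j).symm
  · exact sub_ne_zero.2 (h' i j).symm

lemma differentiableAt_twistNM {q t : ℂ} (hq : ‖q‖ < 1) (ht : ‖t‖ < 1) {e c c' : Fin n → ℂ}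
    {p : (Fin n → ℂ) × (Fin m → ℂ)} (hx : ∀ i, p.1 i ≠ 0) (hy : ∀ j, p.2 j ≠ 0)
    (hxx : ∀ a b, a ≠ b → ‖t * (e b * (p.1 a / p.1 b))‖ < 1)
    (hyy : ∀ a b, a ≠ b → ‖q * (p.2 a / p.2 b)‖ < 1)
    (h : ∀ i j, c i * (p.1 i / p.2 j) ≠ 1) (h' : ∀ i j, c' i * (p.2 j / p.1 i) ≠ 1) :
    DifferentiableAt ℂ (Function.uncurry (twistNM q t e c c')) p := by
  have hm : DifferentiableAt ℂ (fun p : (Fin n → ℂ) × (Fin m → ℂ) => mixedDen c c' p.1 p.2) p :=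
    differentiableAt_mixedDen hx hy
  show DifferentiableAt ℂ (fun p : (Fin n → ℂ) × (Fin m → ℂ) =>
    twistWeight q t e p.1 * twistWeight t q 1 p.2 / mixedDen c c' p.1 p.2) p
  refine differentiableAt_div (DifferentiableAt.mul ?_ ?_) hm (mixedDen_ne_zero h h')
  · exact (differentiableAt_twistWeight hq hx hxx).comp p differentiableAt_fst
  · exact (differentiableAt_twistWeight ht hy (by simpa using hyy)).comp p differentiableAt_snd

lemma wRatio_mul {q t v : ℂ} (hq : ‖q‖ < 1) (hv : v ≠ 1) (hv' : ‖t * v‖ < 1) :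
    wRatio q t v * ((1 - t * v) / (1 - v)) = wRatio q t (q * v) := by
  have h1 : 1 - v ≠ 0 := sub_ne_zero.2 hv.symm
  have h2 : 1 - t * v ≠ 0 := by
    refine sub_ne_zero.2 fun h => ?_
    rw [← h] at hv'; simp at hv'
  rw [wRatio, wRatio, qPochInf_step hq v, qPochInf_step hq (t * v), mul_left_comm q t v]
  have h3 : qPochInf (t * (q * v)) q ≠ 0 := by
    apply qPochInf_ne_zero hq
    calc ‖t * (q * v)‖ = ‖q‖ * ‖t * v‖ := by simp only [norm_mul]; ring
      _ < 1 := by nlinarith [norm_nonneg q, norm_nonneg (t * v)]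
  rw [div_mul_div_comm, div_eq_div_iff (by positivity) h3]
  ring

lemma prod_offDiag_col {f : Fin N → ℂ} (i : Fin N) :
    ∏ a, ∏ b, (if a ≠ b then (if b = i then f a else 1) else 1) =
      ∏ a, if a ≠ i then f a else 1 := by
  refine prod_congr rfl fun a _ => ?_
  rw [prod_eq_single i]
  · simp
  · intro b _ hb; simp [hb]
  · simp

lemma prod_offDiag_row {f : Fin N → ℂ} (i : Fin N) :
    ∏ a, ∏ b, (if a ≠ b then (if a = i then f b else 1) else 1) =
      ∏ a, if a ≠ i then f a else 1 := by
  rw [prod_comm, ← prod_offDiag_col]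
  exact prod_congr rfl fun a _ => prod_congr rfl fun b _ => by simp only [ne_comm]

/-- The coefficient of the difference operator shifting the variable `x_i`. -/
def shiftCoeff (t c d : ℂ) (i : Fin n) (x : Fin n → ℂ) (y : Fin m → ℂ) : ℂ :=
  (∏ k, if k ≠ i then (1 - t * (x k / x i)) / (1 - x k / x i) else 1) *
    ∏ j, (1 - c * (y j / x i)) / (1 - d * (y j / x i))

lemma twistWeight_col {q t : ℂ} (hq : ‖q‖ < 1) (ht : ‖t‖ < 1) {z : Fin N → ℂ} {r : ℝ} (hr : 0 < r)
    (hz : ∀ i, ‖z i‖ = r) (hinj : Function.Injective z) (i : Fin N) :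
    twistWeight q t 1 z * (∏ k, if k ≠ i then (1 - t * (z k / z i)) / (1 - z k / z i) else 1) =
      twistWeight q t (Function.update 1 i q) z := by
  rw [← prod_offDiag_col, twistWeight, twistWeight, ← prod_mul_distrib]
  refine prod_congr rfl fun a _ => ?_
  rw [← prod_mul_distrib]
  refine prod_congr rfl fun b _ => ?_
  by_cases hab : a = b
  · simp [hab]
  simp only [ne_eq, hab, not_false_eq_true, if_true]
  by_cases hb : b = i
  · subst hb
    simp only [Pi.one_apply, one_mul, if_true, Function.update_self]
    refine wRatio_mul hq ?_ ?_
    · intro h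
      have : z b ≠ 0 := norm_pos_iff.1 (by rw [hz]; exact hr)
      exact hab (hinj ((div_eq_one_iff_eq this).1 h))
    · rw [norm_mul, norm_div, hz, hz, div_self hr.ne', mul_one]; exact ht
  · simp [hb]

lemma twistWeight_row {q t : ℂ} (hq : ‖q‖ < 1) (hq0 : q ≠ 0) (ht : ‖t‖ < 1) {z : Fin N → ℂ} {r : ℝ}
    (hr : 0 < r) (hz : ∀ i, ‖z i‖ = r) (hinj : Function.Injective z) (i : Fin N) :
    twistWeight q t 1 z * (∏ k, if k ≠ i then (1 - t * (z i / z k)) / (1 - z i / z k) else 1) =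
      twistWeight q t (Function.update 1 i q) (scaleOn {i} q z) := by
  rw [← prod_offDiag_row, twistWeight, twistWeight, ← prod_mul_distrib]
  refine prod_congr rfl fun a _ => ?_
  rw [← prod_mul_distrib]
  refine prod_congr rfl fun b _ => ?_
  by_cases hab : a = b
  · simp [hab]
  simp only [ne_eq, hab, not_false_eq_true, if_true]
  have hz0 : ∀ i, z i ≠ 0 := fun i => norm_pos_iff.1 (by rw [hz]; exact hr)
  by_cases ha : a = i
  · subst ha
    have hb : b ≠ a := fun h => hab h.symm
    simp only [Pi.one_apply, one_mul, if_true, scaleOn, hb, ne_eq, not_false_eq_true,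
      Function.update_of_ne, mem_singleton, if_false]
    rw [wRatio_mul hq, mul_div_assoc]
    · intro h
      exact hab (hinj ((div_eq_one_iff_eq (hz0 b)).1 h))
    · rw [norm_mul, norm_div, hz, hz, div_self hr.ne', mul_one]; exact ht
  · by_cases hb : b = i
    · subst hb
      simp only [Pi.one_apply, one_mul, scaleOn, ha, if_false, mem_singleton, if_true,
        Function.update_self, mul_one]
      congr 1
      field_simp [hz0 b]
    · simp [scaleOn, ha, hb]

lemma mixedDen_col {c d : ℂ} {x : Fin n → ℂ} {y : Fin m → ℂ} (i : Fin n)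
    (h : ∀ j, c * (y j / x i) ≠ 1) :
    mixedDen (fun _ => c) (Function.update (fun _ => c) i d) x y =
      mixedDen (fun _ => c) (fun _ => c) x y /
        ∏ j, (1 - c * (y j / x i)) / (1 - d * (y j / x i)) := by
  have e : ∏ j, (1 - c * (y j / x i)) / (1 - d * (y j / x i)) =
      ∏ a, if a = i then ∏ j, (1 - c * (y j / x a)) / (1 - d * (y j / x a)) else 1 := by simp
  rw [e, mixedDen, mixedDen, ← prod_div_distrib]
  refine prod_congr rfl fun a _ => ?_
  by_cases ha : a = i
  · subst ha
    simp only [if_true, Function.update_self]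
    rw [← prod_div_distrib]
    refine prod_congr rfl fun j _ => ?_
    have := sub_ne_zero.2 (h j).symm
    rw [div_div_eq_mul_div, eq_div_iff this]
    ring
  · simp [ha]

lemma mixedDen_row {q c : ℂ} (hq : q ≠ 0) {x : Fin n → ℂ} {y : Fin m → ℂ} (i : Fin n)
    (hx : x i ≠ 0) (h : ∀ j, c * (x i / y j) ≠ 1) :
    mixedDen (fun _ => c) (Function.update (fun _ => c) i (q * c)) (scaleOn {i} q x) y =
      mixedDen (fun _ => c) (fun _ => c) x y /
        ∏ j, (1 - c * (x i / y j)) / (1 - q * c * (x i / y j)) := by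
  have e : ∏ j, (1 - c * (x i / y j)) / (1 - q * c * (x i / y j)) =
      ∏ a, if a = i then ∏ j, (1 - c * (x a / y j)) / (1 - q * c * (x a / y j)) else 1 := by simp
  rw [e, mixedDen, mixedDen, ← prod_div_distrib]
  refine prod_congr rfl fun a _ => ?_
  by_cases ha : a = i
  · subst ha
    simp only [if_true, Function.update_self, scaleOn, mem_singleton]
    rw [← prod_div_distrib]
    refine prod_congr rfl fun j _ => ?_
    have := sub_ne_zero.2 (h j).symm
    rw [div_div_eq_mul_div, eq_div_iff this]
    have e2 : q * c * (y j / (q * x a)) = c * (y j / x a) := by field_simp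
    rw [e2]
    ring
  · simp [ha, scaleOn]

lemma shiftCoeff_inv {t c d : ℂ} (i : Fin n) (x : Fin n → ℂ) (y : Fin m → ℂ) :
    shiftCoeff t c d i (fun k => (x k)⁻¹) (fun j => (y j)⁻¹) =
      (∏ k, if k ≠ i then (1 - t * (x i / x k)) / (1 - x i / x k) else 1) *
        ∏ j, (1 - c * (x i / y j)) / (1 - d * (x i / y j)) := by
  simp only [shiftCoeff, inv_div_inv]

/-- Holomorphy on `(ℂ∖{0})^n × (ℂ∖{0})^m`. -/
def HolStar (f : (Fin n → ℂ) → (Fin m → ℂ) → ℂ) : Prop :=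
  ∀ p : (Fin n → ℂ) × (Fin m → ℂ), (∀ i, p.1 i ≠ 0) → (∀ j, p.2 j ≠ 0) →
    DifferentiableAt ℂ (Function.uncurry f) p

/-- The weight `Δ_{n,m}` multiplied by the coefficient of the `i`-th shift. -/
def shiftWt (q t c : ℂ) (i : Fin n) (x : Fin n → ℂ) (y : Fin m → ℂ) : ℂ :=
  twistNM q t (Function.update 1 i q) (fun _ => c) (Function.update (fun _ => c) i (q * c)) x y

/-- The relative position of the contours needed for shifting one `x`-variable by `q`. -/
structure ShiftOK (q c ξ ξ' : ℝ) : Prop where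
  pos : 0 < ξ
  pos' : 0 < ξ'
  left : ∀ u, q ≤ u → u ≤ 1 → c * (u * ξ) ≠ ξ'
  right : ∀ u, q ≤ u → u ≤ 1 → q * c * ξ' ≠ u * ξ
  base : c * ξ' ≠ ξ

lemma ne_one_of_norm {a b w : ℂ} {r s : ℝ} (hr : ‖a‖ = r) (hs : ‖b‖ = s) (hs0 : 0 < s)
    (h : ‖w‖ * r ≠ s) : w * (a / b) ≠ 1 := by
  intro e
  have := congrArg norm e
  rw [norm_mul, norm_div, hr, hs, norm_one, ← mul_div_assoc, div_eq_one_iff_eq hs0.ne'] at this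
  exact h this

lemma norm_ofReal_pos {r : ℝ} (h : 0 < r) : ‖(r : ℂ)‖ = r := by
  rw [norm_real, Real.norm_of_nonneg h.le]

lemma norm_scaleOn_singleton {x : Fin n → ℂ} {r : ℝ} (hx : ∀ i, ‖x i‖ = r) (i k : Fin n) (u : ℂ) :
    ‖scaleOn {i} u x k‖ = (if k = i then ‖u‖ else 1) * r := by
  by_cases h : k = i <;> simp [scaleOn, h, hx]

lemma differentiableAt_shiftWt (h : IsParam q t c) (hs : ShiftOK q c ξ ξ') (i : Fin n)
    {p : (Fin n → ℂ) × (Fin m → ℂ)} (hp : p ∈ torusSet n m ξ ξ') {u : ℂ} (hu : q ≤ ‖u‖)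
    (hu1 : ‖u‖ ≤ 1) :
    DifferentiableAt ℂ (Function.uncurry (shiftWt (q : ℂ) (t : ℂ) (c : ℂ) i))
      (scaleOn {i} u p.1, p.2) := by
  have hξ := hs.pos
  have hξ' := hs.pos'
  have hq := norm_ofReal_pos h.q_pos
  have ht := norm_ofReal_pos h.t_pos
  have hc := norm_ofReal_pos h.c_pos
  have hu0 : 0 < ‖u‖ := h.q_pos.trans_le hu
  have hX := norm_scaleOn_singleton hp.1 i (u := u)
  have hXpos : ∀ k, 0 < (if k = i then ‖u‖ else 1) * ξ := fun k => by
    split_ifs <;> positivity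
  have hleft := hs.left
  have hright := hs.right ‖u‖ hu hu1
  have hbase := hs.base
  refine differentiableAt_twistNM (by rw [hq]; exact h.q_lt) (by rw [ht]; exact h.t_lt)
    (fun k => norm_pos_iff.1 (by rw [hX]; exact hXpos k))
    (fun j => norm_pos_iff.1 (by rw [hp.2]; exact hξ')) ?_ ?_ ?_ ?_
  · intro a b hab
    simp only [norm_mul, norm_div, hX, ht]
    have h1 := h.t_lt
    have h0 := h.t_pos
    have hq0 := h.q_pos
    rw [mul_div_mul_right _ _ hξ.ne']
    by_cases hb : b = i
    · have ha : a ≠ i := fun h => hab (h.trans hb.symm)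
      simp only [hb, Function.update_self, ha, if_true, if_false, hq]
      have : q * (1 / ‖u‖) ≤ 1 := by
        rw [mul_one_div, div_le_one hu0]; exact hu
      nlinarith
    · simp only [hb, ne_eq, not_false_eq_true, Function.update_of_ne, if_false, Pi.one_apply,
        norm_one, one_mul, div_one]
      split_ifs <;> nlinarith
  · intro a b _
    rw [norm_mul, norm_div, hp.2, hp.2, div_self hξ'.ne', hq, mul_one]
    exact h.q_lt
  · intro k j
    refine ne_one_of_norm (hX k) (hp.2 j) hξ' ?_
    rw [hc]
    split_ifs
    · exact hleft _ hu hu1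
    · exact hleft 1 h.q_lt.le le_rfl
  · intro k j
    refine ne_one_of_norm (hp.2 j) (hX k) (hXpos k) ?_
    by_cases hk : k = i
    · subst hk
      simpa [hq, hc, abs_of_pos h.q_pos, abs_of_pos h.c_pos] using hright
    · simpa [hk, hc, abs_of_pos h.c_pos] using hbase

lemma HolStar.scaleOn {f : (Fin n → ℂ) → (Fin m → ℂ) → ℂ} (hf : HolStar f) (s : Finset (Fin n))
    {u : ℂ} (hu : u ≠ 0) : HolStar fun x y => f (scaleOn s u x) y := by
  intro p hx hy
  have h1 := hf (_root_.scaleOn s u p.1, p.2) (fun i => by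
    by_cases hi : i ∈ s <;> simp [_root_.scaleOn, hi, hx, hu]) hy
  refine h1.comp (f := fun p : (Fin n → ℂ) × (Fin m → ℂ) => (_root_.scaleOn s u p.1, p.2)) p ?_
  refine DifferentiableAt.prodMk ?_ differentiableAt_snd
  rw [differentiableAt_pi]
  intro i
  by_cases hi : i ∈ s <;> simp only [_root_.scaleOn, hi, if_true, if_false] <;> fun_prop

lemma torusInt_shiftWt (h : IsParam q t c) (hs : ShiftOK q c ξ ξ') (i : Fin n)
    {f : (Fin n → ℂ) → (Fin m → ℂ) → ℂ} (hf : HolStar f) :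
    torusInt ξ ξ' (fun x y => shiftWt (q : ℂ) t c i x y * f x y) =
      torusInt ξ ξ' (fun x y => shiftWt (q : ℂ) t c i (scaleOn {i} (q : ℂ) x) y *
        f (scaleOn {i} (q : ℂ) x) y) := by
  refine torusInt_scaleOn hs.pos hs.pos' {i} h.q_pos h.q_lt.le (F := fun x y =>
    shiftWt (q : ℂ) t c i x y * f x y) ?_
  intro p hp u hu hu1
  refine DifferentiableAt.mul (differentiableAt_shiftWt h hs i hp hu hu1) (hf _ ?_ ?_)
  · intro k
    rw [← norm_pos_iff, norm_scaleOn_singleton hp.1]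
    have := hs.pos
    have := h.q_pos.trans_le hu
    split_ifs <;> positivity
  · intro j
    rw [← norm_pos_iff, hp.2]
    exact hs.pos'

lemma wt_mul_shiftCoeff (h : IsParam q t c) (hs : ShiftOK q c ξ ξ') (i : Fin n)
    {p : (Fin n → ℂ) × (Fin m → ℂ)} (hp : p ∈ torusSet n m ξ ξ') (hx : Function.Injective p.1) :
    wt (q : ℂ) t c p.1 p.2 * shiftCoeff (t : ℂ) c (q * c) i p.1 p.2 =
      shiftWt (q : ℂ) t c i p.1 p.2 := by
  have hq := norm_ofReal_pos h.q_pos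
  have ht := norm_ofReal_pos h.t_pos
  have hc := norm_ofReal_pos h.c_pos
  rw [wt, twistNM, shiftWt, twistNM, shiftCoeff, mixedDen_col i fun j => ?_,
    ← twistWeight_col (by rw [hq]; exact h.q_lt) (by rw [ht]; exact h.t_lt) hs.pos hp.1 hx i,
    div_div_eq_mul_div]
  · ring
  · exact ne_one_of_norm (hp.2 j) (hp.1 i) hs.pos (by rw [hc]; exact hs.base)

lemma wt_mul_shiftCoeff_inv (h : IsParam q t c) (hs : ShiftOK q c ξ ξ') (i : Fin n)
    {p : (Fin n → ℂ) × (Fin m → ℂ)} (hp : p ∈ torusSet n m ξ ξ') (hx : Function.Injective p.1) :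
    wt (q : ℂ) t c p.1 p.2 *
        shiftCoeff (t : ℂ) c (q * c) i (fun k => (p.1 k)⁻¹) (fun j => (p.2 j)⁻¹) =
      shiftWt (q : ℂ) t c i (scaleOn {i} (q : ℂ) p.1) p.2 := by
  have hq := norm_ofReal_pos h.q_pos
  have ht := norm_ofReal_pos h.t_pos
  have hc := norm_ofReal_pos h.c_pos
  have hq0 : (q : ℂ) ≠ 0 := by exact_mod_cast h.q_pos.ne'
  have hx0 : p.1 i ≠ 0 := norm_pos_iff.1 (by rw [hp.1]; exact hs.pos)
  rw [wt, twistNM, shiftWt, twistNM, shiftCoeff_inv, mixedDen_row hq0 i hx0 fun j => ?_,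
    ← twistWeight_row (by rw [hq]; exact h.q_lt) hq0 (by rw [ht]; exact h.t_lt) hs.pos hp.1 hx i,
    div_div_eq_mul_div]
  · ring
  · exact ne_one_of_norm (hp.1 i) (hp.2 j) hs.pos' (by
      rw [hc]; simpa using hs.left 1 h.q_lt.le le_rfl)

end Weight

section WeightedIntegral

variable {N n m : ℕ} {q t c : ℝ} {ξ ξ' : ℝ}

lemma mixedDen_swap {c : ℂ} (hc : c ≠ 0) {x : Fin n → ℂ} {y : Fin m → ℂ} (hx : ∀ i, x i ≠ 0)
    (hy : ∀ j, y j ≠ 0) :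
    mixedDen (fun _ => c) (fun _ => c) x y =
      (c ^ 2) ^ (n * m) * mixedDen (fun _ => c⁻¹) (fun _ => c⁻¹) y x := by
  have e : (c ^ 2) ^ (n * m) = ∏ _i : Fin n, ∏ _j : Fin m, c ^ 2 := by simp [pow_mul, mul_comm n m]
  unfold mixedDen
  rw [e, prod_comm (s := (univ : Finset (Fin m))), ← prod_mul_distrib]
  refine prod_congr rfl fun i _ => ?_
  rw [← prod_mul_distrib]
  refine prod_congr rfl fun j _ => ?_
  have := hx i
  have := hy j
  field_simp
  ring

lemma wt_swap {q t c : ℂ} (hc : c ≠ 0) {x : Fin n → ℂ} {y : Fin m → ℂ} (hx : ∀ i, x i ≠ 0)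
    (hy : ∀ j, y j ≠ 0) :
    wt q t c x y = ((c ^ 2) ^ (n * m))⁻¹ * wt t q c⁻¹ y x := by
  rw [wt, wt, twistNM, twistNM, mixedDen_swap hc hx hy]
  field_simp

lemma wt_inv (q t c : ℂ) (x : Fin n → ℂ) (y : Fin m → ℂ) : wt q t c x⁻¹ y⁻¹ = wt q t c x y := by
  have key : ∀ {N : ℕ} (q t : ℂ) (z : Fin N → ℂ), twistWeight q t 1 z⁻¹ = twistWeight q t 1 z := by
    intro N q t z
    unfold twistWeight
    rw [prod_comm]
    refine prod_congr rfl fun a _ => prod_congr rfl fun b _ => ?_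
    simp only [Pi.inv_apply, inv_div_inv, Pi.one_apply, ne_comm (a := b)]
  rw [wt, wt, twistNM, twistNM, key, key]
  congr 1
  refine prod_congr rfl fun a _ => prod_congr rfl fun b _ => ?_
  simp only [Pi.inv_apply, inv_div_inv]
  ring

lemma conj_wt (q t c : ℝ) (x : Fin n → ℂ) (y : Fin m → ℂ) :
    starRingEnd ℂ (wt (q : ℂ) t c x y) =
      wt (q : ℂ) t c (fun i => starRingEnd ℂ (x i)) (fun j => starRingEnd ℂ (y j)) := by
  simp only [wt, twistNM, twistWeight, mixedDen, wRatio, map_div₀, map_mul, map_prod, map_sub,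
    map_one, conj_ofReal, apply_ite (starRingEnd ℂ), conj_qPochInf, Pi.one_apply]

lemma continuousOn_wt (h : IsParam q t c) (hξ : 0 < ξ) (hξ' : 0 < ξ') (h1 : c * ξ ≠ ξ')
    (h2 : c * ξ' ≠ ξ) :
    ContinuousOn (Function.uncurry (wt (q : ℂ) t c)) (torusSet n m ξ ξ') := by
  intro p hp
  have hq := norm_ofReal_pos h.q_pos
  have ht := norm_ofReal_pos h.t_pos
  have hc := norm_ofReal_pos h.c_pos
  refine (differentiableAt_twistNM (by rw [hq]; exact h.q_lt) (by rw [ht]; exact h.t_lt)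
    (fun k => norm_pos_iff.1 (by rw [hp.1]; exact hξ))
    (fun j => norm_pos_iff.1 (by rw [hp.2]; exact hξ')) ?_ ?_ ?_ ?_).continuousAt.continuousWithinAt
  · intro a b _
    simpa [hp.1, hξ.ne', abs_of_pos h.t_pos] using h.t_lt
  · intro a b _
    simpa [hp.2, hξ'.ne', abs_of_pos h.q_pos] using h.q_lt
  · exact fun i j => ne_one_of_norm (hp.1 i) (hp.2 j) hξ' (by rwa [hc])
  · exact fun i j => ne_one_of_norm (hp.2 j) (hp.1 i) hξ (by rwa [hc])

lemma HolStar.continuousOn {f : (Fin n → ℂ) → (Fin m → ℂ) → ℂ} (hf : HolStar f) (hξ : 0 < ξ)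
    (hξ' : 0 < ξ') : ContinuousOn (Function.uncurry f) (torusSet n m ξ ξ') := fun p hp =>
  (hf p (fun k => norm_pos_iff.1 (by rw [hp.1]; exact hξ))
    (fun k => norm_pos_iff.1 (by rw [hp.2]; exact hξ'))).continuousAt.continuousWithinAt

lemma HolStar.mul {f g : (Fin n → ℂ) → (Fin m → ℂ) → ℂ} (hf : HolStar f) (hg : HolStar g) :
    HolStar fun x y => f x y * g x y := fun p hx hy => (hf p hx hy).mul (hg p hx hy)

lemma HolStar.const_mul {f : (Fin n → ℂ) → (Fin m → ℂ) → ℂ} (hf : HolStar f) (a : ℂ) :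
    HolStar fun x y => a * f x y := fun p hx hy => (hf p hx hy).const_mul a

lemma HolStar.sum {ι : Type*} {s : Finset ι} {f : ι → (Fin n → ℂ) → (Fin m → ℂ) → ℂ}
    (hf : ∀ i ∈ s, HolStar (f i)) : HolStar fun x y => ∑ i ∈ s, f i x y := fun p hx hy =>
  DifferentiableAt.fun_sum fun i hi => hf i hi p hx hy

lemma HolStar.swap {f : (Fin n → ℂ) → (Fin m → ℂ) → ℂ} (hf : HolStar f) :
    HolStar fun y x => f x y := fun p hy hx =>
  (hf (p.2, p.1) hx hy).comp (f := fun p : (Fin m → ℂ) × (Fin n → ℂ) => (p.2, p.1)) p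
    (differentiableAt_snd.prodMk differentiableAt_fst)

lemma HolStar.inv {f : (Fin n → ℂ) → (Fin m → ℂ) → ℂ} (hf : HolStar f) :
    HolStar fun x y => f x⁻¹ y⁻¹ := by
  intro p hx hy
  refine (hf (p.1⁻¹, p.2⁻¹) (fun i => inv_ne_zero (hx i)) fun j => inv_ne_zero (hy j)).comp
    (f := fun p : (Fin n → ℂ) × (Fin m → ℂ) => (p.1⁻¹, p.2⁻¹)) p ?_
  refine DifferentiableAt.prodMk ?_ ?_ <;> rw [differentiableAt_pi] <;> intro i
  · simp only [Pi.inv_apply]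
    exact DifferentiableAt.inv (by fun_prop) (hx i)
  · simp only [Pi.inv_apply]
    exact DifferentiableAt.inv (by fun_prop) (hy i)

/-- The integral of `f` over the torus against the weight `Δ_{n,m}`. -/
def wInt (q t c ξ ξ' : ℝ) (f : (Fin n → ℂ) → (Fin m → ℂ) → ℂ) : ℂ :=
  torusInt ξ ξ' fun x y => wt (q : ℂ) t c x y * f x y

lemma wInt_swap (hc : c ≠ 0) (hξ : 0 < ξ) (hξ' : 0 < ξ') (f : (Fin n → ℂ) → (Fin m → ℂ) → ℂ) :
    wInt q t c ξ ξ' f =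
      (((c : ℂ) ^ 2) ^ (n * m))⁻¹ * wInt t q c⁻¹ ξ' ξ (fun y x => f x y) := by
  unfold wInt
  rw [torusInt_swap, ← torusInt_const_mul]
  refine torusInt_congr hξ' hξ fun p hp => ?_
  rw [wt_swap (by exact_mod_cast hc) (fun k => norm_pos_iff.1 (by rw [hp.2]; exact hξ))
    (fun k => norm_pos_iff.1 (by rw [hp.1]; exact hξ')), ofReal_inv]
  ring

lemma wInt_inv (f : (Fin n → ℂ) → (Fin m → ℂ) → ℂ) :
    wInt q t c ξ ξ' (fun x y => f x⁻¹ y⁻¹) = wInt q t c ξ⁻¹ ξ'⁻¹ f := by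
  unfold wInt
  rw [← torusInt_inv]
  simp only [← Pi.inv_def, wt_inv]

lemma conj_wInt {f : (Fin n → ℂ) → (Fin m → ℂ) → ℂ}
    (hf : ∀ x y, starRingEnd ℂ (f x y) =
      f (fun i => starRingEnd ℂ (x i)) (fun j => starRingEnd ℂ (y j))) :
    starRingEnd ℂ (wInt q t c ξ ξ' f) = wInt q t c ξ ξ' f := by
  unfold wInt
  exact conj_torusInt _ fun x y => by rw [map_mul, conj_wt, hf]

lemma torusInt_scale_univ (r : ℝ) (F : (Fin n → ℂ) → (Fin m → ℂ) → ℂ) :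
    torusInt ξ ξ' (fun x y => F (scaleOn univ (r : ℂ) x) y) = torusInt (r * ξ) ξ' F := by
  unfold torusInt
  have : ∀ g : Fin n → AddCircle (2 * Real.pi),
      scaleOn univ (r : ℂ) (torusPt ξ g) = torusPt (r * ξ) g := fun g => by
    ext i; simp [scaleOn, torusPt, mul_assoc]
  simp only [this]

lemma wInt_shrink (h : IsParam q t c) {ξ₁ ξ₂ : ℝ} (h1 : 0 < ξ₁) (h12 : ξ₁ ≤ ξ₂) (hξ' : 0 < ξ')
    (hs : ∀ s, ξ₁ ≤ s → s ≤ ξ₂ → c * s ≠ ξ' ∧ c * ξ' ≠ s)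
    {f : (Fin n → ℂ) → (Fin m → ℂ) → ℂ} (hf : HolStar f) :
    wInt q t c ξ₂ ξ' f = wInt q t c ξ₁ ξ' f := by
  have h2 : 0 < ξ₂ := h1.trans_le h12
  unfold wInt
  rw [torusInt_scaleOn (r := ξ₁ / ξ₂) h2 hξ' univ (div_pos h1 h2) ((div_le_one h2).2 h12)]
  · rw [torusInt_scale_univ (ξ₁ / ξ₂) fun x y => wt (q : ℂ) t c x y * f x y,
      div_mul_cancel₀ _ h2.ne']
  · intro p hp u hu hu1
    have hq := norm_ofReal_pos h.q_pos
    have ht := norm_ofReal_pos h.t_pos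
    have hc := norm_ofReal_pos h.c_pos
    have hu0 : 0 < ‖u‖ := (div_pos h1 h2).trans_le hu
    have hX : ∀ i, ‖scaleOn univ u p.1 i‖ = ‖u‖ * ξ₂ := fun i => by simp [scaleOn, hp.1]
    have hX0 : ∀ i, scaleOn univ u p.1 i ≠ 0 := fun i => by
      rw [← norm_pos_iff, hX]; positivity
    have hY0 : ∀ j, p.2 j ≠ 0 := fun j => by rw [← norm_pos_iff, hp.2]; exact hξ'
    have hs' := hs (‖u‖ * ξ₂) (by rwa [div_le_iff₀ h2] at hu) (by nlinarith)
    have hpos : 0 < ‖u‖ * ξ₂ := by positivity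
    refine DifferentiableAt.mul (differentiableAt_twistNM (by rw [hq]; exact h.q_lt)
      (by rw [ht]; exact h.t_lt) hX0 hY0 ?_ ?_ ?_ ?_) (hf _ hX0 hY0)
    · intro a b _
      rw [Pi.one_apply, one_mul, norm_mul, norm_div, hX, hX, div_self hpos.ne', mul_one, ht]
      exact h.t_lt
    · intro a b _
      rw [norm_mul, norm_div, hp.2, hp.2, div_self hξ'.ne', mul_one, hq]
      exact h.q_lt
    · exact fun i j => ne_one_of_norm (hX i) (hp.2 j) hξ' (by rw [hc]; exact hs'.1)
    · exact fun i j => ne_one_of_norm (hp.2 j) (hX i) hpos (by rw [hc]; exact hs'.2)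

/-- `ξ` is large compared to `ξ′`. -/
def Far (c ξ ξ' : ℝ) : Prop := c * ξ' < ξ ∧ ξ' < c * ξ

lemma wInt_far_left (h : IsParam q t c) {ξ₁ ξ₂ : ℝ} (h1 : 0 < ξ₁) (h12 : ξ₁ ≤ ξ₂) (hξ' : 0 < ξ')
    (hs : Far c ξ₁ ξ') {f : (Fin n → ℂ) → (Fin m → ℂ) → ℂ} (hf : HolStar f) :
    wInt q t c ξ₂ ξ' f = wInt q t c ξ₁ ξ' f := by
  refine wInt_shrink h h1 h12 hξ' (fun s hs1 _ => ⟨?_, ?_⟩) hf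
  · have := hs.2; have := h.c_pos; nlinarith
  · have := hs.1; exact (this.trans_le hs1).ne

lemma wInt_far_right (h : IsParam q t c) {ξ₁ ξ₂ : ℝ} (h1 : 0 < ξ₁) (h12 : ξ₁ ≤ ξ₂) (hξ : 0 < ξ)
    (hs : Far c ξ ξ₂) {f : (Fin n → ℂ) → (Fin m → ℂ) → ℂ} (hf : HolStar f) :
    wInt q t c ξ ξ₂ f = wInt q t c ξ ξ₁ f := by
  have hc := h.c_pos
  have h2 : 0 < ξ₂ := h1.trans_le h12
  rw [wInt_swap hc.ne' hξ h2, wInt_swap hc.ne' hξ h1]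
  congr 1
  refine wInt_shrink h.swap h1 h12 hξ (fun s hs1 hs2 => ⟨?_, ?_⟩) hf.swap
  · rw [inv_mul_eq_div, Ne, div_eq_iff hc.ne']
    have := hs.2; nlinarith
  · rw [inv_mul_eq_div, Ne, div_eq_iff hc.ne']
    have := hs.1; nlinarith

lemma wInt_far (h : IsParam q t c) {ξ₁ ξ₁' ξ₂ ξ₂' : ℝ} (h1 : 0 < ξ₁) (h1' : 0 < ξ₁') (h2 : 0 < ξ₂)
    (h2' : 0 < ξ₂') (hf1 : Far c ξ₁ ξ₁') (hf2 : Far c ξ₂ ξ₂')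
    {f : (Fin n → ℂ) → (Fin m → ℂ) → ℂ} (hf : HolStar f) :
    wInt q t c ξ₁ ξ₁' f = wInt q t c ξ₂ ξ₂' f := by
  wlog hle : ξ₁' ≤ ξ₂' generalizing ξ₁ ξ₁' ξ₂ ξ₂'
  · exact (this h2 h2' h1 h1' hf2 hf1 (le_of_not_ge hle)).symm
  have hc := h.c_pos
  have hm : 0 < max ξ₁ ξ₂ := h1.trans_le (le_max_left _ _)
  rw [← wInt_far_left h h1 (le_max_left ξ₁ ξ₂) h1' hf1 hf,
    ← wInt_far_left h h2 (le_max_right ξ₁ ξ₂) h2' hf2 hf]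
  refine (wInt_far_right h h1' hle hm ⟨hf2.1.trans_le (le_max_right _ _), ?_⟩ hf).symm
  exact hf2.2.trans_le (by gcongr; exact le_max_right _ _)

/-- The first-order difference operator acting on functions of `(x, y)`. -/
def hOp (κ κ' q t c : ℂ) (Φ : (Fin n → ℂ) → (Fin m → ℂ) → ℂ) (x : Fin n → ℂ) (y : Fin m → ℂ) : ℂ :=
  κ * ∑ i, shiftCoeff t c (q * c) i x y * Φ (scaleOn {i} q⁻¹ x) y +
    κ' * ∑ j, shiftCoeff q c⁻¹ (t * c⁻¹) j y⁻¹ x⁻¹ * Φ x (scaleOn {j} t y)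

lemma wInt_shiftCoeff (h : IsParam q t c) (hs : ShiftOK q c ξ ξ') (i : Fin n)
    {f : (Fin n → ℂ) → (Fin m → ℂ) → ℂ} (hf : HolStar f) :
    wInt q t c ξ ξ' (fun x y => shiftCoeff (t : ℂ) c (q * c) i x y * f x y) =
      wInt q t c ξ ξ' (fun x y => shiftCoeff (t : ℂ) c (q * c) i x⁻¹ y⁻¹ *
        f (scaleOn {i} (q : ℂ) x) y) := by
  have h1 := torusInt_shiftWt h hs i hf
  unfold wInt
  refine Eq.trans ?_ (h1.trans ?_)
  · refine torusInt_congr_ae hs.pos hs.pos' fun p hp hx _ => ?_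
    rw [← mul_assoc, wt_mul_shiftCoeff h hs i hp hx]
  · refine torusInt_congr_ae hs.pos hs.pos' fun p hp hx _ => ?_
    rw [← mul_assoc]
    exact congrArg (· * _) (wt_mul_shiftCoeff_inv h hs i hp hx).symm

lemma wInt_shiftCoeff' (h : IsParam q t c) (hs : ShiftOK t c⁻¹ ξ' ξ) (j : Fin m)
    {f : (Fin n → ℂ) → (Fin m → ℂ) → ℂ} (hf : HolStar f) :
    wInt q t c ξ ξ' (fun x y => shiftCoeff (q : ℂ) (c : ℂ)⁻¹ (t * (c : ℂ)⁻¹) j y x * f x y) =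
      wInt q t c ξ ξ' (fun x y => shiftCoeff (q : ℂ) (c : ℂ)⁻¹ (t * (c : ℂ)⁻¹) j y⁻¹ x⁻¹ *
        f x (scaleOn {j} (t : ℂ) y)) := by
  have h1 := wInt_shiftCoeff h.swap hs j hf.swap
  rw [ofReal_inv] at h1
  rw [wInt_swap h.c_pos.ne' hs.pos' hs.pos, wInt_swap h.c_pos.ne' hs.pos' hs.pos, h1]

/-- Integrability of `F` over the torus. -/
def IntegrableTorus (n m : ℕ) (ξ ξ' : ℝ) (F : (Fin n → ℂ) → (Fin m → ℂ) → ℂ) : Prop :=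
  Integrable fun g : TorusParam n m => F (torusPt ξ g.1) (torusPt ξ' g.2)

lemma IntegrableTorus.swap {F : (Fin n → ℂ) → (Fin m → ℂ) → ℂ}
    (hF : IntegrableTorus m n ξ' ξ fun y x => F x y) : IntegrableTorus n m ξ ξ' F :=
  Integrable.swap (f := fun z : (Fin m → AddCircle (2 * Real.pi)) × (Fin n → AddCircle (2 * Real.pi))
    => F (torusPt ξ z.2) (torusPt ξ' z.1)) hF

lemma IntegrableTorus.congr (hξ : 0 < ξ) (hξ' : 0 < ξ') {F F' : (Fin n → ℂ) → (Fin m → ℂ) → ℂ}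
    (hF : IntegrableTorus n m ξ ξ' F) (h : ∀ p ∈ torusSet n m ξ ξ', Function.Injective p.1 →
      Function.Injective p.2 → F p.1 p.2 = F' p.1 p.2) : IntegrableTorus n m ξ ξ' F' := by
  refine Integrable.congr hF ?_
  filter_upwards [ae_injective_torusPt hξ hξ'] with g hg
  exact h _ (torusPt_mem hξ hξ' g) hg.1 hg.2

lemma integrableTorus_shiftCoeff (h : IsParam q t c) (hs : ShiftOK q c ξ ξ') (i : Fin n)
    {f : (Fin n → ℂ) → (Fin m → ℂ) → ℂ} (hf : HolStar f) :
    IntegrableTorus n m ξ ξ' fun x y =>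
      wt (q : ℂ) t c x y * (shiftCoeff (t : ℂ) c (q * c) i x y * f x y) := by
  have h0 : IntegrableTorus n m ξ ξ' fun x y => shiftWt (q : ℂ) t c i x y * f x y := by
    refine integrable_torus (F := fun x y => shiftWt (q : ℂ) t c i x y * f x y) hs.pos hs.pos'
      (ContinuousOn.mul ?_ (hf.continuousOn hs.pos hs.pos'))
    intro p hp
    have := differentiableAt_shiftWt h hs i hp (u := 1) (by simpa using h.q_lt.le) (by simp)
    have e : scaleOn {i} 1 p.1 = p.1 := by ext; simp [scaleOn]
    rw [e] at this
    exact this.continuousAt.continuousWithinAt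
  refine h0.congr hs.pos hs.pos' fun p hp hx _ => ?_
  rw [← mul_assoc, wt_mul_shiftCoeff h hs i hp hx]

lemma integrableTorus_shiftCoeff_inv (h : IsParam q t c) (hs : ShiftOK q c ξ ξ') (i : Fin n)
    {f : (Fin n → ℂ) → (Fin m → ℂ) → ℂ} (hf : HolStar f) :
    IntegrableTorus n m ξ ξ' fun x y =>
      wt (q : ℂ) t c x y * (shiftCoeff (t : ℂ) c (q * c) i x⁻¹ y⁻¹ * f x y) := by
  have h0 : IntegrableTorus n m ξ ξ' fun x y =>
      shiftWt (q : ℂ) t c i (scaleOn {i} (q : ℂ) x) y * f x y := by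
    refine integrable_torus (F := fun x y => shiftWt (q : ℂ) t c i (scaleOn {i} (q : ℂ) x) y * f x y)
      hs.pos hs.pos' (ContinuousOn.mul ?_ (hf.continuousOn hs.pos hs.pos'))
    intro p hp
    have hq := norm_ofReal_pos h.q_pos
    have := (differentiableAt_shiftWt h hs i hp (u := q) hq.ge (hq.trans_le h.q_lt.le)).continuousAt
    refine (ContinuousAt.comp (f := fun p : (Fin n → ℂ) × (Fin m → ℂ) =>
      (scaleOn {i} (q : ℂ) p.1, p.2)) this ?_).continuousWithinAt
    refine ContinuousAt.prodMk ?_ continuousAt_snd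
    rw [continuousAt_pi]
    intro k
    by_cases hk : k ∈ ({i} : Finset (Fin n)) <;> simp only [scaleOn, hk, if_true, if_false] <;>
      fun_prop
  refine h0.congr hs.pos hs.pos' fun p hp hx _ => ?_
  rw [← mul_assoc]
  exact congrArg (· * _) (wt_mul_shiftCoeff_inv h hs i hp hx).symm

lemma integrableTorus_swap (h : IsParam q t c) (hξ : 0 < ξ) (hξ' : 0 < ξ')
    {F : (Fin n → ℂ) → (Fin m → ℂ) → ℂ}
    (hF : IntegrableTorus m n ξ' ξ fun y x => wt (t : ℂ) q (c : ℂ)⁻¹ y x * F x y) :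
    IntegrableTorus n m ξ ξ' fun x y => wt (q : ℂ) t c x y * F x y := by
  have h0 : IntegrableTorus m n ξ' ξ fun y x =>
      (((c : ℂ) ^ 2) ^ (n * m))⁻¹ * (wt (t : ℂ) q (c : ℂ)⁻¹ y x * F x y) :=
    Integrable.const_mul hF _
  refine IntegrableTorus.swap (h0.congr hξ' hξ fun p hp _ _ => ?_)
  rw [wt_swap (x := p.2) (y := p.1) (c := (c : ℂ)) (by exact_mod_cast h.c_pos.ne')
    (fun k => norm_pos_iff.1 (by rw [hp.2]; exact hξ))
    (fun k => norm_pos_iff.1 (by rw [hp.1]; exact hξ'))]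
  ring

lemma wInt_linear {ι ι' : Type*} {s : Finset ι} {s' : Finset ι'} (κ κ' : ℂ)
    {F : ι → (Fin n → ℂ) → (Fin m → ℂ) → ℂ} {G : ι' → (Fin n → ℂ) → (Fin m → ℂ) → ℂ}
    (hF : ∀ i ∈ s, IntegrableTorus n m ξ ξ' fun x y => wt (q : ℂ) t c x y * F i x y)
    (hG : ∀ i ∈ s', IntegrableTorus n m ξ ξ' fun x y => wt (q : ℂ) t c x y * G i x y) :
    wInt q t c ξ ξ' (fun x y => κ * ∑ i ∈ s, F i x y + κ' * ∑ i ∈ s', G i x y) =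
      κ * ∑ i ∈ s, wInt q t c ξ ξ' (F i) + κ' * ∑ i ∈ s', wInt q t c ξ ξ' (G i) := by
  unfold wInt torusInt
  rw [← integral_finsetSum _ hF, ← integral_finsetSum _ hG, ← integral_const_mul,
    ← integral_const_mul, ← integral_add]
  · refine integral_congr_ae (.of_forall fun g => ?_)
    simp only [mul_add, mul_sum, mul_left_comm]
  · exact (integrable_finsetSum _ hF).const_mul _
  · exact (integrable_finsetSum _ hG).const_mul _

lemma scaleOn_inv (s : Finset (Fin n)) (u : ℂ) (x : Fin n → ℂ) :
    (scaleOn s u x)⁻¹ = scaleOn s u⁻¹ x⁻¹ := by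
  ext i
  by_cases h : i ∈ s <;> simp [scaleOn, h, mul_comm]

lemma scaleOn_cancel (s : Finset (Fin n)) {u v : ℂ} (h : u * v = 1) (x : Fin n → ℂ) :
    scaleOn s u (scaleOn s v x) = x := by
  ext i
  by_cases hi : i ∈ s <;> simp [scaleOn, hi, ← mul_assoc, h]

theorem wInt_hOp_mul (h : IsParam q t c) (hs : ShiftOK q c ξ ξ') (hs' : ShiftOK t c⁻¹ ξ' ξ)
    (κ κ' : ℂ) {Φ R : (Fin n → ℂ) → (Fin m → ℂ) → ℂ} (hΦ : HolStar Φ) (hR : HolStar R) :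
    wInt q t c ξ ξ' (fun x y => hOp κ κ' (q : ℂ) t c Φ x y * R x⁻¹ y⁻¹) =
      wInt q t c ξ ξ' (fun x y => Φ x y * hOp κ κ' (q : ℂ) t c R x⁻¹ y⁻¹) := by
  have hq0 : (q : ℂ) ≠ 0 := by exact_mod_cast h.q_pos.ne'
  have ht0 : (t : ℂ) ≠ 0 := by exact_mod_cast h.t_pos.ne'
  let f : Fin n → (Fin n → ℂ) → (Fin m → ℂ) → ℂ := fun i x y =>
    Φ (scaleOn {i} (q : ℂ)⁻¹ x) y * R x⁻¹ y⁻¹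
  let g : Fin m → (Fin n → ℂ) → (Fin m → ℂ) → ℂ := fun j x y =>
    Φ x y * R x⁻¹ (scaleOn {j} (t : ℂ) y⁻¹)
  let f' : Fin n → (Fin n → ℂ) → (Fin m → ℂ) → ℂ := fun i x y =>
    Φ x y * R (scaleOn {i} (q : ℂ)⁻¹ x⁻¹) y⁻¹
  let g' : Fin m → (Fin n → ℂ) → (Fin m → ℂ) → ℂ := fun j x y =>
    Φ x (scaleOn {j} (t : ℂ) y) * R x⁻¹ y⁻¹
  have hf : ∀ i, HolStar (f i) := fun i => (hΦ.scaleOn {i} (inv_ne_zero hq0)).mul hR.inv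
  have hf' : ∀ i, HolStar (f' i) := fun i => hΦ.mul (hR.scaleOn {i} (inv_ne_zero hq0)).inv
  have hg : ∀ j, HolStar (g j) := fun j => hΦ.mul (hR.swap.scaleOn {j} ht0).swap.inv
  have hg' : ∀ j, HolStar (g' j) := fun j => (hΦ.swap.scaleOn {j} ht0).swap.mul hR.inv
  have hff' : ∀ i x y, f i (scaleOn {i} (q : ℂ) x) y = f' i x y := fun i x y => by
    simp only [f, f', scaleOn_cancel _ (inv_mul_cancel₀ hq0), scaleOn_inv]
  have hgg' : ∀ j x y, g j x (scaleOn {j} (t : ℂ) y) = g' j x y := fun j x y => by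
    simp only [g, g', scaleOn_inv, scaleOn_cancel _ (mul_inv_cancel₀ ht0)]
  trans κ * ∑ i, wInt q t c ξ ξ' (fun x y => shiftCoeff (t : ℂ) c (q * c) i x y * f i x y) +
    κ' * ∑ j, wInt q t c ξ ξ' (fun x y =>
      shiftCoeff (q : ℂ) (c : ℂ)⁻¹ (t * (c : ℂ)⁻¹) j y⁻¹ x⁻¹ * g' j x y)
  · rw [← wInt_linear]
    · simp only [hOp, f, g', add_mul, sum_mul, mul_assoc]
    · exact fun i _ => integrableTorus_shiftCoeff h hs i (hf i)
    · intro j _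
      refine integrableTorus_swap h hs.pos hs.pos' ?_
      have := integrableTorus_shiftCoeff_inv h.swap hs' j (hg' j).swap
      rwa [ofReal_inv] at this
  trans κ * ∑ i, wInt q t c ξ ξ' (fun x y => shiftCoeff (t : ℂ) c (q * c) i x⁻¹ y⁻¹ * f' i x y) +
    κ' * ∑ j, wInt q t c ξ ξ' (fun x y =>
      shiftCoeff (q : ℂ) (c : ℂ)⁻¹ (t * (c : ℂ)⁻¹) j y x * g j x y)
  · congr 2
    · refine sum_congr rfl fun i _ => ?_
      simp only [wInt_shiftCoeff h hs i (hf i), hff']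
    · refine sum_congr rfl fun j _ => ?_
      simp only [wInt_shiftCoeff' h hs' j (hg j), hgg']
  · rw [← wInt_linear]
    · simp only [hOp, f', g, mul_add, mul_sum, inv_inv]
      congr 1
      funext x y
      congr 1 <;> exact sum_congr rfl fun i _ => by ring
    · exact fun i _ => integrableTorus_shiftCoeff_inv h hs i (hf' i)
    · intro j _
      refine integrableTorus_swap h hs.pos hs.pos' ?_
      have := integrableTorus_shiftCoeff h.swap hs' j (hg j).swap
      rwa [ofReal_inv] at this

end WeightedIntegral

section Lagrange

/-- The partial-fraction identity behind the kernel identity. -/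
lemma sum_one_sub_mul_prod_div {K ι : Type*} [Field K] [Fintype ι] [DecidableEq ι] (s ρ : ι → K)
    (hs : Function.Injective s) (h0 : ∀ k, s k ≠ 0) :
    ∑ k, (1 - ρ k) * ∏ l ∈ univ.erase k, (s k - ρ l * s l) / (s k - s l) = 1 - ∏ k, ρ k := by
  let P : Polynomial K := ∏ l, (Polynomial.X - Polynomial.C (ρ l * s l))
  let v : Option ι → K := fun o => o.elim 0 s
  have hv : Function.Injective v := by
    rintro (_ | a) (_ | b) h
    · rfl
    · exact absurd h.symm (h0 b)
    · exact absurd h (h0 a)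
    · exact congrArg some (hs h)
  have hP : P.Monic := Polynomial.monic_prod_of_monic _ _ fun l _ => Polynomial.monic_X_sub_C _
  have hdeg : P.degree = Fintype.card ι := by
    rw [Polynomial.degree_prod]; simp only [Polynomial.degree_X_sub_C]; simp
  have key := Lagrange.leadingCoeff_eq_sum (s := (univ : Finset (Option ι))) (v := v) (P := P)
    hv.injOn (by rw [hdeg]; simp)
  rw [hP.leadingCoeff, ← add_sum_erase _ _ (mem_univ none)] at key
  have hev : ∀ z, P.eval z = ∏ l, (z - ρ l * s l) := fun z => by
    simp [P, Polynomial.eval_prod]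
  have e0 : (univ : Finset (Option ι)).erase none = univ.map Function.Embedding.some := by
    ext o; cases o <;> simp
  have e1 : ∀ k : ι, (univ : Finset (Option ι)).erase (some k) =
      insert none ((univ.erase k).map Function.Embedding.some) := by
    intro k; ext o; cases o <;> simp [eq_comm]
  have h1 : P.eval (v none) / ∏ j ∈ univ.erase none, (v none - v j) = ∏ k, ρ k := by
    rw [hev, e0, prod_map, ← prod_div_distrib]
    refine prod_congr rfl fun k _ => ?_
    simp only [v, Function.Embedding.some_apply, Option.elim]
    have := h0 k
    field_simp
    ring
  have h2 : ∀ k : ι, P.eval (v (some k)) / ∏ j ∈ univ.erase (some k), (v (some k) - v j) =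
      (1 - ρ k) * ∏ l ∈ univ.erase k, (s k - ρ l * s l) / (s k - s l) := by
    intro k
    rw [hev, e1, prod_insert (by simp), prod_map, ← mul_prod_erase _ _ (mem_univ k),
      prod_div_distrib]
    simp only [v, Function.Embedding.some_apply, Option.elim, sub_zero]
    have := h0 k
    rw [mul_div_mul_comm, ← one_sub_mul, mul_div_cancel_right₀ _ this]
  rw [h1, e0, sum_map] at key
  simp only [Function.Embedding.some_apply, h2] at key
  exact eq_sub_of_add_eq' key.symm

end Lagrange

section FieldKernel

variable {K : Type*} [Field K] {N n m : ℕ}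

lemma div_eq_mul_div_of_eq {u v u' v' r l : K} (hl : l ≠ 0) (hu : u = l * (r * u'))
    (hv : v = l * v') : u / v = r * (u' / v') := by
  rw [hu, hv, mul_div_mul_left _ _ hl, mul_div_assoc]

lemma field_kernel_identity (q t c : K) (hq : q ≠ 0) (ht : t ≠ 0) (hc : c ≠ 0)
    (hrel : q * c ^ 2 = t) (Z : Fin N → K) (x : Fin n → K) (y : Fin m → K)
    (hZ : Function.Injective Z) (hx : Function.Injective x) (hy : Function.Injective y)
    (hZ0 : ∀ a, Z a ≠ 0) (hx0 : ∀ i, x i ≠ 0) (hy0 : ∀ j, y j ≠ 0)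
    (hxy : ∀ i j, x i ≠ q * c * y j) (hZx : ∀ a i, 1 - x i * Z a ≠ 0)
    (hZy : ∀ a j, 1 - q * c * y j * Z a ≠ 0) (Ψ : K) (Ψx : Fin n → K) (Ψy : Fin m → K)
    (Ψz : Fin N → K)
    (h1 : ∀ i, (∏ a, (1 - x i * Z a)) * Ψx i = (∏ a, (1 - q⁻¹ * x i * Z a)) * Ψ)
    (h2 : ∀ j, (∏ a, (1 - q * c * y j * Z a)) * Ψy j = (∏ a, (1 - c * y j * Z a)) * Ψ)
    (h3 : ∀ a, (∏ i, (1 - x i * Z a)) * (∏ j, (1 - q * c * y j * Z a)) * Ψz a =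
      (∏ i, (1 - t * x i * Z a)) * (∏ j, (1 - c * y j * Z a)) * Ψ) :
    (1 - t⁻¹) * t * t⁻¹ ^ n * q ^ m * ∑ i, ((∏ k, if k ≠ i then
        (1 - t * (x k / x i)) / (1 - x k / x i) else 1) *
        ∏ j, (1 - c * (y j / x i)) / (1 - q * c * (y j / x i))) * Ψx i +
      (1 - q) * ∑ j, ((∏ k, if k ≠ j then
        (1 - q * ((y k)⁻¹ / (y j)⁻¹)) / (1 - (y k)⁻¹ / (y j)⁻¹) else 1) *
        ∏ i, (1 - c⁻¹ * ((x i)⁻¹ / (y j)⁻¹)) / (1 - t * c⁻¹ * ((x i)⁻¹ / (y j)⁻¹))) * Ψy j +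
      (1 - q⁻¹) * t⁻¹ ^ n * q ^ m * ∑ a, (∏ b ∈ univ.erase a,
        (Z a - q⁻¹ * Z b) / (Z a - Z b)) * Ψz a =
    (1 - q⁻¹ ^ N * t⁻¹ ^ n * q ^ m) * Ψ := by
  classical
  have hd : q * c ≠ 0 := mul_ne_zero hq hc
  let s : Fin N ⊕ Fin n ⊕ Fin m → K :=
    Sum.elim Z (Sum.elim (fun i => (x i)⁻¹) fun j => (q * c * y j)⁻¹)
  let ρ : Fin N ⊕ Fin n ⊕ Fin m → K :=
    Sum.elim (fun _ => q⁻¹) (Sum.elim (fun _ => t⁻¹) fun _ => q)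
  have hs : Function.Injective s := by
    refine hZ.sumElim (Function.Injective.sumElim (inv_injective.comp hx) ?_ ?_) ?_
    · intro j j' h
      exact hy (mul_left_cancel₀ hd (inv_injective h))
    · intro i j h
      exact hxy i j (inv_injective h)
    · rintro a (i | j) h
      · refine hZx a i ?_
        change Z a = (x i)⁻¹ at h
        rw [h, mul_inv_cancel₀ (hx0 i), sub_self]
      · refine hZy a j ?_
        change Z a = (q * c * y j)⁻¹ at h
        rw [h, mul_inv_cancel₀ (mul_ne_zero hd (hy0 j)), sub_self]
  have hs0 : ∀ k, s k ≠ 0 := by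
    rintro (a | i | j)
    · exact hZ0 a
    · exact inv_ne_zero (hx0 i)
    · exact inv_ne_zero (mul_ne_zero hd (hy0 j))
  have key := congrArg (· * Ψ) (sum_one_sub_mul_prod_div s ρ hs hs0)
  have hsplit : ∀ (k : Fin N ⊕ Fin n ⊕ Fin m) (f : Fin N ⊕ Fin n ⊕ Fin m → K),
      ∏ l ∈ univ.erase k, f l = ∏ l, if l ≠ k then f l else 1 := by
    intro k f
    rw [prod_ite, prod_const_one, mul_one, filter_ne']
  have hsplit' : ∀ (a : Fin N) (f : Fin N → K),
      ∏ l ∈ univ.erase a, f l = ∏ l, if ¬ l = a then f l else 1 := by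
    intro k f
    rw [prod_ite, prod_const_one, mul_one, filter_ne']
  simp only [hsplit, Fintype.sum_sum_type, Fintype.prod_sum_type] at key
  simp only [s, ρ, Sum.elim_inl, Sum.elim_inr, ne_eq, Sum.inl.injEq, Sum.inr.injEq, reduceCtorEq,
    not_false_eq_true, if_true, prod_const, card_univ, Fintype.card_fin] at key
  have e1 : ∀ i, (1 - t⁻¹) * ((∏ a, ((x i)⁻¹ - q⁻¹ * Z a) / ((x i)⁻¹ - Z a)) *
      ((∏ k, if ¬ k = i then ((x i)⁻¹ - t⁻¹ * (x k)⁻¹) / ((x i)⁻¹ - (x k)⁻¹) else 1) *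
      ∏ j, ((x i)⁻¹ - q * (q * c * y j)⁻¹) / ((x i)⁻¹ - (q * c * y j)⁻¹))) * Ψ =
      (1 - t⁻¹) * t * t⁻¹ ^ n * q ^ m * (((∏ k, if k ≠ i then
        (1 - t * (x k / x i)) / (1 - x k / x i) else 1) *
        ∏ j, (1 - c * (y j / x i)) / (1 - q * c * (y j / x i))) * Ψx i) := by
    intro i
    have a1 : (∏ a, ((x i)⁻¹ - q⁻¹ * Z a) / ((x i)⁻¹ - Z a)) * Ψ = Ψx i := by
      have : ∀ a, ((x i)⁻¹ - q⁻¹ * Z a) / ((x i)⁻¹ - Z a) =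
          1 * ((1 - q⁻¹ * x i * Z a) / (1 - x i * Z a)) := fun a => by
        have := hx0 i
        exact div_eq_mul_div_of_eq (inv_ne_zero this) (by field_simp) (by field_simp)
      simp only [this, one_mul, prod_div_distrib]
      rw [div_mul_eq_mul_div, div_eq_iff (prod_ne_zero_iff.2 fun a _ => hZx a i), ← h1]
      ring
    have a2 : (∏ k, if ¬ k = i then ((x i)⁻¹ - t⁻¹ * (x k)⁻¹) / ((x i)⁻¹ - (x k)⁻¹) else 1) =
        t * t⁻¹ ^ n * ∏ k, if k ≠ i then (1 - t * (x k / x i)) / (1 - x k / x i) else 1 := by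
      have : t * t⁻¹ ^ n = ∏ k : Fin n, if k = i then 1 else t⁻¹ := by
        rw [prod_ite, prod_const_one, one_mul, filter_ne', prod_const, card_erase_of_mem
          (mem_univ i), card_univ, Fintype.card_fin]
        obtain ⟨k, rfl⟩ : ∃ k, n = k + 1 := ⟨n - 1, by have := i.pos; omega⟩
        rw [pow_succ', mul_inv_cancel_left₀ ht, Nat.add_sub_cancel]
      rw [this, ← prod_mul_distrib]
      refine prod_congr rfl fun k _ => ?_
      by_cases hk : k = i
      · simp [hk]
      · have h1 := hx0 i
        have h2 := hx0 k
        simp only [hk, not_false_eq_true, if_true, if_false, ne_eq]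
        exact div_eq_mul_div_of_eq (neg_ne_zero.2 (inv_ne_zero h2)) (by field_simp; ring)
          (by field_simp; ring)
    have a3 : (∏ j, ((x i)⁻¹ - q * (q * c * y j)⁻¹) / ((x i)⁻¹ - (q * c * y j)⁻¹)) =
        q ^ m * ∏ j, (1 - c * (y j / x i)) / (1 - q * c * (y j / x i)) := by
      have : q ^ m = ∏ j : Fin m, q := by simp
      rw [this, ← prod_mul_distrib]
      refine prod_congr rfl fun j _ => ?_
      have h1 := hx0 i
      have h2 := hy0 j
      exact div_eq_mul_div_of_eq (neg_ne_zero.2 (inv_ne_zero (mul_ne_zero hd h2)))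
        (by field_simp; ring) (by field_simp; ring)
    rw [a2, a3, ← a1]
    ring
  have e2 : ∀ j, (1 - q) * ((∏ a, ((q * c * y j)⁻¹ - q⁻¹ * Z a) / ((q * c * y j)⁻¹ - Z a)) *
      ((∏ i, ((q * c * y j)⁻¹ - t⁻¹ * (x i)⁻¹) / ((q * c * y j)⁻¹ - (x i)⁻¹)) *
      ∏ k, if ¬ k = j then ((q * c * y j)⁻¹ - q * (q * c * y k)⁻¹) /
        ((q * c * y j)⁻¹ - (q * c * y k)⁻¹) else 1)) * Ψ =
      (1 - q) * (((∏ k, if k ≠ j then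
        (1 - q * ((y k)⁻¹ / (y j)⁻¹)) / (1 - (y k)⁻¹ / (y j)⁻¹) else 1) *
        ∏ i, (1 - c⁻¹ * ((x i)⁻¹ / (y j)⁻¹)) / (1 - t * c⁻¹ * ((x i)⁻¹ / (y j)⁻¹))) * Ψy j) := by
    intro j
    have a1 : (∏ a, ((q * c * y j)⁻¹ - q⁻¹ * Z a) / ((q * c * y j)⁻¹ - Z a)) * Ψ = Ψy j := by
      have : ∀ a, ((q * c * y j)⁻¹ - q⁻¹ * Z a) / ((q * c * y j)⁻¹ - Z a) =
          1 * ((1 - c * y j * Z a) / (1 - q * c * y j * Z a)) := fun a => by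
        have := hy0 j
        exact div_eq_mul_div_of_eq (inv_ne_zero (mul_ne_zero hd this)) (by field_simp)
          (by field_simp)
      simp only [this, one_mul, prod_div_distrib]
      rw [div_mul_eq_mul_div, div_eq_iff (prod_ne_zero_iff.2 fun a _ => hZy a j), ← h2]
      ring
    rw [← a1, mul_comm (∏ k, if k ≠ j then _ else _)]
    have a2 : ∀ i, ((q * c * y j)⁻¹ - t⁻¹ * (x i)⁻¹) / ((q * c * y j)⁻¹ - (x i)⁻¹) =
        (1 - c⁻¹ * ((x i)⁻¹ / (y j)⁻¹)) / (1 - t * c⁻¹ * ((x i)⁻¹ / (y j)⁻¹)) := by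
      intro i
      have h1 := hx0 i
      have h2 := hy0 j
      rw [← one_mul (_ / (1 - t * c⁻¹ * _)), ← hrel]
      exact div_eq_mul_div_of_eq (inv_ne_zero (mul_ne_zero hd h2)) (by field_simp) (by field_simp)
    have a3 : ∀ k, ((q * c * y j)⁻¹ - q * (q * c * y k)⁻¹) /
        ((q * c * y j)⁻¹ - (q * c * y k)⁻¹) =
        (1 - q * ((y k)⁻¹ / (y j)⁻¹)) / (1 - (y k)⁻¹ / (y j)⁻¹) := by
      intro k
      have h1 := hy0 k
      have h2 := hy0 j
      rw [← one_mul (_ / (1 - (y k)⁻¹ / _))]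
      exact div_eq_mul_div_of_eq (inv_ne_zero (mul_ne_zero hd h2)) (by field_simp) (by field_simp)
    simp only [a2, a3]
    ring
  have e3 : ∀ a, (1 - q⁻¹) * ((∏ b, if ¬ b = a then (Z a - q⁻¹ * Z b) / (Z a - Z b) else 1) *
      ((∏ i, (Z a - t⁻¹ * (x i)⁻¹) / (Z a - (x i)⁻¹)) *
      ∏ j, (Z a - q * (q * c * y j)⁻¹) / (Z a - (q * c * y j)⁻¹))) * Ψ =
      (1 - q⁻¹) * t⁻¹ ^ n * q ^ m * ((∏ b ∈ univ.erase a,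
        (Z a - q⁻¹ * Z b) / (Z a - Z b)) * Ψz a) := by
    intro a
    have a2 : ∀ i, (Z a - t⁻¹ * (x i)⁻¹) / (Z a - (x i)⁻¹) =
        t⁻¹ * ((1 - t * x i * Z a) / (1 - x i * Z a)) := by
      intro i
      have h1 := hx0 i
      exact div_eq_mul_div_of_eq (neg_ne_zero.2 (inv_ne_zero h1)) (by field_simp; ring)
        (by field_simp; ring)
    have a3 : ∀ j, (Z a - q * (q * c * y j)⁻¹) / (Z a - (q * c * y j)⁻¹) =
        q * ((1 - c * y j * Z a) / (1 - q * c * y j * Z a)) := by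
      intro j
      have h1 := hy0 j
      exact div_eq_mul_div_of_eq (neg_ne_zero.2 (inv_ne_zero (mul_ne_zero hd h1)))
        (by field_simp; ring) (by field_simp; ring)
    have a4 : Ψz a = (∏ i, (1 - t * x i * Z a) / (1 - x i * Z a)) *
        (∏ j, (1 - c * y j * Z a) / (1 - q * c * y j * Z a)) * Ψ := by
      simp only [prod_div_distrib]
      rw [div_mul_div_comm, div_mul_eq_mul_div, eq_div_iff (mul_ne_zero
        (prod_ne_zero_iff.2 fun i _ => hZx a i) (prod_ne_zero_iff.2 fun j _ => hZy a j)), ← h3]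
      ring
    simp only [a2, a3, prod_mul_distrib, prod_const, card_univ, Fintype.card_fin]
    rw [a4, hsplit']
    ring
  simp only [add_mul, sum_mul, e1, e2, e3] at key
  simp only [mul_sum]
  rw [← mul_assoc (q⁻¹ ^ N)] at key
  rw [← key]
  ring

end FieldKernel

section GeneratingSeries

/-- The power series `1 - a X`. -/
def linSeries (a : ℂ) : PowerSeries ℂ := 1 - PowerSeries.C a * PowerSeries.X

lemma rescale_linSeries (u a : ℂ) : PowerSeries.rescale u (linSeries a) = linSeries (u * a) := by
  ext k
  simp only [linSeries, PowerSeries.coeff_rescale, map_sub, PowerSeries.coeff_C_mul,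
    PowerSeries.coeff_one, PowerSeries.coeff_X]
  split_ifs with h1 h2 h2 <;> simp_all

/-- The coefficients of the single-variable generating series `(dX;t)_∞/(cX;t)_∞`, `d = q c`. -/
def gCoef (q t c : ℂ) (k : ℕ) : ℂ :=
  ∏ i ∈ range k, c * (1 - q * t ^ i) / (1 - t ^ (i + 1))

/-- The single-variable generating series `(dX;t)_∞/(cX;t)_∞`, `d = q c`. -/
def gSeries (q t c : ℂ) : PowerSeries ℂ := PowerSeries.mk (gCoef q t c)

lemma gCoef_succ {q t c : ℂ} (ht : ∀ k, t ^ (k + 1) ≠ 1) (k : ℕ) :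
    gCoef q t c (k + 1) * (1 - t ^ (k + 1)) = gCoef q t c k * (c * (1 - q * t ^ k)) := by
  rw [gCoef, prod_range_succ, ← gCoef, mul_assoc, div_mul_cancel₀ _ (sub_ne_zero.2 (ht k).symm)]

lemma linSeries_mul_rescale_gSeries {q t c : ℂ} (ht : ∀ k, t ^ (k + 1) ≠ 1) :
    linSeries (q * c) * PowerSeries.rescale t (gSeries q t c) =
      linSeries c * gSeries q t c := by
  ext k
  simp only [linSeries, sub_mul, one_mul, mul_assoc, map_sub, PowerSeries.coeff_C_mul]
  cases k with
  | zero => simp [gSeries]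
  | succ k =>
    simp only [PowerSeries.coeff_succ_X_mul, PowerSeries.coeff_rescale, gSeries,
      PowerSeries.coeff_mk]
    linear_combination -gCoef_succ ht k

variable {n m : ℕ}

/-- The generating series `∏ᵢ (1 - xᵢ X) ∏ⱼ G(yⱼ X)`. -/
def epsSeries (q t c : ℂ) (x : Fin n → ℂ) (y : Fin m → ℂ) : PowerSeries ℂ :=
  (∏ i, linSeries (x i)) * ∏ j, PowerSeries.rescale (y j) (gSeries q t c)

/-- The deformed elementary symmetric functions. -/
def eps (q t c : ℂ) (k : ℕ) (x : Fin n → ℂ) (y : Fin m → ℂ) : ℂ :=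
  PowerSeries.coeff k (epsSeries q t c x y)

lemma prod_scaleOn_mul {M : Type*} [CommMonoid M] (f : ℂ → M) (i : Fin n) (u : ℂ)
    (x : Fin n → ℂ) :
    f (x i) * ∏ k, f (scaleOn {i} u x k) = f (u * x i) * ∏ k, f (x k) := by
  rw [← mul_prod_erase univ _ (mem_univ i), ← mul_prod_erase univ (fun k => f (x k)) (mem_univ i),
    prod_congr rfl fun k hk => ?_]
  · simp only [scaleOn, mem_singleton, if_true]
    exact mul_left_comm _ _ _
  · simp [scaleOn, (mem_erase.1 hk).1]

lemma epsSeries_scale_left (q t c : ℂ) (x : Fin n → ℂ) (y : Fin m → ℂ) (i : Fin n) (u : ℂ) :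
    linSeries (x i) * epsSeries q t c (scaleOn {i} u x) y =
      linSeries (u * x i) * epsSeries q t c x y := by
  rw [epsSeries, ← mul_assoc, prod_scaleOn_mul linSeries, mul_assoc, epsSeries]

lemma epsSeries_scale_right {q t c : ℂ} (ht : ∀ k, t ^ (k + 1) ≠ 1) (x : Fin n → ℂ)
    (y : Fin m → ℂ) (j : Fin m) :
    linSeries (q * c * y j) * epsSeries q t c x (scaleOn {j} t y) =
      linSeries (c * y j) * epsSeries q t c x y := by
  have h := congrArg (PowerSeries.rescale (y j)) (linSeries_mul_rescale_gSeries (q := q) (c := c) ht)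
  simp only [map_mul, rescale_linSeries, PowerSeries.rescale_rescale] at h
  have h2 : ∏ k, PowerSeries.rescale (scaleOn {j} t y k) (gSeries q t c) =
      PowerSeries.rescale (t * y j) (gSeries q t c) *
        ∏ k ∈ univ.erase j, PowerSeries.rescale (y k) (gSeries q t c) := by
    rw [← mul_prod_erase univ _ (mem_univ j)]
    congr 1
    · simp [scaleOn]
    · exact prod_congr rfl fun k hk => by simp [scaleOn, (mem_erase.1 hk).1]
  rw [epsSeries, h2, epsSeries, ← mul_prod_erase univ _ (mem_univ j), mul_comm (q * c), mul_comm c]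
  linear_combination (∏ i, linSeries (x i)) *
    (∏ k ∈ univ.erase j, PowerSeries.rescale (y k) (gSeries q t c)) * h

lemma rescale_epsSeries {q t c : ℂ} (ht : ∀ k, t ^ (k + 1) ≠ 1) (x : Fin n → ℂ)
    (y : Fin m → ℂ) :
    (∏ i, linSeries (x i)) * (∏ j, linSeries (q * c * y j)) *
        PowerSeries.rescale t (epsSeries q t c x y) =
      (∏ i, linSeries (t * x i)) * (∏ j, linSeries (c * y j)) * epsSeries q t c x y := by
  have h : ∀ j, linSeries (q * c * y j) * PowerSeries.rescale (t * y j) (gSeries q t c) =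
      linSeries (c * y j) * PowerSeries.rescale (y j) (gSeries q t c) := fun j => by
    have h := congrArg (PowerSeries.rescale (y j))
      (linSeries_mul_rescale_gSeries (q := q) (c := c) ht)
    simp only [map_mul, rescale_linSeries, PowerSeries.rescale_rescale] at h
    rwa [mul_comm (q * c), mul_comm c]
  have h' := prod_congr (rfl : (univ : Finset (Fin m)) = univ) fun j _ => h j
  simp only [prod_mul_distrib] at h'
  simp only [epsSeries, map_mul, map_prod, rescale_linSeries, PowerSeries.rescale_rescale,
    mul_comm _ t]
  linear_combination (∏ i, linSeries (t * x i)) * (∏ i, linSeries (x i)) * h'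

end GeneratingSeries

section Tensor

variable {N : ℕ}

/-- The product `∏ₐ fₐ(Zₐ)` of univariate power series in separate variables. -/
def tens (f : Fin N → PowerSeries ℂ) : MvPowerSeries (Fin N) ℂ :=
  fun β => ∏ a, PowerSeries.coeff (β a) (f a)

lemma coeff_tens (f : Fin N → PowerSeries ℂ) (β : Fin N →₀ ℕ) :
    MvPowerSeries.coeff β (tens f) = ∏ a, PowerSeries.coeff (β a) (f a) := rfl

lemma tens_mul (f g : Fin N → PowerSeries ℂ) : tens f * tens g = tens fun a => f a * g a := by
  classical
  ext β
  simp only [MvPowerSeries.coeff_mul, coeff_tens, PowerSeries.coeff_mul, prod_univ_sum,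
    ← prod_mul_distrib]
  refine sum_bij' (fun p _ a => (p.1 a, p.2 a))
    (fun p _ => (Finsupp.equivFunOnFinite.symm fun a => (p a).1,
      Finsupp.equivFunOnFinite.symm fun a => (p a).2)) ?_ ?_ ?_ ?_ ?_
  · intro p hp
    rw [Fintype.mem_piFinset]
    intro a
    rw [HasAntidiagonal.mem_antidiagonal] at hp ⊢
    rw [← hp]; rfl
  · intro p hp
    rw [Fintype.mem_piFinset] at hp
    rw [HasAntidiagonal.mem_antidiagonal]
    ext a
    exact HasAntidiagonal.mem_antidiagonal.1 (hp a)
  · intro p _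
    exact Prod.ext (Finsupp.ext fun a => rfl) (Finsupp.ext fun a => rfl)
  · intro p _
    rfl
  · intro p _
    rfl

lemma tens_one : tens (fun _ : Fin N => 1) = 1 := by
  classical
  ext β
  simp only [coeff_tens, PowerSeries.coeff_one, MvPowerSeries.coeff_one]
  split_ifs with h
  · simp [h]
  · obtain ⟨a, ha⟩ : ∃ a, β a ≠ 0 := by
      by_contra! h'
      exact h (Finsupp.ext h')
    exact prod_eq_zero (mem_univ a) (if_neg ha)

lemma tens_prod {ι : Type*} (s : Finset ι) (f : ι → Fin N → PowerSeries ℂ) :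
    ∏ i ∈ s, tens (f i) = tens fun a => ∏ i ∈ s, f i a := by
  classical
  induction s using Finset.induction_on with
  | empty => simp [tens_one]
  | insert i s hi ih => rw [prod_insert hi, ih, tens_mul]; simp only [prod_insert hi]

lemma tens_update_linSeries (a : Fin N) (z : ℂ) :
    tens (Function.update 1 a (linSeries z)) =
      1 - MvPowerSeries.C z * MvPowerSeries.X a := by
  classical
  have hX : tens (Function.update 1 a PowerSeries.X) = MvPowerSeries.X a := by
    ext β
    simp only [coeff_tens, MvPowerSeries.coeff_X]
    split_ifs with h
    · refine prod_eq_one fun b _ => ?_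
      rcases eq_or_ne b a with rfl | hb
      · simp [h]
      · simp [h, hb]
    · obtain ⟨b, hb⟩ : ∃ b, β b ≠ Finsupp.single a 1 b := by
        by_contra! h'
        exact h (Finsupp.ext h')
      refine prod_eq_zero (mem_univ b) ?_
      rcases eq_or_ne b a with rfl | hba
      · simp only [Function.update_self, PowerSeries.coeff_X]
        exact if_neg (by simpa using hb)
      · simp only [Function.update_of_ne hba, Pi.one_apply, PowerSeries.coeff_one]
        exact if_neg (by simpa [Finsupp.single_apply, hba.symm] using hb)
  have key : ∀ (u : PowerSeries ℂ) (β : Fin N →₀ ℕ),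
      MvPowerSeries.coeff β (tens (Function.update 1 a u)) = PowerSeries.coeff (β a) u *
        ∏ b ∈ univ.erase a, PowerSeries.coeff (β b) (1 : PowerSeries ℂ) := by
    intro u β
    rw [coeff_tens, ← mul_prod_erase _ _ (mem_univ a), Function.update_self]
    congr 1
    exact prod_congr rfl fun b hb => by rw [Function.update_of_ne (mem_erase.1 hb).1]; rfl
  have h1 : (fun _ : Fin N => (1 : PowerSeries ℂ)) =
      Function.update (1 : Fin N → PowerSeries ℂ) a 1 :=
    (Function.update_eq_self a _).symm
  rw [← hX, ← tens_one, h1]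
  ext β
  rw [map_sub, MvPowerSeries.coeff_C_mul, key, key, key, linSeries, map_sub,
    PowerSeries.coeff_C_mul]
  ring

lemma prod_one_sub_X (z : ℂ) :
    ∏ a : Fin N, (1 - MvPowerSeries.C z * MvPowerSeries.X a) = tens fun _ => linSeries z := by
  simp only [← tens_update_linSeries, tens_prod]
  congr 1
  funext a
  rw [prod_eq_single a]
  · simp
  · intro b _ hb
    simp [Function.update_of_ne hb.symm]
  · simp

lemma prod_one_sub_X_fixed {ι : Type*} [Fintype ι] (a : Fin N) (z : ι → ℂ) :
    ∏ i, (1 - MvPowerSeries.C (z i) * MvPowerSeries.X a) =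
      tens (Function.update 1 a (∏ i, linSeries (z i))) := by
  simp only [← tens_update_linSeries, tens_prod]
  congr 1
  funext b
  rcases eq_or_ne b a with rfl | h
  · simp
  · simp [Function.update_of_ne h]

end Tensor

section Vandermonde

variable {N : ℕ} {R : Type*} [CommRing R]

/-- The Vandermonde product `∏_{b<c} (Z_b - Z_c)`. -/
def vdm (Z : Fin N → R) : R := ∏ b, ∏ c, if b < c then Z b - Z c else 1

/-- The Vandermonde product with all variables other than `Z_a` multiplied by `r` in the
factors containing `Z_a`. -/
def vdmTwist (r : R) (Z : Fin N → R) (a : Fin N) : R :=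
  ∏ b, ∏ c, if b < c then
    (if c = a then r * Z b - Z c else if b = a then Z b - r * Z c else Z b - Z c) else 1

lemma map_vdm {S : Type*} [CommRing S] (f : R →+* S) (Z : Fin N → R) :
    f (vdm Z) = vdm fun a => f (Z a) := by
  simp only [vdm, map_prod, apply_ite f, map_sub, map_one]

lemma map_vdmTwist {S : Type*} [CommRing S] (f : R →+* S) (r : R) (Z : Fin N → R) (a : Fin N) :
    f (vdmTwist r Z a) = vdmTwist (f r) (fun a => f (Z a)) a := by
  simp only [vdmTwist, map_prod, apply_ite f, map_sub, map_one, map_mul]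

lemma vdm_mul_prod_div {K : Type*} [Field K] (r : K) {Z : Fin N → K}
    (hZ : Function.Injective Z) (a : Fin N) :
    vdm Z * ∏ b ∈ univ.erase a, (Z a - r * Z b) / (Z a - Z b) = vdmTwist r Z a := by
  have key : ∏ b ∈ univ.erase a, (Z a - r * Z b) / (Z a - Z b) =
      ∏ b, ∏ c, ((if b < c ∧ c = a then (Z a - r * Z b) / (Z a - Z b) else 1) *
        if b < c ∧ b = a then (Z a - r * Z c) / (Z a - Z c) else 1) := by
    have e1 : ∀ b, ∏ c, (if b < c ∧ c = a then (Z a - r * Z b) / (Z a - Z b) else 1) =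
        if b < a then (Z a - r * Z b) / (Z a - Z b) else 1 := by
      intro b
      rw [prod_eq_single a (fun c _ hc => by simp [hc]) (by simp)]
      simp
    have e2 : ∏ b, ∏ c, (if b < c ∧ b = a then (Z a - r * Z c) / (Z a - Z c) else 1) =
        ∏ c, if a < c then (Z a - r * Z c) / (Z a - Z c) else 1 := by
      rw [prod_eq_single a (fun b _ hb => by simp [hb]) (by simp)]
      simp
    simp only [prod_mul_distrib, e1]
    rw [e2, ← prod_mul_distrib, ← filter_ne', prod_filter]
    refine prod_congr rfl fun b _ => ?_
    rcases lt_trichotomy b a with h | h | h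
    · simp [h, h.ne, h.not_gt]
    · simp [h]
    · simp [h, h.ne', h.not_gt]
  rw [key, vdm, vdmTwist]
  simp only [← prod_mul_distrib]
  refine prod_congr rfl fun b _ => prod_congr rfl fun c _ => ?_
  by_cases hbc : b < c
  · by_cases hc : c = a
    · subst hc
      have h : Z c - Z b ≠ 0 := sub_ne_zero.2 fun h => hbc.ne' (hZ h)
      simp only [hbc, hbc.ne, if_true, and_true, and_false, if_false, mul_one]
      field_simp
      ring
    · by_cases hb : b = a
      · subst hb
        have h : Z b - Z c ≠ 0 := sub_ne_zero.2 fun h => hbc.ne (hZ h)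
        simp only [hbc, hc, if_true, and_true, and_false, if_false, one_mul]
        field_simp
      · simp [hbc, hc, hb]
  · simp [hbc]

end Vandermonde

section Kernel

variable {N n m : ℕ}

lemma kernel_identity_of_injective {K : Type*} [Field K]
    (φ : MvPowerSeries (Fin N) ℂ →+* K) (hφ : Function.Injective φ) {q t c : ℂ} (hq : q ≠ 0) (ht0 : t ≠ 0) (hc : c ≠ 0)
    (ht : ∀ k, t ^ (k + 1) ≠ 1) (hrel : q * c ^ 2 = t) {x : Fin n → ℂ} {y : Fin m → ℂ}
    (hx : Function.Injective x) (hy : Function.Injective y) (hx0 : ∀ i, x i ≠ 0)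
    (hy0 : ∀ j, y j ≠ 0) (hxy : ∀ i j, x i ≠ q * c * y j) :
    let Z : Fin N → MvPowerSeries (Fin N) ℂ := MvPowerSeries.X
    vdm Z * (MvPowerSeries.C ((1 - t⁻¹) * t * t⁻¹ ^ n * q ^ m) *
          ∑ i, MvPowerSeries.C (shiftCoeff t c (q * c) i x y) *
            tens (fun _ => epsSeries q t c (scaleOn {i} q⁻¹ x) y) +
        MvPowerSeries.C (1 - q) * ∑ j, MvPowerSeries.C (shiftCoeff q c⁻¹ (t * c⁻¹) j
            (fun j => (y j)⁻¹) (fun i => (x i)⁻¹)) *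
            tens (fun _ => epsSeries q t c x (scaleOn {j} t y))) +
      MvPowerSeries.C ((1 - q⁻¹) * t⁻¹ ^ n * q ^ m) * ∑ a, vdmTwist (MvPowerSeries.C q⁻¹) Z a *
        tens (Function.update (fun _ => epsSeries q t c x y) a
          (PowerSeries.rescale t (epsSeries q t c x y))) =
    MvPowerSeries.C (1 - q⁻¹ ^ N * t⁻¹ ^ n * q ^ m) *
      (vdm Z * tens (fun _ => epsSeries q t c x y)) := by
  intro Z
  let ι : ℂ →+* K := φ.comp MvPowerSeries.C
  have hι : Function.Injective ι := ι.injective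
  have hZ : Function.Injective fun a => φ (Z a) :=
    hφ.comp fun a b h => (MvPowerSeries.X_inj (R := ℂ)).1 h
  have hne : ∀ (α : ℂ) a, 1 - ι α * φ (Z a) ≠ 0 := by
    intro α a h
    have h1 : φ (1 - MvPowerSeries.C α * Z a) = φ 0 := by
      rw [map_zero, ← h]; simp [ι]
    have h2 := congrArg (MvPowerSeries.coeff 0) (hφ h1)
    rw [map_sub, MvPowerSeries.coeff_C_mul, MvPowerSeries.coeff_zero_X] at h2
    simp at h2
  have hprod : ∀ α : ℂ, ∏ a, (1 - ι α * φ (Z a)) = φ (tens fun _ => linSeries α) := fun α => by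
    rw [← prod_one_sub_X, map_prod]; simp [ι, Z]
  have hfix : ∀ {p : ℕ} (α : Fin p → ℂ) a, ∏ i, (1 - ι (α i) * φ (Z a)) =
      φ (tens (Function.update 1 a (∏ i, linSeries (α i)))) := fun α a => by
    rw [← prod_one_sub_X_fixed, map_prod]; simp [ι, Z]
  have key := field_kernel_identity (ι q) (ι t) (ι c) ((map_ne_zero ι).2 hq)
    ((map_ne_zero ι).2 ht0) ((map_ne_zero ι).2 hc) (by rw [← hrel]; simp)
    (fun a => φ (Z a)) (fun i => ι (x i)) (fun j => ι (y j)) hZ (hι.comp hx) (hι.comp hy)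
    (fun a h => ?_) (fun i => (map_ne_zero ι).2 (hx0 i)) (fun j => (map_ne_zero ι).2 (hy0 j))
    (fun i j h => hxy i j (hι (by simpa using h))) (fun a i => hne _ a)
    (fun a j => by simpa using hne (q * c * y j) a)
    (φ (tens fun _ => epsSeries q t c x y))
    (fun i => φ (tens fun _ => epsSeries q t c (scaleOn {i} q⁻¹ x) y))
    (fun j => φ (tens fun _ => epsSeries q t c x (scaleOn {j} t y)))
    (fun a => φ (tens (Function.update (fun _ => epsSeries q t c x y) a
          (PowerSeries.rescale t (epsSeries q t c x y))))) ?_ ?_ ?_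
  · apply hφ
    have hW : ∀ a (ψ : K), φ (vdm Z) * ((∏ b ∈ univ.erase a, (φ (Z a) - (ι q)⁻¹ * φ (Z b)) /
        (φ (Z a) - φ (Z b))) * ψ) = φ (vdmTwist (MvPowerSeries.C q⁻¹) Z a) * ψ := by
      intro a ψ
      rw [← mul_assoc, map_vdm, vdm_mul_prod_div _ hZ, map_vdmTwist,
        show φ (MvPowerSeries.C q⁻¹) = (ι q)⁻¹ from map_inv₀ ι q]
    have hS : φ (vdm Z) * ∑ a, (∏ b ∈ univ.erase a, (φ (Z a) - (ι q)⁻¹ * φ (Z b)) /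
        (φ (Z a) - φ (Z b))) * φ (tens (Function.update (fun _ => epsSeries q t c x y) a
          (PowerSeries.rescale t (epsSeries q t c x y)))) =
        ∑ a, φ (vdmTwist (MvPowerSeries.C q⁻¹) Z a) *
          φ (tens (Function.update (fun _ => epsSeries q t c x y) a
          (PowerSeries.rescale t (epsSeries q t c x y)))) := by
      rw [mul_sum]
      exact sum_congr rfl fun a _ => hW a _
    have hs1 : ∀ i, φ (MvPowerSeries.C (shiftCoeff t c (q * c) i x y)) =
        (∏ k, if k ≠ i then (1 - ι t * (ι (x k) / ι (x i))) / (1 - ι (x k) / ι (x i)) else 1) *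
          ∏ j, (1 - ι c * (ι (y j) / ι (x i))) / (1 - ι q * ι c * (ι (y j) / ι (x i))) := by
      intro i
      change ι _ = _
      simp only [shiftCoeff, map_mul, map_prod, apply_ite ι, map_div₀, map_sub, map_one]
    have hs2 : ∀ j, φ (MvPowerSeries.C (shiftCoeff q c⁻¹ (t * c⁻¹) j
            (fun j => (y j)⁻¹) (fun i => (x i)⁻¹))) =
        (∏ k, if k ≠ j then (1 - ι q * ((ι (y k))⁻¹ / (ι (y j))⁻¹)) /
          (1 - (ι (y k))⁻¹ / (ι (y j))⁻¹) else 1) *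
          ∏ i, (1 - (ι c)⁻¹ * ((ι (x i))⁻¹ / (ι (y j))⁻¹)) /
            (1 - ι t * (ι c)⁻¹ * ((ι (x i))⁻¹ / (ι (y j))⁻¹)) := by
      intro i
      change ι _ = _
      simp only [shiftCoeff, map_mul, map_prod, apply_ite ι, map_div₀, map_sub, map_one, map_inv₀]
    have hC : ∀ α, φ (MvPowerSeries.C α) = ι α := fun α => rfl
    simp only [map_add, map_mul, map_sum, hs1, hs2]
    simp only [hC, map_mul, map_sub, map_one, map_pow, map_inv₀]
    linear_combination φ (vdm Z) * key - (1 - (ι q)⁻¹) * (ι t)⁻¹ ^ n * ι q ^ m * hS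
  · have h := hφ (h.trans (map_zero φ).symm)
    have h2 := congrArg (MvPowerSeries.coeff (Finsupp.single a 1)) h
    simp [Z, MvPowerSeries.coeff_X] at h2
  · intro i
    simp only [← map_inv₀, ← map_mul ι, hprod, ← map_mul φ, tens_mul, epsSeries_scale_left]
  · intro j
    simp only [← map_mul ι, hprod, ← map_mul φ, tens_mul, epsSeries_scale_right ht]
  · intro a
    simp only [← map_mul ι, hfix, ← map_mul φ, tens_mul]
    refine congrArg (fun f => φ (tens f)) (funext fun b => ?_)
    rcases eq_or_ne b a with rfl | hb
    · simp only [Function.update_self]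
      exact rescale_epsSeries ht x y
    · simp [Function.update_of_ne hb]

/-- The kernel identity, as an identity of formal power series in the auxiliary variables. -/
lemma kernel_identity {q t c : ℂ} (hq : q ≠ 0) (ht0 : t ≠ 0) (hc : c ≠ 0)
    (ht : ∀ k, t ^ (k + 1) ≠ 1) (hrel : q * c ^ 2 = t) {x : Fin n → ℂ} {y : Fin m → ℂ}
    (hx : Function.Injective x) (hy : Function.Injective y) (hx0 : ∀ i, x i ≠ 0)
    (hy0 : ∀ j, y j ≠ 0) (hxy : ∀ i j, x i ≠ q * c * y j) :
    let Z : Fin N → MvPowerSeries (Fin N) ℂ := MvPowerSeries.X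
    vdm Z * (MvPowerSeries.C ((1 - t⁻¹) * t * t⁻¹ ^ n * q ^ m) *
          ∑ i, MvPowerSeries.C (shiftCoeff t c (q * c) i x y) *
            tens (fun _ => epsSeries q t c (scaleOn {i} q⁻¹ x) y) +
        MvPowerSeries.C (1 - q) * ∑ j, MvPowerSeries.C (shiftCoeff q c⁻¹ (t * c⁻¹) j
            (fun j => (y j)⁻¹) (fun i => (x i)⁻¹)) *
            tens (fun _ => epsSeries q t c x (scaleOn {j} t y))) +
      MvPowerSeries.C ((1 - q⁻¹) * t⁻¹ ^ n * q ^ m) * ∑ a, vdmTwist (MvPowerSeries.C q⁻¹) Z a *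
        tens (Function.update (fun _ => epsSeries q t c x y) a
          (PowerSeries.rescale t (epsSeries q t c x y))) =
    MvPowerSeries.C (1 - q⁻¹ ^ N * t⁻¹ ^ n * q ^ m) *
      (vdm Z * tens (fun _ => epsSeries q t c x y)) := by
  have : IsDomain (MvPowerSeries (Fin N) ℂ) := NoZeroDivisors.to_isDomain _
  exact kernel_identity_of_injective (algebraMap _ (FractionRing (MvPowerSeries (Fin N) ℂ)))
    (IsFractionRing.injective _ _) hq ht0 hc ht hrel hx hy hx0 hy0 hxy

end Kernel

section EpsRegularity

variable {n m : ℕ} {α : Type*}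

lemma coeff_mul_mem (A : Subalgebra ℂ (α → ℂ)) {F G : α → PowerSeries ℂ}
    (hF : ∀ k, (fun a => PowerSeries.coeff k (F a)) ∈ A)
    (hG : ∀ k, (fun a => PowerSeries.coeff k (G a)) ∈ A) (k : ℕ) :
    (fun a => PowerSeries.coeff k (F a * G a)) ∈ A := by
  have : (fun a => PowerSeries.coeff k (F a * G a)) = ∑ p ∈ antidiagonal k,
      (fun a => PowerSeries.coeff p.1 (F a)) * fun a => PowerSeries.coeff p.2 (G a) := by
    funext a
    simp [PowerSeries.coeff_mul]
  rw [this]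
  exact A.sum_mem fun p _ => A.mul_mem (hF _) (hG _)

lemma coeff_prod_mem {ι : Type*} (A : Subalgebra ℂ (α → ℂ)) (s : Finset ι)
    {F : ι → α → PowerSeries ℂ} (hF : ∀ i k, (fun a => PowerSeries.coeff k (F i a)) ∈ A) :
    ∀ k, (fun a => PowerSeries.coeff k (∏ i ∈ s, F i a)) ∈ A := by
  classical
  induction s using Finset.induction_on with
  | empty =>
    intro k
    simp only [prod_empty]
    exact A.algebraMap_mem (PowerSeries.coeff k (1 : PowerSeries ℂ))
  | insert i s hi ih =>
    simp only [prod_insert hi]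
    exact coeff_mul_mem A (hF i) ih

lemma const_mem_subalgebra (A : Subalgebra ℂ (α → ℂ)) (z : ℂ) : (fun _ => z) ∈ A :=
  A.algebraMap_mem z

lemma gCoef_mem (A : Subalgebra ℂ (α → ℂ)) {q c : α → ℂ} (t : ℂ) (hq : q ∈ A) (hc : c ∈ A)
    (k : ℕ) : (fun a => gCoef (q a) t (c a) k) ∈ A := by
  have : (fun a => gCoef (q a) t (c a) k) =
      ∏ i ∈ range k, c * (1 - q * fun _ => t ^ i) * fun _ => (1 - t ^ (i + 1))⁻¹ := by
    funext a
    simp [gCoef, div_eq_mul_inv]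
  rw [this]
  exact A.prod_mem fun i _ => A.mul_mem (A.mul_mem hc (A.sub_mem A.one_mem
    (A.mul_mem hq (const_mem_subalgebra A _)))) (const_mem_subalgebra A _)

lemma eps_mem (A : Subalgebra ℂ (α → ℂ)) {q c : α → ℂ} (t : ℂ) (hq : q ∈ A) (hc : c ∈ A)
    {x : α → Fin n → ℂ} {y : α → Fin m → ℂ} (hx : ∀ i, (fun a => x a i) ∈ A)
    (hy : ∀ j, (fun a => y a j) ∈ A) (k : ℕ) :
    (fun a => eps (q a) t (c a) k (x a) (y a)) ∈ A := by
  refine coeff_mul_mem A (coeff_prod_mem A _ fun i k => ?_) (coeff_prod_mem A _ fun j k => ?_) k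
  · have : (fun a => PowerSeries.coeff k (linSeries (x a i))) =
        (fun _ => if k = 0 then 1 else 0) - (fun a => x a i) * fun _ => if k = 1 then 1 else 0 := by
      funext a
      simp [linSeries, PowerSeries.coeff_one, PowerSeries.coeff_X]
    rw [this]
    exact A.sub_mem (const_mem_subalgebra A _) (A.mul_mem (hx i) (const_mem_subalgebra A _))
  · have : (fun a => PowerSeries.coeff k (PowerSeries.rescale (y a j) (gSeries (q a) t (c a)))) =
        (fun a => y a j) ^ k * fun a => gCoef (q a) t (c a) k := by
      funext a
      simp [gSeries]
    rw [this]
    exact A.mul_mem (A.pow_mem (hy j) k) (gCoef_mem A t hq hc k)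

/-- The product of deformed elementary symmetric functions indexed by a composition. -/
def epsProd {N : ℕ} (q t c : ℂ) (v : Fin N →₀ ℕ) (x : Fin n → ℂ) (y : Fin m → ℂ) : ℂ :=
  ∏ a, eps q t c (v a) x y

lemma epsProd_mem {N : ℕ} (A : Subalgebra ℂ (α → ℂ)) {q c : α → ℂ} (t : ℂ) (hq : q ∈ A)
    (hc : c ∈ A) {x : α → Fin n → ℂ} {y : α → Fin m → ℂ} (hx : ∀ i, (fun a => x a i) ∈ A)
    (hy : ∀ j, (fun a => y a j) ∈ A) (v : Fin N →₀ ℕ) :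
    (fun a => epsProd (q a) t (c a) v (x a) (y a)) ∈ A := by
  have : (fun a => epsProd (q a) t (c a) v (x a) (y a)) =
      ∏ b, fun a => eps (q a) t (c a) (v b) (x a) (y a) := by
    funext a
    simp [epsProd]
  rw [this]
  exact A.prod_mem fun b _ => eps_mem A t hq hc hx hy _

lemma holStar_epsProd {N : ℕ} (q t c : ℂ) (v : Fin N →₀ ℕ) :
    HolStar (epsProd q t c v : (Fin n → ℂ) → (Fin m → ℂ) → ℂ) := by
  let A : Subalgebra ℂ ((Fin n → ℂ) × (Fin m → ℂ) → ℂ) :=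
    { carrier := {f | Differentiable ℂ f}
      mul_mem' := fun hf hg => Differentiable.mul hf hg
      add_mem' := fun hf hg => Differentiable.add hf hg
      algebraMap_mem' := fun r => differentiable_const r }
  have h := epsProd_mem A (q := fun _ => q) (c := fun _ => c) t (const_mem_subalgebra A _)
    (const_mem_subalgebra A _) (x := fun p => p.1) (y := fun p => p.2)
    (fun i => show Differentiable ℂ _ by fun_prop)
    (fun i => show Differentiable ℂ _ by fun_prop) v
  exact fun p _ _ => h p

lemma coeff_tens_epsSeries {N : ℕ} (q t c : ℂ) (v : Fin N →₀ ℕ) (x : Fin n → ℂ)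
    (y : Fin m → ℂ) :
    MvPowerSeries.coeff v (tens fun _ => epsSeries q t c x y) = epsProd q t c v x y := rfl

end EpsRegularity

section GramRelation

variable {N n m : ℕ}

/-- The coefficients of the Vandermonde product. -/
def vdmCoeff (u : Fin N →₀ ℕ) : ℂ := MvPowerSeries.coeff u (vdm MvPowerSeries.X)

/-- The matrix coefficients of the dual operator acting on the auxiliary variables. -/
def dualCoeff (q t κ κ' : ℂ) (u v : Fin N →₀ ℕ) : ℂ :=
  κ * vdmCoeff u - κ' * ∑ a, MvPowerSeries.coeff u
    (vdmTwist (MvPowerSeries.C q⁻¹) MvPowerSeries.X a) * t ^ v a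

lemma hOp_sum {ι : Type*} (s : Finset ι) (b : ι → ℂ) (κ κ' q t c : ℂ)
    (f : ι → (Fin n → ℂ) → (Fin m → ℂ) → ℂ) (x : Fin n → ℂ) (y : Fin m → ℂ) :
    hOp κ κ' q t c (fun x y => ∑ p ∈ s, b p * f p x y) x y =
      ∑ p ∈ s, b p * hOp κ κ' q t c (f p) x y := by
  simp only [hOp, mul_add, sum_add_distrib, mul_sum]
  congr 1 <;> rw [sum_comm] <;>
    exact sum_congr rfl fun p _ => sum_congr rfl fun i _ => by ring

lemma hOp_epsProd_sum {q t c : ℂ} (hq : q ≠ 0) (ht0 : t ≠ 0) (hc : c ≠ 0)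
    (ht : ∀ k, t ^ (k + 1) ≠ 1) (hrel : q * c ^ 2 = t) {x : Fin n → ℂ} {y : Fin m → ℂ}
    (hx : Function.Injective x) (hy : Function.Injective y) (hx0 : ∀ i, x i ≠ 0)
    (hy0 : ∀ j, y j ≠ 0) (hxy : ∀ i j, x i ≠ q * c * y j) (α : Fin N →₀ ℕ) :
    hOp ((1 - t⁻¹) * t * t⁻¹ ^ n * q ^ m) (1 - q) q t c
        (fun x y => ∑ p ∈ antidiagonal α, vdmCoeff p.1 * epsProd q t c p.2 x y) x y =
      ∑ p ∈ antidiagonal α, dualCoeff q t (1 - q⁻¹ ^ N * t⁻¹ ^ n * q ^ m)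
        ((1 - q⁻¹) * t⁻¹ ^ n * q ^ m) p.1 p.2 * epsProd q t c p.2 x y := by
  have h0 := kernel_identity (N := N) hq ht0 hc ht hrel hx hy hx0 hy0 hxy
  dsimp only at h0
  rw [mul_add, mul_left_comm, mul_left_comm (vdm _), mul_sum _ _ (vdm _),
    mul_sum _ _ (vdm _)] at h0
  simp only [mul_left_comm (vdm MvPowerSeries.X) (MvPowerSeries.C _)] at h0
  have key := congrArg (MvPowerSeries.coeff α) h0
  rw [hOp_sum]
  simp only [map_add, MvPowerSeries.coeff_C_mul, map_sum] at key
  simp only [MvPowerSeries.coeff_mul] at key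
  have hz : ∀ (a : Fin N) (v : Fin N →₀ ℕ), MvPowerSeries.coeff v
      (tens (Function.update (fun _ => epsSeries q t c x y) a
        (PowerSeries.rescale t (epsSeries q t c x y)))) = t ^ v a * epsProd q t c v x y := by
    intro a v
    rw [coeff_tens, epsProd, ← mul_prod_erase _ _ (mem_univ a), ← mul_prod_erase univ
      (fun a => eps q t c (v a) x y) (mem_univ a), Function.update_self, PowerSeries.coeff_rescale,
      ← mul_assoc]
    congr 1
    exact prod_congr rfl fun b hb => by rw [Function.update_of_ne (mem_erase.1 hb).1]; rfl
  simp only [hz, coeff_tens_epsSeries] at key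
  have hL : ∑ p ∈ antidiagonal α, vdmCoeff p.1 * hOp ((1 - t⁻¹) * t * t⁻¹ ^ n * q ^ m) (1 - q) q t c
      (fun x y => epsProd q t c p.2 x y) x y =
      (1 - t⁻¹) * t * t⁻¹ ^ n * q ^ m * ∑ i, shiftCoeff t c (q * c) i x y *
          ∑ p ∈ antidiagonal α, vdmCoeff p.1 * epsProd q t c p.2 (scaleOn {i} q⁻¹ x) y +
        (1 - q) * ∑ j, shiftCoeff q c⁻¹ (t * c⁻¹) j y⁻¹ x⁻¹ *
          ∑ p ∈ antidiagonal α, vdmCoeff p.1 * epsProd q t c p.2 x (scaleOn {j} t y) := by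
    rw [← hOp_sum]
    rfl
  have hR : ∑ p ∈ antidiagonal α, dualCoeff q t (1 - q⁻¹ ^ N * t⁻¹ ^ n * q ^ m)
        ((1 - q⁻¹) * t⁻¹ ^ n * q ^ m) p.1 p.2 * epsProd q t c p.2 x y =
      (1 - q⁻¹ ^ N * t⁻¹ ^ n * q ^ m) * (∑ p ∈ antidiagonal α,
        vdmCoeff p.1 * epsProd q t c p.2 x y) - (1 - q⁻¹) * t⁻¹ ^ n * q ^ m *
        ∑ a, ∑ p ∈ antidiagonal α, MvPowerSeries.coeff p.1
          (vdmTwist (MvPowerSeries.C q⁻¹) MvPowerSeries.X a) *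
          (t ^ p.2 a * epsProd q t c p.2 x y) := by
    rw [sum_comm (s := univ), mul_sum, mul_sum, ← sum_sub_distrib]
    refine sum_congr rfl fun p _ => ?_
    simp only [dualCoeff, sub_mul, mul_sum, sum_mul]
    congr 1
    · ring
    · exact sum_congr rfl fun a _ => by ring
  rw [hL, hR]
  exact eq_sub_of_add_eq key

variable {q t c ξ ξ' : ℝ}

lemma shiftOK_of_lt (h : IsParam q t c) (hξ' : 0 < ξ') (h1 : c * ξ' < ξ)
    (h2 : ξ' < q * c * ξ) : ShiftOK q c ξ ξ' ∧ ShiftOK t c⁻¹ ξ' ξ := by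
  have hc := h.c_pos
  have hq := h.q_pos
  have hξ : 0 < ξ := lt_trans (by positivity) h1
  have hrel : t * c⁻¹ = q * c := by
    have := h.rel; field_simp; linarith
  have e1 : ξ' < c * (q * ξ) := by linarith
  have e2 : c⁻¹ * ξ' < q * ξ := by rwa [inv_mul_lt_iff₀ hc]
  refine ⟨⟨hξ, hξ', fun u hu hu1 => ?_, fun u hu hu1 => ?_, h1.ne⟩,
    ⟨hξ', hξ, fun u hu hu1 => ?_, fun u hu hu1 => ?_, ?_⟩⟩
  · exact (e1.trans_le (by gcongr)).ne'
  · refine ne_of_lt (lt_of_lt_of_le ?_ (mul_le_mul_of_nonneg_right hu hξ.le))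
    rw [mul_assoc]; gcongr
  · have : c⁻¹ * (u * ξ') ≤ c⁻¹ * ξ' := by
      gcongr
      nlinarith
    have h3 : q * ξ < ξ := by nlinarith [h.q_lt]
    exact (this.trans_lt (e2.trans h3)).ne
  · rw [hrel]
    exact (lt_of_le_of_lt (by nlinarith) h2).ne'
  · rw [ne_eq, inv_mul_eq_iff_eq_mul₀ hc.ne']
    intro h4
    have h3 : q * ξ < ξ := by nlinarith [h.q_lt]
    have : c * (q * ξ) < c * ξ := by gcongr
    linarith

/-- The Gram matrix of the products of deformed elementary symmetric functions. -/
def gram (n m : ℕ) (q t c ξ ξ' : ℝ) (v v' : Fin N →₀ ℕ) : ℂ :=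
  wInt q t c ξ ξ' fun (x : Fin n → ℂ) (y : Fin m → ℂ) =>
    epsProd (q : ℂ) t c v x y * epsProd (q : ℂ) t c v' x⁻¹ y⁻¹

lemma wInt_sum_mul_sum (h : IsParam q t c) (hξ : 0 < ξ) (hξ' : 0 < ξ') (h1 : c * ξ ≠ ξ')
    (h2 : c * ξ' ≠ ξ) {ι ι' : Type*} (s : Finset ι) (s' : Finset ι') (a : ι → ℂ) (b : ι' → ℂ)
    {f : ι → (Fin n → ℂ) → (Fin m → ℂ) → ℂ} {g : ι' → (Fin n → ℂ) → (Fin m → ℂ) → ℂ}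
    (hf : ∀ i ∈ s, HolStar (f i)) (hg : ∀ i ∈ s', HolStar (g i)) :
    wInt q t c ξ ξ' (fun x y => (∑ i ∈ s, a i * f i x y) * ∑ i ∈ s', b i * g i x y) =
      ∑ i ∈ s, ∑ i' ∈ s', a i * b i' * wInt q t c ξ ξ' (fun x y => f i x y * g i' x y) := by
  unfold wInt
  have e : ∀ (x : Fin n → ℂ) (y : Fin m → ℂ), wt (q : ℂ) t c x y *
      ((∑ i ∈ s, a i * f i x y) * ∑ i ∈ s', b i * g i x y) = ∑ i ∈ s, ∑ i' ∈ s',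
        a i * b i' * (wt (q : ℂ) t c x y * (f i x y * g i' x y)) := by
    intro x y
    rw [sum_mul_sum, mul_sum]
    refine sum_congr rfl fun i _ => ?_
    rw [mul_sum]
    exact sum_congr rfl fun i' _ => by ring
  have hcont : ∀ i ∈ s, ∀ i' ∈ s', ContinuousOn (Function.uncurry fun x y =>
      a i * b i' * (wt (q : ℂ) t c x y * (f i x y * g i' x y))) (torusSet n m ξ ξ') :=
    fun i hi i' hi' => continuousOn_const.mul ((continuousOn_wt h hξ hξ' h1 h2).mul
      (((hf i hi).mul (hg i' hi')).continuousOn hξ hξ'))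
  simp only [e]
  rw [torusInt_sum hξ hξ' s (F := fun i x y => ∑ i' ∈ s',
        a i * b i' * (wt (q : ℂ) t c x y * (f i x y * g i' x y)))
      fun i hi => continuousOn_finsetSum s' fun i' hi' => hcont i hi i' hi']
  refine sum_congr rfl fun i hi => ?_
  rw [torusInt_sum hξ hξ' s' (F := fun i' x y =>
        a i * b i' * (wt (q : ℂ) t c x y * (f i x y * g i' x y))) (hcont i hi)]
  exact sum_congr rfl fun i' _ => torusInt_const_mul _ _

lemma gram_relation (h : IsParam q t c) (hξ' : 0 < ξ') (h1 : c * ξ' < ξ) (h2 : ξ' < q * c * ξ)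
    (α α' : Fin N →₀ ℕ) :
    let κ : ℂ := 1 - (q : ℂ)⁻¹ ^ N * (t : ℂ)⁻¹ ^ n * q ^ m
    let κ' : ℂ := (1 - (q : ℂ)⁻¹) * (t : ℂ)⁻¹ ^ n * q ^ m
    ∑ p ∈ antidiagonal α, ∑ p' ∈ antidiagonal α',
      (dualCoeff q t κ κ' p.1 p.2 * vdmCoeff p'.1 - vdmCoeff p.1 * dualCoeff q t κ κ' p'.1 p'.2) *
        gram n m q t c ξ ξ' p.2 p'.2 = 0 := by
  intro κ κ'
  have hc := h.c_pos
  have hq := h.q_pos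
  have hξ : 0 < ξ := lt_trans (by positivity) h1
  obtain ⟨hs, hs'⟩ := shiftOK_of_lt h hξ' h1 h2
  have h1' : c * ξ ≠ ξ' := by
    have := hs.left 1 h.q_lt.le le_rfl
    rwa [one_mul] at this
  have hH : ∀ (α : Fin N →₀ ℕ) (b : (Fin N →₀ ℕ) × (Fin N →₀ ℕ) → ℂ),
      HolStar (fun (x : Fin n → ℂ) (y : Fin m → ℂ) =>
        ∑ p ∈ antidiagonal α, b p * epsProd (q : ℂ) t c p.2 x y) := fun α b =>
    HolStar.sum fun p _ => (holStar_epsProd _ _ _ _).const_mul _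
  have key := wInt_hOp_mul h hs hs' ((1 - (t : ℂ)⁻¹) * t * (t : ℂ)⁻¹ ^ n * q ^ m) (1 - q)
    (hH α fun p => vdmCoeff p.1) (hH α' fun p => vdmCoeff p.1)
  have hker : ∀ (α : Fin N →₀ ℕ) {r r' : ℝ}, 0 < r → 0 < r' → r ≠ q * c * r' →
      ∀ p ∈ torusSet n m r r', Function.Injective p.1 → Function.Injective p.2 →
      hOp ((1 - (t : ℂ)⁻¹) * t * (t : ℂ)⁻¹ ^ n * q ^ m) (1 - q) (q : ℂ) t c
        (fun x y => ∑ p ∈ antidiagonal α, vdmCoeff p.1 * epsProd (q : ℂ) t c p.2 x y) p.1 p.2 =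
      ∑ p' ∈ antidiagonal α, dualCoeff q t κ κ' p'.1 p'.2 * epsProd (q : ℂ) t c p'.2 p.1 p.2 := by
    intro α r r' hr hr' hrr p hp hx hy
    refine hOp_epsProd_sum (by exact_mod_cast h.q_pos.ne') (by exact_mod_cast h.t_pos.ne')
      (by exact_mod_cast h.c_pos.ne') (fun k => ?_) (by exact_mod_cast h.rel) hx hy
      (fun i => norm_pos_iff.1 (by rw [hp.1]; exact hr))
      (fun j => norm_pos_iff.1 (by rw [hp.2]; exact hr')) (fun i j hij => hrr ?_) α
    · exact_mod_cast (pow_lt_one₀ h.t_pos.le h.t_lt (by omega)).ne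
    · have := congrArg norm hij
      rwa [norm_mul, norm_mul, hp.1, hp.2, norm_ofReal_pos h.q_pos, norm_ofReal_pos h.c_pos] at this
  have hqc : q * c * ξ' < ξ := lt_trans (by
    have := h.q_lt; rw [mul_assoc]; nlinarith [mul_pos hc hξ']) h1
  have eL : wInt q t c ξ ξ' (fun (x : Fin n → ℂ) (y : Fin m → ℂ) =>
      (∑ p ∈ antidiagonal α, dualCoeff q t κ κ' p.1 p.2 * epsProd (q : ℂ) t c p.2 x y) *
        ∑ p ∈ antidiagonal α', vdmCoeff p.1 * epsProd (q : ℂ) t c p.2 x⁻¹ y⁻¹) =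
      wInt q t c ξ ξ' (fun (x : Fin n → ℂ) (y : Fin m → ℂ) =>
      (∑ p ∈ antidiagonal α, vdmCoeff p.1 * epsProd (q : ℂ) t c p.2 x y) *
        ∑ p ∈ antidiagonal α', dualCoeff q t κ κ' p.1 p.2 * epsProd (q : ℂ) t c p.2 x⁻¹ y⁻¹) := by
    refine Eq.trans ?_ (key.trans ?_)
    · refine torusInt_congr_ae hξ hξ' fun p hp hx hy => ?_
      have hk := hker α hξ hξ' hqc.ne' p hp hx hy
      dsimp only at hk ⊢
      rw [hk]
    · refine torusInt_congr_ae hξ hξ' fun p hp hx hy => ?_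
      have h3 : ξ⁻¹ ≠ q * c * ξ'⁻¹ := by
        intro h3
        field_simp at h3
        linarith
      have hk := hker α' (inv_pos.2 hξ) (inv_pos.2 hξ') h3 (p.1⁻¹, p.2⁻¹)
        ⟨fun i => by simp [hp.1], fun j => by simp [hp.2]⟩
        (inv_injective.comp hx) (inv_injective.comp hy)
      dsimp only at hk ⊢
      rw [hk]
  have hexp := fun a b : (Fin N →₀ ℕ) × (Fin N →₀ ℕ) → ℂ =>
    wInt_sum_mul_sum h hξ hξ' h1' h1.ne (antidiagonal α) (antidiagonal α') a b
      (f := fun p (x : Fin n → ℂ) (y : Fin m → ℂ) => epsProd (q : ℂ) t c p.2 x y)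
      (g := fun p x y => epsProd (q : ℂ) t c p.2 x⁻¹ y⁻¹)
      (fun _ _ => holStar_epsProd _ _ _ _) (fun _ _ => (holStar_epsProd _ _ _ _).inv)
  have eL' := sub_eq_zero.2 (((hexp (fun p => dualCoeff q t κ κ' p.1 p.2)
    fun p => vdmCoeff p.1).symm.trans eL).trans
      (hexp (fun p => vdmCoeff p.1) fun p => dualCoeff q t κ κ' p.1 p.2))
  rw [← sum_sub_distrib] at eL'
  refine Eq.trans (sum_congr rfl fun p _ => ?_) eL'
  rw [← sum_sub_distrib]
  refine sum_congr rfl fun p' _ => ?_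
  rw [gram, sub_mul]

end GramRelation

section LeadingCoefficient

variable {N : ℕ}

/-- `r` is the coefficient of the monomial `d` in `f`, and all coefficients of lexicographically
smaller monomials vanish. -/
def LeadCoeff (f : MvPowerSeries (Fin N) ℂ) (d : Fin N →₀ ℕ) (r : ℂ) : Prop :=
  MvPowerSeries.coeff d f = r ∧ ∀ u, toLex u < toLex d → MvPowerSeries.coeff u f = 0

lemma LeadCoeff.one : LeadCoeff (1 : MvPowerSeries (Fin N) ℂ) 0 1 := by
  refine ⟨by simp, fun u hu => ?_⟩
  exact absurd hu (not_lt.2 (Finsupp.toLex_monotone zero_le))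

lemma LeadCoeff.mul {f g : MvPowerSeries (Fin N) ℂ} {d e : Fin N →₀ ℕ} {r s : ℂ}
    (hf : LeadCoeff f d r) (hg : LeadCoeff g e s) : LeadCoeff (f * g) (d + e) (r * s) := by
  classical
  refine ⟨?_, fun w hw => ?_⟩
  · rw [MvPowerSeries.coeff_mul, sum_eq_single_of_mem ⟨d, e⟩ (by simp)]
    · rw [hf.1, hg.1]
    rintro ⟨u, v⟩ h h'
    simp only [HasAntidiagonal.mem_antidiagonal] at h
    rcases trichotomy_of_add_eq_add (congrArg toLex h) with h'' | h'' | h''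
    · exact False.elim (h' (by simp_all))
    · rw [hf.2 u h'', zero_mul]
    · rw [hg.2 v h'', mul_zero]
  · rw [MvPowerSeries.coeff_mul]
    refine sum_eq_zero fun p hp => ?_
    rw [HasAntidiagonal.mem_antidiagonal] at hp
    by_cases h1 : toLex p.1 < toLex d
    · rw [hf.2 _ h1, zero_mul]
    by_cases h2 : toLex p.2 < toLex e
    · rw [hg.2 _ h2, mul_zero]
    refine absurd hw (not_lt.2 ?_)
    rw [← hp, toLex_add, toLex_add]
    exact add_le_add (not_lt.1 h1) (not_lt.1 h2)

lemma LeadCoeff.prod {ι : Type*} (s : Finset ι) {f : ι → MvPowerSeries (Fin N) ℂ}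
    {d : ι → Fin N →₀ ℕ} {r : ι → ℂ} (h : ∀ i ∈ s, LeadCoeff (f i) (d i) (r i)) :
    LeadCoeff (∏ i ∈ s, f i) (∑ i ∈ s, d i) (∏ i ∈ s, r i) := by
  classical
  induction s using Finset.induction_on with
  | empty => simpa using LeadCoeff.one
  | insert a s ha ih =>
    rw [prod_insert ha, sum_insert ha, prod_insert ha]
    exact (h a (mem_insert_self a s)).mul (ih fun i hi => h i (mem_insert_of_mem hi))

lemma leadCoeff_sub {b c : Fin N} (hbc : b < c) (r s : ℂ) :
    LeadCoeff (MvPowerSeries.C r * MvPowerSeries.X b - MvPowerSeries.C s * MvPowerSeries.X c)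
      (Finsupp.single c 1) (-s) := by
  classical
  have hlt : toLex (Finsupp.single c 1) < toLex (Finsupp.single b 1 : Fin N →₀ ℕ) :=
    Finsupp.Lex.single_lt_iff.2 hbc
  refine ⟨?_, fun u hu => ?_⟩
  · rw [map_sub, MvPowerSeries.coeff_C_mul, MvPowerSeries.coeff_C_mul, MvPowerSeries.coeff_X,
      MvPowerSeries.coeff_X, if_neg, if_pos rfl]
    · ring
    · intro h
      rw [h] at hlt
      exact lt_irrefl _ hlt
  · rw [map_sub, MvPowerSeries.coeff_C_mul, MvPowerSeries.coeff_C_mul, MvPowerSeries.coeff_X,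
      MvPowerSeries.coeff_X, if_neg, if_neg]
    · ring
    · rintro rfl
      exact lt_irrefl _ hu
    · rintro rfl
      exact lt_asymm hu hlt

/-- The leading exponent of the Vandermonde product. -/
def vdmExp (N : ℕ) : Fin N →₀ ℕ :=
  ∑ b, ∑ c, if b < c then Finsupp.single c 1 else 0

/-- The leading coefficient of the Vandermonde product. -/
def vdmSign (N : ℕ) : ℂ := ∏ b : Fin N, ∏ c : Fin N, if b < c then -1 else 1

lemma vdmSign_ne_zero : vdmSign N ≠ 0 := by
  refine prod_ne_zero_iff.2 fun b _ => prod_ne_zero_iff.2 fun c _ => ?_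
  split_ifs <;> simp

lemma leadCoeff_vdm : LeadCoeff (vdm MvPowerSeries.X) (vdmExp N) (vdmSign N) := by
  refine LeadCoeff.prod _ fun b _ => LeadCoeff.prod _ fun c _ => ?_
  split_ifs with hbc
  · simpa using leadCoeff_sub hbc 1 1
  · exact LeadCoeff.one

lemma leadCoeff_vdmTwist (r : ℂ) (a : Fin N) :
    LeadCoeff (vdmTwist (MvPowerSeries.C r) MvPowerSeries.X a) (vdmExp N)
      (vdmSign N * r ^ (N - 1 - a)) := by
  have e : vdmSign N * r ^ (N - 1 - a) = ∏ b : Fin N, ∏ c : Fin N,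
      if b < c then (if b = a then -r else -1) else 1 := by
    have e2 : r ^ (N - 1 - a) = ∏ b : Fin N, ∏ c : Fin N, if b < c ∧ b = a then r else 1 := by
      rw [Fintype.prod_eq_single a]
      · simp [prod_ite, ← Fin.card_Ioi, filter_lt_eq_Ioi]
      · intro b hb
        simp [hb]
    rw [e2, vdmSign, ← prod_mul_distrib]
    refine prod_congr rfl fun b _ => ?_
    rw [← prod_mul_distrib]
    refine prod_congr rfl fun c _ => ?_
    rcases eq_or_ne b a with rfl | h2
    · by_cases h1 : b < c <;> simp [h1]
    · by_cases h1 : b < c <;> simp [h1, h2]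
  rw [e]
  refine LeadCoeff.prod _ fun b _ => LeadCoeff.prod _ fun c _ => ?_
  split_ifs with hbc hca hba hba
  · exact absurd (hba.trans hca.symm) hbc.ne
  · simpa using leadCoeff_sub hbc r 1
  · simpa using leadCoeff_sub hbc 1 r
  · simpa using leadCoeff_sub hbc 1 1
  · exact LeadCoeff.one

/-- The eigenvalue-like diagonal entries of the dual operator. -/
def dualEigen (r t : ℂ) (v : Fin N →₀ ℕ) : ℂ := ∑ a : Fin N, r ^ (N - 1 - (a : ℕ)) * t ^ v a

lemma dualCoeff_vdmExp (q t κ κ' : ℂ) (v : Fin N →₀ ℕ) :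
    dualCoeff q t κ κ' (vdmExp N) v = vdmSign N * (κ - κ' * dualEigen q⁻¹ t v) := by
  simp only [dualCoeff, dualEigen, vdmCoeff, leadCoeff_vdm.1, (leadCoeff_vdmTwist q⁻¹ _).1,
    mul_assoc, ← mul_sum]
  ring

lemma dualCoeff_of_lt (q t κ κ' : ℂ) {u : Fin N →₀ ℕ} (hu : toLex u < toLex (vdmExp N))
    (v : Fin N →₀ ℕ) : dualCoeff q t κ κ' u v = 0 := by
  simp [dualCoeff, vdmCoeff, leadCoeff_vdm.2 u hu, (leadCoeff_vdmTwist q⁻¹ _).2 u hu]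

lemma eq_zero_of_triangular_relation {V : (Fin N →₀ ℕ) → ℂ}
    {D : (Fin N →₀ ℕ) → (Fin N →₀ ℕ) → ℂ} {δ : Fin N →₀ ℕ}
    (hV : ∀ u, toLex u < toLex δ → V u = 0) (hD : ∀ u v, toLex u < toLex δ → D u v = 0)
    (hδ : V δ ≠ 0) (hne : ∀ β γ, β ≠ γ → D δ β ≠ D δ γ)
    {C : (Fin N →₀ ℕ) → (Fin N →₀ ℕ) → ℂ} (hdiag : ∀ β, C β β = 0)
    (hrel : ∀ α α', ∑ p ∈ antidiagonal α, ∑ p' ∈ antidiagonal α',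
      (D p.1 p.2 * V p'.1 - V p.1 * D p'.1 p'.2) * C p.2 p'.2 = 0) (β γ : Fin N →₀ ℕ) :
    C β γ = 0 := by
  suffices ∀ (β γ : Lex (Fin N →₀ ℕ)), C (ofLex β) (ofLex γ) = 0 from this (toLex β) (toLex γ)
  intro β
  induction β using WellFoundedLT.induction with
  | ind β ihβ =>
  intro γ
  induction γ using WellFoundedLT.induction with
  | ind γ ihγ =>
  by_cases hβγ : β = γ
  · rw [hβγ, hdiag]
  have h := hrel (δ + ofLex β) (δ + ofLex γ)
  have hcase : ∀ {ε : Lex (Fin N →₀ ℕ)} {p : (Fin N →₀ ℕ) × (Fin N →₀ ℕ)},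
      p ∈ antidiagonal (δ + ofLex ε) → p ≠ (δ, ofLex ε) →
      toLex p.1 < toLex δ ∨ toLex p.2 < ε := by
    intro ε p hp hne
    rw [HasAntidiagonal.mem_antidiagonal] at hp
    rcases trichotomy_of_add_eq_add (congrArg toLex hp) with h'' | h'' | h''
    · exact absurd (Prod.ext h''.1 h''.2) hne
    · exact Or.inl h''
    · exact Or.inr h''
  rw [sum_eq_single_of_mem (δ, ofLex β) (by simp), sum_eq_single_of_mem (δ, ofLex γ) (by simp)] at h
  · dsimp only at h
    rcases mul_eq_zero.1 h with h | h
    · refine absurd ?_ (hne (ofLex β) (ofLex γ) (fun e => hβγ (ofLex.injective e)))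
      have : V δ * (D δ (ofLex β) - D δ (ofLex γ)) = 0 := by linear_combination h
      exact sub_eq_zero.1 ((mul_eq_zero.1 this).resolve_left hδ)
    · exact h
  · intro p hp hpne
    rcases hcase hp hpne with h1 | h1
    · simp [hV _ h1, hD _ _ h1]
    · rw [show C (δ, ofLex β).2 p.2 = 0 from ihγ _ h1, mul_zero]
  · intro p hp hpne
    refine sum_eq_zero fun p' _ => ?_
    rcases hcase hp hpne with h1 | h1
    · simp [hV _ h1, hD _ _ h1]
    · rw [show C p.2 p'.2 = 0 from ihβ _ h1 (toLex p'.2), mul_zero]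

lemma dualEigen_eq_eval (r t : ℂ) (v : Fin N →₀ ℕ) :
    dualEigen r t v = (∑ a : Fin N, Polynomial.C (t ^ v a) * Polynomial.X ^ (N - 1 - (a : ℕ))).eval
      r := by
  simp [dualEigen, Polynomial.eval_finsetSum, mul_comm]

lemma countable_not_injective_dualEigen {t : ℝ} (ht : 0 < t) (ht1 : t < 1) :
    {r : ℂ | ¬ Function.Injective (dualEigen (N := N) r t)}.Countable := by
  have key : ∀ v v' : Fin N →₀ ℕ, v ≠ v' → {r : ℂ | dualEigen r t v = dualEigen r t v'}.Countable := by
    intro v v' hne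
    set p : (Fin N →₀ ℕ) → Polynomial ℂ := fun v =>
      ∑ a : Fin N, Polynomial.C ((t : ℂ) ^ v a) * Polynomial.X ^ (N - 1 - (a : ℕ)) with hp
    have hcoef : ∀ v (a : Fin N), (p v).coeff (N - 1 - a) = (t : ℂ) ^ v a := by
      intro v a
      simp only [hp, Polynomial.finsetSum_coeff, Polynomial.coeff_C_mul, Polynomial.coeff_X_pow]
      rw [Fintype.sum_eq_single a]
      · simp
      · intro b hb
        rw [if_neg, mul_zero]
        intro h
        exact hb (Fin.ext (by omega))
    have hpne : p v - p v' ≠ 0 := by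
      intro h
      refine hne (Finsupp.ext fun a => ?_)
      have := congrArg (fun P => P.coeff (N - 1 - a)) (sub_eq_zero.1 h)
      simp only [hcoef] at this
      exact pow_right_injective₀ ht ht1.ne (by exact_mod_cast this)
    refine ((p v - p v').roots.toFinset.finite_toSet.subset ?_).countable
    intro r hr
    simp only [Set.mem_ofPred_eq, dualEigen_eq_eval] at hr
    rw [mem_coe, Multiset.mem_toFinset, Polynomial.mem_roots hpne, Polynomial.IsRoot,
      Polynomial.eval_sub]
    exact sub_eq_zero.2 hr
  have : {r : ℂ | ¬ Function.Injective (dualEigen (N := N) r t)} ⊆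
      ⋃ p : {p : (Fin N →₀ ℕ) × (Fin N →₀ ℕ) // p.1 ≠ p.2},
        {r : ℂ | dualEigen r t p.1.1 = dualEigen r t p.1.2} := by
    intro r hr
    simp only [Set.mem_ofPred_eq, Function.Injective, not_forall] at hr
    obtain ⟨v, v', h, hne⟩ := hr
    exact Set.mem_iUnion.2 ⟨⟨(v, v'), hne⟩, h⟩
  exact (Set.countable_iUnion fun p => key _ _ p.2).mono this

end LeadingCoefficient

section GramSymmetry

variable {N n m : ℕ} {q t c ξ ξ' : ℝ}

lemma gram_symm_of_injective (h : IsParam q t c) (hξ' : 0 < ξ') (h1 : c * ξ' < ξ)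
    (h2 : ξ' < q * c * ξ) (hinj : Function.Injective (dualEigen (N := N) (q : ℂ)⁻¹ t))
    (β γ : Fin N →₀ ℕ) : gram n m q t c ξ ξ' β γ = gram n m q t c ξ ξ' γ β := by
  have hq0 : (q : ℂ) ≠ 0 := by exact_mod_cast h.q_pos.ne'
  have ht0 : (t : ℂ) ≠ 0 := by exact_mod_cast h.t_pos.ne'
  have hq1 : (1 : ℂ) - (q : ℂ)⁻¹ ≠ 0 := by
    rw [sub_ne_zero, ne_eq, eq_comm, inv_eq_one]
    exact_mod_cast h.q_lt.ne
  have hrel := fun α α' => gram_relation (n := n) (m := m) h hξ' h1 h2 (N := N) α α'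
  dsimp only at hrel
  set κ : ℂ := 1 - (q : ℂ)⁻¹ ^ N * (t : ℂ)⁻¹ ^ n * q ^ m
  set κ' : ℂ := (1 - (q : ℂ)⁻¹) * (t : ℂ)⁻¹ ^ n * q ^ m with hκ'
  have hκ0 : κ' ≠ 0 := by
    rw [hκ']
    exact mul_ne_zero (mul_ne_zero hq1 (pow_ne_zero _ (inv_ne_zero ht0))) (pow_ne_zero _ hq0)
  rw [← sub_eq_zero]
  refine eq_zero_of_triangular_relation (V := vdmCoeff) (D := dualCoeff q t κ κ') (δ := vdmExp N)
    (C := fun β γ => gram n m q t c ξ ξ' β γ - gram n m q t c ξ ξ' γ β)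
    (fun u hu => leadCoeff_vdm.2 u hu) (fun u v hu => dualCoeff_of_lt _ _ _ _ hu v)
    (by rw [vdmCoeff, leadCoeff_vdm.1]; exact vdmSign_ne_zero) (fun β γ hne he => hne (hinj ?_))
    (fun β => sub_self _) (fun α α' => ?_) β γ
  · rw [dualCoeff_vdmExp, dualCoeff_vdmExp] at he
    exact mul_left_cancel₀ hκ0 (sub_right_inj.1 (mul_left_cancel₀ vdmSign_ne_zero he))
  · have e1 := hrel α α'
    have e2 := hrel α' α
    rw [sum_comm] at e2
    rw [← add_zero (0 : ℂ)]
    nth_rw 1 [← e1]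
    rw [← e2, ← sum_add_distrib]
    refine sum_congr rfl fun p _ => ?_
    rw [← sum_add_distrib]
    exact sum_congr rfl fun p' _ => by ring

lemma continuous_wRatio_comp {Ω : Type*} [TopologicalSpace Ω] {q t v : Ω → ℂ} (hq : Continuous q)
    (ht : Continuous t) (hv : Continuous v) (hq1 : ∀ w, ‖q w‖ < 1) (htv : ∀ w, ‖t w * v w‖ < 1) :
    Continuous fun w => wRatio (q w) (t w) (v w) :=
  (continuousOn_qPochInf.comp_continuous (hv.prodMk hq) hq1).div
    (continuousOn_qPochInf.comp_continuous ((ht.mul hv).prodMk hq) hq1)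
    fun w => qPochInf_ne_zero (hq1 w) (htv w)

lemma continuous_wt_comp {Ω : Type*} [TopologicalSpace Ω] {q t c : Ω → ℂ} {x : Ω → Fin n → ℂ}
    {y : Ω → Fin m → ℂ} (hq : Continuous q) (ht : Continuous t) (hc : Continuous c)
    (hx : Continuous x) (hy : Continuous y) (hq1 : ∀ w, ‖q w‖ < 1) (ht1 : ∀ w, ‖t w‖ < 1)
    {r r' : ℝ} (hr : 0 < r) (hr' : 0 < r') (hxr : ∀ w i, ‖x w i‖ = r) (hyr : ∀ w j, ‖y w j‖ = r')
    (h1 : ∀ w, ‖c w‖ * r ≠ r') (h2 : ∀ w, ‖c w‖ * r' ≠ r) :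
    Continuous fun w => wt (q w) (t w) (c w) (x w) (y w) := by
  have hx0 : ∀ w i, x w i ≠ 0 := fun w i => norm_pos_iff.1 (by rw [hxr]; exact hr)
  have hy0 : ∀ w j, y w j ≠ 0 := fun w j => norm_pos_iff.1 (by rw [hyr]; exact hr')
  have hxi : ∀ i, Continuous fun w => x w i := fun i => (continuous_apply i).comp hx
  have hyj : ∀ j, Continuous fun w => y w j := fun j => (continuous_apply j).comp hy
  unfold wt twistNM twistWeight mixedDen
  refine ((continuous_finsetProd _ fun a _ => continuous_finsetProd _ fun b _ => ?_).mul
    (continuous_finsetProd _ fun a _ => continuous_finsetProd _ fun b _ => ?_)).div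
    (continuous_finsetProd _ fun i _ => continuous_finsetProd _ fun j _ => ?_) fun w => ?_
  · split_ifs
    · refine continuous_wRatio_comp hq ht
        (continuous_const.mul ((hxi a).div (hxi b) fun w => hx0 w b)) hq1 fun w => ?_
      simpa [hxr, hr.ne'] using ht1 w
    · exact continuous_const
  · split_ifs
    · refine continuous_wRatio_comp ht hq
        (continuous_const.mul ((hyj a).div (hyj b) fun w => hy0 w b)) ht1 fun w => ?_
      simpa [hyr, hr'.ne'] using hq1 w
    · exact continuous_const
  · exact (continuous_const.sub (hc.mul ((hxi i).div (hyj j) fun w => hy0 w j))).mul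
      (continuous_const.sub (hc.mul ((hyj j).div (hxi i) fun w => hx0 w i)))
  · refine prod_ne_zero_iff.2 fun i _ => prod_ne_zero_iff.2 fun j _ => mul_ne_zero ?_ ?_
    · exact sub_ne_zero.2 (ne_one_of_norm (hxr w i) (hyr w j) hr' (h1 w)).symm
    · exact sub_ne_zero.2 (ne_one_of_norm (hyr w j) (hxr w i) hr (h2 w)).symm

/-- The parameters `q` for which the radii `ξ` and `1` are far apart. -/
def farParam (t ξ : ℝ) : Set ℝ :=
  {q | 0 < q ∧ q < 1 ∧ √(t / q) < ξ ∧ 1 < q * √(t / q) * ξ}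

lemma isParam_sqrt (ht : 0 < t) (ht1 : t < 1) (hq : 0 < q) (hq1 : q < 1) :
    IsParam q t √(t / q) where
  q_pos := hq
  q_lt := hq1
  t_pos := ht
  t_lt := ht1
  c_pos := Real.sqrt_pos.2 (by positivity)
  rel := by rw [Real.sq_sqrt (by positivity)]; field_simp

lemma isOpen_farParam (t ξ : ℝ) : IsOpen (farParam t ξ) := by
  rw [isOpen_iff_mem_nhds]
  rintro q ⟨h1, h2, h3, h4⟩
  have hc : ContinuousAt (fun q : ℝ => √(t / q)) q :=
    (continuousAt_const.div continuousAt_id h1.ne').sqrt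
  filter_upwards [lt_mem_nhds h1, gt_mem_nhds h2, hc.eventually_lt continuousAt_const h3,
    continuousAt_const.eventually_lt ((continuousAt_id.mul hc).mul continuousAt_const) h4]
    with r a1 a2 a3 a4 using ⟨a1, a2, a3, a4⟩

lemma continuousOn_gram (ht : 0 < t) (ht1 : t < 1) (ξ : ℝ) (v v' : Fin N →₀ ℕ) :
    ContinuousOn (fun q => gram n m q t √(t / q) ξ 1 v v') (farParam t ξ) := by
  rw [continuousOn_iff_continuous_domRestrict]
  rcases (farParam t ξ).eq_empty_or_nonempty with he | ⟨q₀, hq₀⟩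
  · have : IsEmpty (farParam t ξ) := Set.isEmpty_coe_sort.2 he
    exact continuous_of_discreteTopology
  have hξ : 0 < ξ := (Real.sqrt_nonneg _).trans_lt hq₀.2.2.1
  have : LocallyCompactSpace (farParam t ξ) := (isOpen_farParam t ξ).locallyCompactSpace
  let Ω := farParam t ξ × TorusParam n m
  have hq : Continuous fun w : Ω => ((w.1 : ℝ) : ℂ) :=
    continuous_ofReal.comp (continuous_subtype_val.comp continuous_fst)
  have hc : Continuous fun w : Ω => ((√(t / (w.1 : ℝ)) : ℝ) : ℂ) :=
    continuous_ofReal.comp ((continuous_const.div (continuous_subtype_val.comp continuous_fst)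
      fun w => w.1.2.1.ne').sqrt)
  have hx : Continuous fun w : Ω => torusPt ξ w.2.1 :=
    continuous_torusPt.comp (continuous_fst.comp continuous_snd)
  have hy : Continuous fun w : Ω => torusPt 1 w.2.2 :=
    continuous_torusPt.comp (continuous_snd.comp continuous_snd)
  have hxn : ∀ (w : Ω) i, ‖torusPt ξ w.2.1 i‖ = ξ := fun w i => norm_torusPt hξ _ i
  have hyn : ∀ (w : Ω) i, ‖torusPt 1 w.2.2 i‖ = 1 := fun w i => norm_torusPt one_pos _ i
  have hE : ∀ (v : Fin N →₀ ℕ) (x : Ω → Fin n → ℂ) (y : Ω → Fin m → ℂ), Continuous x →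
      Continuous y → Continuous fun w : Ω =>
        epsProd ((w.1 : ℝ) : ℂ) t (√(t / (w.1 : ℝ)) : ℝ) v (x w) (y w) := by
    intro v x y hx hy
    have hA : ∀ f : Ω → ℂ, f ∈ (ContinuousMap.coeFnAlgHom (α := Ω) (A := ℂ) ℂ).range ↔
        Continuous f := fun f =>
      ⟨fun ⟨g, hg⟩ => hg ▸ g.continuous, fun hf => ⟨⟨f, hf⟩, rfl⟩⟩
    exact (hA _).1 (epsProd_mem _ _ ((hA _).2 hq) ((hA _).2 hc)
      (fun i => (hA _).2 ((continuous_apply i).comp hx))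
      (fun i => (hA _).2 ((continuous_apply i).comp hy)) v)
  have hF : Continuous (Function.uncurry fun (q : farParam t ξ) (g : TorusParam n m) =>
      wt ((q : ℝ) : ℂ) t (√(t / (q : ℝ)) : ℝ) (torusPt ξ g.1) (torusPt 1 g.2) *
        (epsProd ((q : ℝ) : ℂ) t (√(t / (q : ℝ)) : ℝ) v (torusPt ξ g.1) (torusPt 1 g.2) *
          epsProd ((q : ℝ) : ℂ) t (√(t / (q : ℝ)) : ℝ) v' (torusPt ξ g.1)⁻¹ (torusPt 1 g.2)⁻¹)) := by
    refine (continuous_wt_comp hq continuous_const hc hx hy ?_ ?_ hξ one_pos hxn hyn ?_ ?_).mul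
      ((hE v _ _ hx hy).mul (hE v' _ _ ?_ ?_))
    · intro w
      rw [norm_ofReal_pos w.1.2.1]
      exact w.1.2.2.1
    · intro w
      rw [norm_ofReal_pos ht]
      exact ht1
    · rintro ⟨⟨q, h1, h2, h3, h4⟩, g⟩
      have h5 := (isParam_sqrt ht ht1 h1 h2).c_pos
      dsimp only
      rw [norm_ofReal_pos h5]
      have : q * (√(t / q) * ξ) < √(t / q) * ξ := by nlinarith [mul_pos h5 hξ]
      intro h6
      linarith
    · rintro ⟨⟨q, h1, h2, h3, h4⟩, g⟩
      have h5 := (isParam_sqrt ht ht1 h1 h2).c_pos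
      dsimp only
      rw [norm_ofReal_pos h5, mul_one]
      exact h3.ne
    · exact continuous_pi fun i => ((continuous_apply i).comp hx).inv₀ fun w =>
        norm_pos_iff.1 (hξ.trans_eq (hxn w i).symm)
    · exact continuous_pi fun i => ((continuous_apply i).comp hy).inv₀ fun w =>
        norm_pos_iff.1 (one_pos.trans_eq (hyn w i).symm)
  have := continuous_parametric_integral_of_continuous (μ := volume) hF isCompact_univ
  simp only [setIntegral_univ] at this
  exact this

lemma gram_symm_far (ht : 0 < t) (ht1 : t < 1) (hq : q ∈ farParam t ξ) (β γ : Fin N →₀ ℕ) :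
    gram n m q t √(t / q) ξ 1 β γ = gram n m q t √(t / q) ξ 1 γ β := by
  set B : Set ℝ := {r : ℝ | ¬ Function.Injective (dualEigen (N := N) (r : ℂ)⁻¹ t)} with hB
  have hBc : B.Countable := by
    have := (countable_not_injective_dualEigen (N := N) ht ht1).preimage_of_injOn
      (f := fun r : ℝ => (r : ℂ)⁻¹) (inv_injective.comp ofReal_injective).injOn
    exact this
  have hd : Dense Bᶜ := hBc.dense_compl ℝ
  have hopen := isOpen_farParam t ξ
  have hcl : q ∈ closure (farParam t ξ ∩ Bᶜ) := hd.open_subset_closure_inter hopen hq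
  have hcont := ((continuousOn_gram (n := n) (m := m) ht ht1 ξ β γ).sub
    (continuousOn_gram (n := n) (m := m) ht ht1 ξ γ β)).continuousAt (hopen.mem_nhds hq)
  have hmem := mem_closure_image hcont hcl
  have hsub : ((fun q => gram n m q t √(t / q) ξ 1 β γ) - fun q => gram n m q t √(t / q) ξ 1 γ β) ''
      (farParam t ξ ∩ Bᶜ) ⊆ {0} := by
    rintro _ ⟨r, ⟨⟨h1, h2, h3, h4⟩, hr⟩, rfl⟩
    rw [Set.mem_singleton_iff, Pi.sub_apply, sub_eq_zero]
    exact gram_symm_of_injective (isParam_sqrt ht ht1 h1 h2) one_pos (by rwa [mul_one]) h4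
      (not_not.1 hr) β γ
  have := closure_mono hsub hmem
  rw [closure_singleton, Set.mem_singleton_iff, Pi.sub_apply, sub_eq_zero] at this
  exact this

/-- Reversibility of the pairing of products of deformed elementary symmetric functions. -/
lemma gram_symm (h : IsParam q t c) (hξ : 0 < ξ) (hξ' : 0 < ξ') (hf : Far c ξ ξ')
    (β γ : Fin N →₀ ℕ) : gram n m q t c ξ ξ' β γ = gram n m q t c ξ ξ' γ β := by
  have hq := h.q_pos
  have hc := h.c_pos
  have hcs : c = √(t / q) := by
    rw [← h.rel, mul_div_cancel_left₀ _ hq.ne', Real.sqrt_sq hc.le]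
  set ρ : ℝ := c + (q * c)⁻¹ + 1 with hρ
  have hqc : 0 < q * c := mul_pos hq hc
  have hρ0 : 0 < ρ := by positivity
  have e1 : c < ρ := by rw [hρ]; have := inv_pos.2 hqc; linarith
  have e2 : 1 < q * c * ρ := by
    rw [hρ, mul_add, mul_add, mul_inv_cancel₀ hqc.ne']
    nlinarith [mul_pos hqc hc]
  have hfar : Far c ρ 1 := by
    refine ⟨by rwa [mul_one], e2.trans ?_⟩
    have := h.q_lt
    nlinarith [mul_pos hc hρ0]
  have key : ∀ v v' : Fin N →₀ ℕ, gram n m q t c ξ ξ' v v' = gram n m q t c ρ 1 v v' :=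
    fun v v' => wInt_far h hξ hξ' hρ0 one_pos hf hfar
      ((holStar_epsProd _ _ _ _).mul (holStar_epsProd _ _ _ _).inv)
  rw [key, key, hcs]
  exact gram_symm_far h.t_pos h.t_lt ⟨hq, h.q_lt, hcs ▸ e1, hcs ▸ e2⟩ β γ

end GramSymmetry

section Positivity

open MvPolynomial
open scoped ComplexOrder

variable {m : ℕ}

lemma sum_piAntidiag_antidiagonal {M : Type*} [AddCommMonoid M] (i : Fin m) (d : ℕ)
    (F : ℕ → (Fin m → ℕ) → M) :
    ∑ β ∈ piAntidiag univ d, ∑ p ∈ antidiagonal (β i), F p.1 (Function.update β i p.2) =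
      ∑ p ∈ antidiagonal d, ∑ γ ∈ piAntidiag univ p.2, F p.1 γ := by
  have hs : ∀ (β : Fin m → ℕ) (l : ℕ),
      β i + ∑ j, Function.update β i l j = l + ∑ j, β j := fun β l => by
    rw [← add_sum_erase univ (Function.update β i l) (mem_univ i), Function.update_self,
      ← add_sum_erase univ β (mem_univ i), sum_congr rfl fun j hj =>
        Function.update_of_ne (mem_erase.1 hj).1 l β]
    ring
  rw [sum_sigma', sum_sigma']
  refine sum_bij' (fun b _ => ⟨(b.2.1, d - b.2.1), Function.update b.1 i b.2.2⟩)
    (fun b _ => ⟨Function.update b.2 i (b.1.1 + b.2 i), (b.1.1, b.2 i)⟩) ?_ ?_ ?_ ?_ ?_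
  · rintro ⟨β, k, l⟩ h
    simp only [mem_sigma, mem_piAntidiag, mem_univ, implies_true, and_true,
      HasAntidiagonal.mem_antidiagonal] at h ⊢
    have : β i + univ.sum (Function.update β i l) = l + univ.sum β := hs β l
    have h2 : β i ≤ univ.sum β := single_le_sum (f := β) (fun _ _ => Nat.zero_le _) (mem_univ i)
    constructor <;> omega
  · rintro ⟨⟨k, e⟩, γ⟩ h
    simp only [mem_sigma, mem_piAntidiag, mem_univ, implies_true, and_true,
      HasAntidiagonal.mem_antidiagonal, Function.update_self] at h ⊢
    have : γ i + univ.sum (Function.update γ i (k + γ i)) = k + γ i + univ.sum γ :=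
      hs γ (k + γ i)
    omega
  · rintro ⟨β, k, l⟩ h
    simp only [mem_sigma, mem_piAntidiag, mem_univ, implies_true, and_true,
      HasAntidiagonal.mem_antidiagonal] at h
    simp [h.2]
  · rintro ⟨⟨k, e⟩, γ⟩ h
    simp only [mem_sigma, mem_piAntidiag, mem_univ, implies_true, and_true,
      HasAntidiagonal.mem_antidiagonal] at h
    have : d - k = e := by omega
    simp [this]
  · intros
    rfl

/-- The Hermitian form attached to the kernel `∑ H_β(y) z^β`, in degree `d`. -/
def hermForm (h : ℕ → MvPolynomial (Fin m) ℂ) (ℓ : MvPolynomial (Fin m) ℂ →ₗ[ℂ] ℂ) (d : ℕ) : ℂ :=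
  ∑ β ∈ piAntidiag univ d, ℓ (∏ i, h (β i)) * (starRingEnd ℂ) (ℓ (∏ i, X i ^ β i))

lemma hermForm_rec {h : ℕ → MvPolynomial (Fin m) ℂ} {κ : ℕ → ℝ}
    (hh : ∀ k : ℕ, (k : MvPolynomial (Fin m) ℂ) * h k =
      ∑ p ∈ antidiagonal k, C (κ p.1 : ℂ) * (psum (Fin m) ℂ p.1 * h p.2))
    (ℓ : MvPolynomial (Fin m) ℂ →ₗ[ℂ] ℂ) (d : ℕ) :
    (d : ℂ) * hermForm h ℓ d = ∑ p ∈ antidiagonal d,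
      (κ p.1 : ℂ) * hermForm h (ℓ ∘ₗ LinearMap.mulLeft ℂ (psum (Fin m) ℂ p.1)) p.2 := by
  have step : ∀ i (β : Fin m → ℕ), (β i : ℂ) *
      (ℓ (∏ i, h (β i)) * (starRingEnd ℂ) (ℓ (∏ i, X i ^ β i))) =
      ∑ p ∈ antidiagonal (β i), (κ p.1 : ℂ) *
        (ℓ (psum (Fin m) ℂ p.1 * ∏ j, h (Function.update β i p.2 j)) *
          (starRingEnd ℂ) (ℓ (X i ^ p.1 * ∏ j, X j ^ Function.update β i p.2 j))) := by
    intro i β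
    have e1 : ∀ l, ∏ j, h (Function.update β i l j) = h l * ∏ j ∈ univ.erase i, h (β j) := by
      intro l
      rw [← mul_prod_erase univ _ (mem_univ i), Function.update_self]
      congr 1
      exact prod_congr rfl fun j hj => by rw [Function.update_of_ne (mem_erase.1 hj).1]
    have e2 : ∀ p ∈ antidiagonal (β i), (X i ^ p.1 * ∏ j, X j ^ Function.update β i p.2 j :
        MvPolynomial (Fin m) ℂ) = ∏ j, X j ^ β j := by
      intro p hp
      rw [← mul_prod_erase univ _ (mem_univ i), Function.update_self, ← mul_assoc, ← pow_add,
        HasAntidiagonal.mem_antidiagonal.1 hp, ← mul_prod_erase univ (fun j => X j ^ β j) (mem_univ i)]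
      congr 1
      exact prod_congr rfl fun j hj => by rw [Function.update_of_ne (mem_erase.1 hj).1]
    rw [sum_congr rfl fun p hp => by rw [e2 p hp, e1, ← mul_assoc, ← mul_assoc], ← sum_mul,
      ← mul_assoc]
    congr 1
    have e3 : (β i : ℂ) * ℓ (∏ i, h (β i)) = ℓ (((β i : ℕ) : MvPolynomial (Fin m) ℂ) *
        ∏ i, h (β i)) := by
      rw [← nsmul_eq_mul, ← nsmul_eq_mul, map_nsmul]
    rw [e3, ← mul_prod_erase univ _ (mem_univ i), ← mul_assoc, hh, sum_mul, map_sum]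
    refine sum_congr rfl fun p _ => ?_
    rw [mul_assoc, ← smul_eq_C_mul, map_smul, smul_eq_mul, mul_assoc]
  have h1 : (d : ℂ) * hermForm h ℓ d = ∑ i, ∑ β ∈ piAntidiag univ d, (β i : ℂ) *
      (ℓ (∏ i, h (β i)) * (starRingEnd ℂ) (ℓ (∏ i, X i ^ β i))) := by
    rw [hermForm, mul_sum, sum_comm]
    refine sum_congr rfl fun β hβ => ?_
    rw [← sum_mul, ← Nat.cast_sum, (mem_piAntidiag.1 hβ).1]
  rw [h1]
  simp only [step]
  rw [sum_congr rfl fun i _ => sum_piAntidiag_antidiagonal i d fun k γ => (κ k : ℂ) *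
        (ℓ (psum (Fin m) ℂ k * ∏ j, h (γ j)) *
          (starRingEnd ℂ) (ℓ (X i ^ k * ∏ j, X j ^ γ j))), sum_comm]
  refine sum_congr rfl fun p _ => ?_
  rw [sum_comm, hermForm, mul_sum]
  refine sum_congr rfl fun γ _ => ?_
  rw [← mul_sum, ← mul_sum, ← map_sum, ← map_sum, ← sum_mul]
  rfl

lemma hermForm_nonneg {h : ℕ → MvPolynomial (Fin m) ℂ} {κ : ℕ → ℝ} (h0 : h 0 = 1)
    (hκ : ∀ k, 0 ≤ κ k) (hκ0 : κ 0 = 0)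
    (hh : ∀ k : ℕ, (k : MvPolynomial (Fin m) ℂ) * h k =
      ∑ p ∈ antidiagonal k, C (κ p.1 : ℂ) * (psum (Fin m) ℂ p.1 * h p.2)) (d : ℕ) :
    ∀ ℓ : MvPolynomial (Fin m) ℂ →ₗ[ℂ] ℂ, 0 ≤ hermForm h ℓ d := by
  induction d using Nat.strong_induction_on with
  | _ d ih =>
    intro ℓ
    rcases Nat.eq_zero_or_pos d with rfl | hd
    · rw [hermForm, piAntidiag_zero, sum_singleton]
      simp only [Pi.zero_apply, h0, pow_zero, prod_const_one]
      exact mul_star_self_nonneg (ℓ 1)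
    · have hd' : (d : ℂ) ≠ 0 := by exact_mod_cast hd.ne'
      have hd2 : (0 : ℂ) ≤ (d : ℂ)⁻¹ := by
        have : (0 : ℂ) ≤ (((d : ℝ)⁻¹ : ℝ) : ℂ) := Complex.zero_le_real.2 (by positivity)
        rwa [ofReal_inv, ofReal_natCast] at this
      rw [← inv_mul_cancel_left₀ hd' (hermForm h ℓ d), hermForm_rec hh]
      refine mul_nonneg hd2 (sum_nonneg fun p hp => ?_)
      rcases Nat.eq_zero_or_pos p.1 with h1 | h1
      · simp [h1, hκ0]
      · exact mul_nonneg (by exact_mod_cast hκ _)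
          (ih _ (by have := HasAntidiagonal.mem_antidiagonal.1 hp; omega) _)

/-- A functional is null if its Hermitian form vanishes in every degree. -/
def IsNull (h : ℕ → MvPolynomial (Fin m) ℂ) (ℓ : MvPolynomial (Fin m) ℂ →ₗ[ℂ] ℂ) : Prop :=
  ∀ d, hermForm h ℓ d = 0

lemma IsNull.psum_comp {h : ℕ → MvPolynomial (Fin m) ℂ} {κ : ℕ → ℝ} (h0 : h 0 = 1)
    (hκ : ∀ k, 0 < κ (k + 1)) (hκ0 : κ 0 = 0)
    (hh : ∀ k : ℕ, (k : MvPolynomial (Fin m) ℂ) * h k =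
      ∑ p ∈ antidiagonal k, C (κ p.1 : ℂ) * (psum (Fin m) ℂ p.1 * h p.2))
    {ℓ : MvPolynomial (Fin m) ℂ →ₗ[ℂ] ℂ} (hℓ : IsNull h ℓ) (k : ℕ) :
    IsNull h (ℓ ∘ₗ LinearMap.mulLeft ℂ (psum (Fin m) ℂ (k + 1))) := by
  intro d
  have hκ' : ∀ k, 0 ≤ κ k := fun k => by
    cases k with
    | zero => exact hκ0.ge
    | succ k => exact (hκ k).le
  have h1 := hermForm_rec hh ℓ (k + 1 + d)
  rw [hℓ, mul_zero] at h1
  have h2 := (sum_eq_zero_iff_of_nonneg fun p _ => mul_nonneg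
    (show (0 : ℂ) ≤ (κ p.1 : ℂ) by exact_mod_cast hκ' _)
    (hermForm_nonneg h0 hκ' hκ0 hh _ _)).1 h1.symm (k + 1, d)
    (HasAntidiagonal.mem_antidiagonal.2 rfl)
  exact (mul_eq_zero.1 h2).resolve_left (by exact_mod_cast (hκ k).ne')

lemma IsNull.map_one {h : ℕ → MvPolynomial (Fin m) ℂ} (h0 : h 0 = 1)
    {ℓ : MvPolynomial (Fin m) ℂ →ₗ[ℂ] ℂ} (hℓ : IsNull h ℓ) : ℓ 1 = 0 := by
  have := hℓ 0
  rw [hermForm, piAntidiag_zero, sum_singleton] at this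
  simpa [h0] using this

/-- Symmetric polynomials lie in the subalgebra generated by the power sums. -/
lemma mem_of_psum_mem (A : Subalgebra ℂ (MvPolynomial (Fin m) ℂ))
    (hA : ∀ k, psum (Fin m) ℂ (k + 1) ∈ A) {f : MvPolynomial (Fin m) ℂ} (hf : f.IsSymmetric) :
    f ∈ A := by
  have he : ∀ k, esymm (Fin m) ℂ k ∈ A := by
    intro k
    induction k using Nat.strong_induction_on with
    | _ k ih =>
      rcases Nat.eq_zero_or_pos k with rfl | hk
      · simp
      · have h1 := mul_esymm_eq_sum (Fin m) ℂ k
        have h2 : (k : MvPolynomial (Fin m) ℂ) * esymm (Fin m) ℂ k ∈ A := by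
          rw [h1]
          refine A.mul_mem (A.pow_mem (A.neg_mem A.one_mem) _) (A.sum_mem fun p hp => ?_)
          rw [mem_filter, HasAntidiagonal.mem_antidiagonal] at hp
          refine A.mul_mem (A.mul_mem (A.pow_mem (A.neg_mem A.one_mem) _) (ih _ hp.2)) ?_
          obtain ⟨l, hl⟩ : ∃ l, p.2 = l + 1 := ⟨p.2 - 1, by omega⟩
          rw [hl]
          exact hA l
        have hk' : (k : ℂ) ≠ 0 := by exact_mod_cast hk.ne'
        have h3 := A.smul_mem h2 (k : ℂ)⁻¹
        rwa [← nsmul_eq_mul, ← Nat.cast_smul_eq_nsmul ℂ, smul_smul, inv_mul_cancel₀ hk',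
          one_smul] at h3
  obtain ⟨p, hp⟩ := esymmAlgHom_fin_surjective ℂ (le_refl m)
    (⟨f, hf⟩ : symmetricSubalgebra (Fin m) ℂ)
  have : f = aeval (fun i : Fin m => esymm (Fin m) ℂ (i + 1)) p := by
    rw [← esymmAlgHom_apply, hp]
  rw [this]
  have hle : Algebra.adjoin ℂ (Set.range fun i : Fin m => esymm (Fin m) ℂ (i + 1)) ≤ A :=
    Algebra.adjoin_le (by rintro _ ⟨i, rfl⟩; exact he _)
  refine hle ?_
  rw [Algebra.adjoin_range_eq_range_aeval]
  exact ⟨p, rfl⟩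

/-- The products of `m` complete-type functions span the symmetric polynomials. -/
lemma mem_span_prod_of_isSymmetric {h : ℕ → MvPolynomial (Fin m) ℂ} {κ : ℕ → ℝ} (h0 : h 0 = 1)
    (hκ : ∀ k, 0 < κ (k + 1)) (hκ0 : κ 0 = 0)
    (hh : ∀ k : ℕ, (k : MvPolynomial (Fin m) ℂ) * h k =
      ∑ p ∈ antidiagonal k, C (κ p.1 : ℂ) * (psum (Fin m) ℂ p.1 * h p.2))
    {f : MvPolynomial (Fin m) ℂ} (hf : f.IsSymmetric) :
    f ∈ Submodule.span ℂ (Set.range fun β : Fin m → ℕ => ∏ i, h (β i)) := by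
  by_contra hx
  obtain ⟨ℓ, hℓ, hℓ2⟩ := Submodule.exists_dual_map_eq_bot_of_notMem hx inferInstance
  have hnull : IsNull h ℓ := fun d => sum_eq_zero fun β _ => by
    have : ℓ (∏ i, h (β i)) = 0 := by
      have := Submodule.mem_map_of_mem (f := ℓ) (Submodule.subset_span (R := ℂ)
        (Set.mem_range_self (f := fun β : Fin m → ℕ => ∏ i, h (β i)) β))
      rwa [hℓ2, Submodule.mem_bot] at this
    rw [this, zero_mul]
  let K : Submodule ℂ (MvPolynomial (Fin m) ℂ) :=
    { carrier := {f | ∀ ℓ, IsNull h ℓ → ℓ f = 0}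
      add_mem' := fun {a b} ha hb ℓ hℓ => by rw [map_add, ha ℓ hℓ, hb ℓ hℓ, add_zero]
      zero_mem' := fun ℓ _ => map_zero ℓ
      smul_mem' := fun z a ha ℓ hℓ => by rw [map_smul, ha ℓ hℓ, smul_zero] }
  let T : Subalgebra ℂ (MvPolynomial (Fin m) ℂ) :=
    { carrier := {a | ∀ f ∈ K, a * f ∈ K}
      mul_mem' := fun {a b} ha hb f hf => by rw [mul_assoc]; exact ha _ (hb _ hf)
      add_mem' := fun {a b} ha hb f hf => by rw [add_mul]; exact K.add_mem (ha _ hf) (hb _ hf)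
      algebraMap_mem' := fun z f hf => by
        rw [← Algebra.smul_def]; exact K.smul_mem z hf }
  have hT : f ∈ T := mem_of_psum_mem T (fun k f hf ℓ hℓ =>
    hf _ (hℓ.psum_comp h0 hκ hκ0 hh k)) hf
  have h1 : (1 : MvPolynomial (Fin m) ℂ) ∈ K := fun ℓ hℓ => hℓ.map_one h0
  have h2 := hT 1 h1
  rw [mul_one] at h2
  exact hℓ (h2 ℓ hnull)

end Positivity

section EulerOperator

variable {R : Type*} [CommRing R]

/-- The Euler operator `X d/dX` on power series. -/
def eulerOp (F : PowerSeries R) : PowerSeries R :=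
  PowerSeries.mk fun k => (k : R) * PowerSeries.coeff k F

lemma eulerOp_mul (F G : PowerSeries R) :
    eulerOp (F * G) = eulerOp F * G + F * eulerOp G := by
  ext k
  simp only [eulerOp, PowerSeries.coeff_mk, map_add, PowerSeries.coeff_mul, mul_sum,
    ← sum_add_distrib]
  refine sum_congr rfl fun p hp => ?_
  rw [← HasAntidiagonal.mem_antidiagonal.1 hp, Nat.cast_add]
  ring

lemma eulerOp_rescale (u : R) (F : PowerSeries R) :
    eulerOp (PowerSeries.rescale u F) = PowerSeries.rescale u (eulerOp F) := by
  ext k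
  simp only [eulerOp, PowerSeries.coeff_mk, PowerSeries.coeff_rescale]
  ring

lemma eulerOp_prod {ι : Type*} (s : Finset ι) {F K : ι → PowerSeries R}
    (h : ∀ i, eulerOp (F i) = K i * F i) :
    eulerOp (∏ i ∈ s, F i) = (∑ i ∈ s, K i) * ∏ i ∈ s, F i := by
  classical
  induction s using Finset.induction_on with
  | empty =>
    ext k
    simp only [eulerOp, prod_empty, PowerSeries.coeff_mk, PowerSeries.coeff_one]
    split_ifs with hk <;> simp [hk]
  | insert i s hi ih =>
    rw [prod_insert hi, sum_insert hi, eulerOp_mul, ih, h]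
    ring

end EulerOperator

section LogDerivative

/-- The coefficients of the logarithmic derivative of the generating series `G`. -/
def kapCoef (q t c : ℝ) (k : ℕ) : ℝ := c ^ k * (1 - q ^ k) / (1 - t ^ k)

lemma kapCoef_zero (q t c : ℝ) : kapCoef q t c 0 = 0 := by simp [kapCoef]

lemma IsParam.kapCoef_pos {q t c : ℝ} (h : IsParam q t c) (k : ℕ) : 0 < kapCoef q t c (k + 1) := by
  have h1 := pow_lt_one₀ h.q_pos.le h.q_lt k.succ_ne_zero
  have h2 := pow_lt_one₀ h.t_pos.le h.t_lt k.succ_ne_zero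
  exact div_pos (mul_pos (pow_pos h.c_pos _) (sub_pos.2 h1)) (sub_pos.2 h2)

lemma linSeries_mul_geom (a : ℂ) : linSeries a * PowerSeries.mk (fun k => a ^ k) = 1 := by
  ext k
  rw [linSeries, sub_mul, one_mul, mul_assoc, map_sub, PowerSeries.coeff_C_mul,
    PowerSeries.coeff_one]
  cases k with
  | zero => simp
  | succ k => simp [PowerSeries.coeff_succ_X_mul, pow_succ']

lemma eulerOp_linSeries (a : ℂ) : eulerOp (linSeries a) = linSeries a - 1 := by
  ext k
  simp only [eulerOp, linSeries, PowerSeries.coeff_mk, map_sub, PowerSeries.coeff_C_mul,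
    PowerSeries.coeff_one, PowerSeries.coeff_X]
  split_ifs with h1 h2 h2 <;> simp_all

lemma IsParam.pow_ne_one {q t c : ℝ} (h : IsParam q t c) (k : ℕ) : (t : ℂ) ^ (k + 1) ≠ 1 := by
  exact_mod_cast (pow_lt_one₀ h.t_pos.le h.t_lt k.succ_ne_zero).ne

lemma eulerOp_gSeries {q t c : ℝ} (h : IsParam q t c) :
    eulerOp (gSeries q t c) =
      PowerSeries.mk (fun k => (kapCoef q t c k : ℂ)) * gSeries q t c := by
  set G := gSeries (q : ℂ) t c
  set K : PowerSeries ℂ := PowerSeries.mk fun k => (kapCoef q t c k : ℂ)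
  have hG : linSeries ((q : ℂ) * c) * PowerSeries.rescale (t : ℂ) G = linSeries (c : ℂ) * G :=
    linSeries_mul_rescale_gSeries h.pow_ne_one
  have hE := congrArg eulerOp hG
  simp only [eulerOp_mul, eulerOp_linSeries, eulerOp_rescale] at hE
  have hK : PowerSeries.rescale (t : ℂ) K = K + PowerSeries.mk (fun k => ((q : ℂ) * c) ^ k) -
      PowerSeries.mk fun k => (c : ℂ) ^ k := by
    ext k
    simp only [K, PowerSeries.coeff_rescale, map_add, map_sub, PowerSeries.coeff_mk]
    cases k with
    | zero => simp
    | succ k =>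
      have h1 : (1 - (t : ℂ) ^ (k + 1)) ≠ 0 := sub_ne_zero.2 (h.pow_ne_one k).symm
      simp only [kapCoef]
      push_cast
      field_simp
      ring
  have hA := linSeries_mul_geom ((q : ℂ) * c)
  have hB := linSeries_mul_geom (c : ℂ)
  set F := eulerOp G - K * G with hF
  have hlin : linSeries ((q : ℂ) * c) ≠ 0 := fun h0 => by
    have := congrArg (PowerSeries.coeff 0) h0
    simp [linSeries] at this
  have key : linSeries ((q : ℂ) * c) * PowerSeries.rescale (t : ℂ) F = linSeries (c : ℂ) * F := by
    refine mul_left_cancel₀ hlin ?_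
    rw [hF, map_sub, map_mul, hK]
    set A := PowerSeries.mk fun k => ((q : ℂ) * c) ^ k
    set B := PowerSeries.mk fun k => (c : ℂ) ^ k
    linear_combination linSeries ((q : ℂ) * c) * hE -
      (linSeries ((q : ℂ) * c) * (K + A - B) + linSeries ((q : ℂ) * c) - 1) * hG -
      linSeries (c : ℂ) * G * hA + linSeries ((q : ℂ) * c) * G * hB
  have hz : ∀ k, PowerSeries.coeff k F = 0 := by
    intro k
    induction k with
    | zero => simp [hF, K, eulerOp, kapCoef_zero]
    | succ k ih =>
      have h1 := congrArg (PowerSeries.coeff (k + 1)) key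
      simp only [linSeries, sub_mul, one_mul, mul_assoc, map_sub, PowerSeries.coeff_C_mul,
        PowerSeries.coeff_succ_X_mul, PowerSeries.coeff_rescale, ih, mul_zero, sub_zero] at h1
      have h2 : ((t : ℂ) ^ (k + 1) - 1) * PowerSeries.coeff (k + 1) F = 0 := by
        linear_combination h1
      exact (mul_eq_zero.1 h2).resolve_left (sub_ne_zero.2 (h.pow_ne_one k))
  exact sub_eq_zero.1 (PowerSeries.ext hz)

variable {m : ℕ}

open MvPolynomial

/-- The polynomials in `y` given by the deformed elementary functions without `x`-variables. -/
def hPoly (q t c : ℂ) (m k : ℕ) : MvPolynomial (Fin m) ℂ :=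
  PowerSeries.coeff k (∏ j, PowerSeries.rescale (X j) (PowerSeries.map C (gSeries q t c)))

lemma eval_hPoly (q t c : ℂ) (k : ℕ) (x : Fin 0 → ℂ) (y : Fin m → ℂ) :
    eval y (hPoly q t c m k) = eps q t c k x y := by
  rw [hPoly, ← PowerSeries.coeff_map, map_prod, eps, epsSeries, Fin.prod_univ_zero, one_mul]
  congr 1
  refine prod_congr rfl fun j _ => ?_
  ext k
  simp

lemma hPoly_zero (q t c : ℂ) : hPoly q t c m 0 = 1 := by
  rw [hPoly, PowerSeries.coeff_zero_eq_constantCoeff_apply, map_prod]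
  refine prod_eq_one fun j _ => ?_
  rw [← PowerSeries.coeff_zero_eq_constantCoeff_apply]
  simp [gSeries, gCoef]

lemma hPoly_rec {q t c : ℝ} (h : IsParam q t c) (k : ℕ) :
    (k : MvPolynomial (Fin m) ℂ) * hPoly q t c m k =
      ∑ p ∈ antidiagonal k, C (kapCoef q t c p.1 : ℂ) *
        (psum (Fin m) ℂ p.1 * hPoly q t c m p.2) := by
  have h1 : ∀ j : Fin m,
      eulerOp (PowerSeries.rescale (X j) (PowerSeries.map C (gSeries (q : ℂ) t c))) =
      PowerSeries.rescale (X j : MvPolynomial (Fin m) ℂ)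
        (PowerSeries.map C (PowerSeries.mk fun k => (kapCoef q t c k : ℂ))) *
      PowerSeries.rescale (X j) (PowerSeries.map C (gSeries (q : ℂ) t c)) := by
    intro j
    rw [eulerOp_rescale, ← map_mul, ← map_mul, ← eulerOp_gSeries h]
    congr 1
    ext1 k
    simp [eulerOp]
  have h2 := congrArg (PowerSeries.coeff k) (eulerOp_prod univ h1)
  rw [eulerOp, PowerSeries.coeff_mk, PowerSeries.coeff_mul] at h2
  rw [hPoly, h2]
  refine sum_congr rfl fun p _ => ?_
  rw [← mul_assoc, hPoly]
  congr 1
  simp [psum, mul_sum, mul_comm]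

end LogDerivative

section DeformedInvariants

variable {n m : ℕ}

/-- The deformed invariants of degree less than `r` in each of the variables `x`. -/
structure IsLam (q t c : ℂ) (r : ℕ) (P : (Fin n → ℂ) → (Fin m → ℂ) → ℂ) : Prop where
  symm : ∀ (σ : Equiv.Perm (Fin n)) (τ : Equiv.Perm (Fin m)) x y, P (x ∘ σ) (y ∘ τ) = P x y
  rel : ∀ i j x y s, P (Function.update x i (q * s)) (Function.update y j (t * c⁻¹ * s)) =
    P (Function.update x i s) (Function.update y j (c⁻¹ * s))
  poly : ∀ x, ∃ p : MvPolynomial (Fin m) ℂ, ∀ y, P x y = MvPolynomial.eval y p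
  deg : ∀ i x y, ∃ p ∈ Polynomial.degreeLT ℂ r, ∀ s, P (Function.update x i s) y = p.eval s

lemma IsLam.sub {q t c : ℂ} {r : ℕ} {P Q : (Fin n → ℂ) → (Fin m → ℂ) → ℂ}
    (hP : IsLam q t c r P) (hQ : IsLam q t c r Q) : IsLam q t c r (P - Q) where
  symm σ τ x y := by simp only [Pi.sub_apply, hP.symm, hQ.symm]
  rel i j x y s := by simp only [Pi.sub_apply, hP.rel, hQ.rel]
  poly x := by
    obtain ⟨p, hp⟩ := hP.poly x
    obtain ⟨p', hp'⟩ := hQ.poly x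
    exact ⟨p - p', fun y => by simp only [Pi.sub_apply, hp, hp', map_sub]⟩
  deg i x y := by
    obtain ⟨p, h, hp⟩ := hP.deg i x y
    obtain ⟨p', h', hp'⟩ := hQ.deg i x y
    exact ⟨p - p', Submodule.sub_mem _ h h', fun y => by
      simp only [Pi.sub_apply, hp, hp', Polynomial.eval_sub]⟩

lemma IsLam.sum {q t c : ℂ} {r : ℕ} {ι : Type*} (s : Finset ι) (w : ι → ℂ)
    {P : ι → (Fin n → ℂ) → (Fin m → ℂ) → ℂ} (hP : ∀ a, IsLam q t c r (P a)) :
    IsLam q t c r (fun x y => ∑ a ∈ s, w a * P a x y) where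
  symm σ τ x y := by simp only [(hP _).symm]
  rel i j x y u := by simp only [(hP _).rel]
  poly x := by
    choose p hp using fun a => (hP a).poly x
    exact ⟨∑ a ∈ s, MvPolynomial.C (w a) * p a, fun y => by simp [hp]⟩
  deg i x y := by
    choose p h hp using fun a => (hP a).deg i x y
    exact ⟨∑ a ∈ s, w a • p a, Submodule.sum_mem _ fun a _ => Submodule.smul_mem _ _ (h a),
      fun u => by simp [hp, Polynomial.eval_finsetSum]⟩

lemma prod_apply_update {ι M : Type*} [Fintype ι] [DecidableEq ι] [CommMonoid M] (f : ℂ → M)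
    (x : ι → ℂ) (i : ι) (s : ℂ) :
    ∏ k, f (Function.update x i s k) = f s * ∏ k ∈ univ.erase i, f (x k) := by
  rw [← mul_prod_erase univ _ (mem_univ i), Function.update_self]
  congr 1
  exact prod_congr rfl fun k hk => by rw [Function.update_of_ne (mem_erase.1 hk).1]

lemma eps_comp_perm (q t c : ℂ) (k : ℕ) (σ : Equiv.Perm (Fin n)) (τ : Equiv.Perm (Fin m))
    (x : Fin n → ℂ) (y : Fin m → ℂ) : eps q t c k (x ∘ σ) (y ∘ τ) = eps q t c k x y := by
  simp only [eps, epsSeries, Function.comp_apply]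
  rw [Equiv.prod_comp σ fun i => linSeries (x i),
    Equiv.prod_comp τ fun j => PowerSeries.rescale (y j) (gSeries q t c)]

lemma eps_rel {q t c : ℂ} (hc : c ≠ 0) (ht : ∀ k, t ^ (k + 1) ≠ 1) (k : ℕ) (i : Fin n) (j : Fin m)
    (x : Fin n → ℂ) (y : Fin m → ℂ) (s : ℂ) :
    eps q t c k (Function.update x i (q * s)) (Function.update y j (t * c⁻¹ * s)) =
      eps q t c k (Function.update x i s) (Function.update y j (c⁻¹ * s)) := by
  have h := congrArg (PowerSeries.rescale (c⁻¹ * s))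
    (linSeries_mul_rescale_gSeries (q := q) (c := c) ht)
  simp only [map_mul, rescale_linSeries, PowerSeries.rescale_rescale] at h
  rw [show c⁻¹ * s * (q * c) = q * s by field_simp, show c⁻¹ * s * c = s by field_simp,
    ← mul_assoc] at h
  rw [eps, eps, epsSeries, epsSeries, prod_apply_update linSeries, prod_apply_update linSeries,
    prod_apply_update fun z => PowerSeries.rescale z (gSeries q t c),
    prod_apply_update fun z => PowerSeries.rescale z (gSeries q t c)]
  refine congrArg (PowerSeries.coeff k) ?_
  rw [mul_mul_mul_comm, h, mul_mul_mul_comm]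

lemma eps_update (q t c : ℂ) (k : ℕ) (i : Fin n) (x : Fin n → ℂ) (y : Fin m → ℂ) :
    ∃ a b : ℂ, ∀ s, eps q t c k (Function.update x i s) y = a + b * s := by
  refine ⟨PowerSeries.coeff k ((∏ k ∈ univ.erase i, linSeries (x k)) *
      ∏ j, PowerSeries.rescale (y j) (gSeries q t c)),
    -PowerSeries.coeff k (PowerSeries.X * ((∏ k ∈ univ.erase i, linSeries (x k)) *
      ∏ j, PowerSeries.rescale (y j) (gSeries q t c))), fun s => ?_⟩
  rw [eps, epsSeries, prod_apply_update linSeries, linSeries, mul_assoc, sub_mul, one_mul,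
    mul_assoc, map_sub, PowerSeries.coeff_C_mul]
  ring

lemma eps_zero (q t c : ℂ) (x : Fin n → ℂ) (y : Fin m → ℂ) : eps q t c 0 x y = 1 := by
  rw [eps, epsSeries, PowerSeries.coeff_zero_eq_constantCoeff_apply, map_mul, map_prod, map_prod,
    prod_eq_one, prod_eq_one, one_mul]
  · intro j _
    rw [← PowerSeries.coeff_zero_eq_constantCoeff_apply]
    simp [gSeries, gCoef]
  · intro i _
    simp [linSeries]

lemma eps_cons (q t c : ℂ) (k : ℕ) (s : ℂ) (x : Fin n → ℂ) (y : Fin m → ℂ) :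
    eps q t c (k + 1) (Fin.cons s x : Fin (n + 1) → ℂ) y =
      eps q t c (k + 1) x y - eps q t c k x y * s := by
  rw [eps, epsSeries, Fin.prod_univ_succ]
  simp only [Fin.cons_zero, Fin.cons_succ]
  rw [mul_assoc, ← epsSeries, linSeries, sub_mul, one_mul, mul_assoc, map_sub,
    PowerSeries.coeff_C_mul, PowerSeries.coeff_succ_X_mul, ← eps, ← eps, mul_comm s]

lemma eps_cons_zero (q t c : ℂ) (k : ℕ) (x : Fin n → ℂ) (y : Fin m → ℂ) :
    eps q t c k x (Fin.cons 0 y : Fin (m + 1) → ℂ) = eps q t c k x y := by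
  rw [eps, epsSeries, Fin.prod_univ_succ]
  simp only [Fin.cons_zero, Fin.cons_succ]
  rw [PowerSeries.rescale_zero_apply, eps, epsSeries,
    ← PowerSeries.coeff_zero_eq_constantCoeff_apply]
  simp [gSeries, gCoef]

lemma prod_linear_mem_degreeLT {r : ℕ} (a b : Fin r → ℂ) :
    ∏ i, (Polynomial.C (a i) + Polynomial.C (b i) * Polynomial.X) ∈
      Polynomial.degreeLT ℂ (r + 1) := by
  rw [Polynomial.mem_degreeLT, Nat.cast_add, Nat.cast_one]
  refine lt_of_le_of_lt (Polynomial.degree_le_of_natDegree_le (n := r) ?_) (by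
    exact_mod_cast Nat.lt_succ_self r)
  refine (Polynomial.natDegree_prod_le _ _).trans ?_
  calc _ ≤ ∑ _i : Fin r, 1 := sum_le_sum fun i _ => by
        rw [add_comm]; exact Polynomial.natDegree_linear_le
    _ = r := by simp

lemma prod_linear_sub_mem_degreeLT {r : ℕ} (a b : Fin r → ℂ) :
    ∏ i, (Polynomial.C (a i) + Polynomial.C (b i) * Polynomial.X) -
      Polynomial.C (∏ i, b i) * Polynomial.X ^ r ∈ Polynomial.degreeLT ℂ r := by
  have h1 := prod_linear_mem_degreeLT a b
  rw [Polynomial.mem_degreeLT] at h1 ⊢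
  rw [Polynomial.degree_lt_iff_coeff_zero] at h1 ⊢
  intro k hk
  rcases hk.lt_or_eq with h | rfl
  · rw [Polynomial.coeff_sub, h1 k h, Polynomial.coeff_C_mul_X_pow, if_neg h.ne', sub_zero]
  · have := Polynomial.coeff_prod_of_natDegree_le univ
      (fun i => Polynomial.C (a i) + Polynomial.C (b i) * Polynomial.X) 1 fun i _ => by
        rw [add_comm]; exact Polynomial.natDegree_linear_le
    rw [card_univ, Fintype.card_fin, mul_one] at this
    rw [Polynomial.coeff_sub, this, Polynomial.coeff_C_mul_X_pow]
    simp

lemma isLam_epsProd {q t c : ℂ} (hc : c ≠ 0) (ht : ∀ k, t ^ (k + 1) ≠ 1) {r : ℕ}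
    (v : Fin r →₀ ℕ) :
    IsLam q t c (r + 1) (epsProd q t c v : (Fin n → ℂ) → (Fin m → ℂ) → ℂ) where
  symm σ τ x y := by simp only [epsProd, eps_comp_perm]
  rel i j x y s := by simp only [epsProd, eps_rel hc ht]
  poly x := by
    let A : Subalgebra ℂ ((Fin m → ℂ) → ℂ) :=
      { carrier := {f | ∃ p : MvPolynomial (Fin m) ℂ, ∀ y, f y = MvPolynomial.eval y p}
        mul_mem' := by
          rintro f g ⟨p, hp⟩ ⟨p', hp'⟩
          exact ⟨p * p', fun y => by simp [hp, hp']⟩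
        add_mem' := by
          rintro f g ⟨p, hp⟩ ⟨p', hp'⟩
          exact ⟨p + p', fun y => by simp [hp, hp']⟩
        algebraMap_mem' := fun z => ⟨MvPolynomial.C z, fun y => by simp⟩ }
    exact epsProd_mem A (q := fun _ => q) (c := fun _ => c) t (const_mem_subalgebra A _)
      (const_mem_subalgebra A _) (x := fun _ => x) (y := fun y => y)
      (fun i => const_mem_subalgebra A _) (fun j => ⟨MvPolynomial.X j, fun y => by simp⟩) v
  deg i x y := by
    choose a b hab using fun k => eps_update q t c k i x y
    exact ⟨_, prod_linear_mem_degreeLT (fun k => a (v k)) (fun k => b (v k)), fun s => by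
      simp [epsProd, hab, Polynomial.eval_prod]⟩

/-- The span of the `r`-fold products of deformed elementary symmetric functions. -/
def epsSpan (q t c : ℂ) (n m r : ℕ) : Submodule ℂ ((Fin n → ℂ) → (Fin m → ℂ) → ℂ) :=
  Submodule.span ℂ (Set.range fun v : Fin r →₀ ℕ => epsProd q t c v)

lemma epsProd_mem_epsSpan (q t c : ℂ) {r : ℕ} (v : Fin r →₀ ℕ) :
    (epsProd q t c v : (Fin n → ℂ) → (Fin m → ℂ) → ℂ) ∈ epsSpan q t c n m r :=
  Submodule.subset_span ⟨v, rfl⟩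

lemma epsSpan_mono (q t c : ℂ) (n m : ℕ) : Monotone (epsSpan q t c n m) := by
  refine monotone_nat_of_le_succ fun r => Submodule.span_le.2 ?_
  rintro _ ⟨v, rfl⟩
  have : (epsProd q t c v : (Fin n → ℂ) → (Fin m → ℂ) → ℂ) =
      epsProd q t c (Finsupp.cons 0 v) := by
    funext x y
    simp [epsProd, Fin.prod_univ_succ, eps_zero]
  simp only [this]
  exact epsProd_mem_epsSpan q t c _

lemma isLam_of_mem_epsSpan {q t c : ℂ} (hc : c ≠ 0) (ht : ∀ k, t ^ (k + 1) ≠ 1) {r : ℕ}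
    {F : (Fin n → ℂ) → (Fin m → ℂ) → ℂ} (hF : F ∈ epsSpan q t c n m r) :
    IsLam q t c (r + 1) F := by
  obtain ⟨w, rfl⟩ := (Finsupp.mem_span_range_iff_exists_finsupp).1 hF
  have := IsLam.sum w.support w fun v : Fin r →₀ ℕ =>
    isLam_epsProd (q := q) (n := n) (m := m) hc ht v
  convert this using 1
  funext x y
  simp [Finsupp.sum, Finset.sum_apply]

end DeformedInvariants

section Interpolation

lemma exists_coeff_weights (r : ℕ) : ∃ w : ℕ → ℕ → ℂ, ∀ p ∈ Polynomial.degreeLT ℂ r, ∀ k,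
    p.coeff k = ∑ b ∈ range r, w k b * p.eval (b : ℂ) := by
  refine ⟨fun k b => (Lagrange.basis (range r) (fun b : ℕ => (b : ℂ)) b).coeff k,
    fun p hp k => ?_⟩
  have h := Lagrange.eq_interpolate (s := range r) (v := fun b : ℕ => (b : ℂ)) (f := p)
    Nat.cast_injective.injOn (by simpa [Polynomial.mem_degreeLT] using hp)
  conv_lhs => rw [h, Lagrange.interpolate_apply, Polynomial.finsetSum_coeff]
  refine sum_congr rfl fun b _ => ?_
  rw [Polynomial.coeff_C_mul, mul_comm]

end Interpolation

section Step

variable {n m : ℕ}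

lemma IsLam.cons {q t c : ℂ} {r : ℕ} {P : (Fin (n + 1) → ℂ) → (Fin m → ℂ) → ℂ}
    (hP : IsLam q t c r P) (s : ℂ) :
    IsLam q t c r fun x y => P (Fin.cons s x : Fin (n + 1) → ℂ) y where
  symm σ τ x y := by
    refine Eq.trans ?_ (hP.symm (Equiv.Perm.decomposeFin.symm (0, σ)) τ (Fin.cons s x) y)
    congr 1
    funext i
    refine Fin.cases ?_ (fun i => ?_) i <;> simp
  rel i j x y u := by
    simp only [Fin.cons_update]
    exact hP.rel _ _ _ _ _
  poly x := hP.poly _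
  deg i x y := by
    obtain ⟨p, h, hp⟩ := hP.deg i.succ (Fin.cons s x) y
    exact ⟨p, h, fun u => by rw [← hp, Fin.cons_update]⟩

lemma IsLam.eq_zero {q t c : ℂ} {P : (Fin (n + 1) → ℂ) → (Fin m → ℂ) → ℂ}
    (hP : IsLam q t c 0 P) : P = 0 := by
  funext x y
  obtain ⟨p, h, hp⟩ := hP.deg 0 x y
  replace h : p = 0 := by
    rw [Polynomial.mem_degreeLT, Nat.cast_zero] at h
    exact Polynomial.degree_eq_bot.1 (WithBot.lt_coe_bot.1 h)
  have := hp (x 0)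
  rwa [Function.update_eq_self, h, Polynomial.eval_zero] at this

lemma IsLam.of_cons {q t c : ℂ} {r r' : ℕ} {P : (Fin (n + 1) → ℂ) → (Fin m → ℂ) → ℂ}
    (hP : IsLam q t c r' P) (h : ∀ x y, ∃ p ∈ Polynomial.degreeLT ℂ r,
      ∀ s, P (Fin.cons s x : Fin (n + 1) → ℂ) y = p.eval s) : IsLam q t c r P where
  symm := hP.symm
  rel := hP.rel
  poly := hP.poly
  deg i x y := by
    obtain ⟨p, h, hp⟩ := h (Fin.tail (x ∘ Equiv.swap 0 i)) y
    refine ⟨p, h, fun s => ?_⟩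
    rw [← hp, ← hP.symm (Equiv.swap 0 i) (Equiv.refl _)]
    congr 1
    funext k
    refine Fin.cases ?_ (fun k => ?_) k
    · simp
    · rw [Function.comp_apply, Function.update_of_ne]
      · simp [Fin.tail]
      · intro h
        rw [Equiv.swap_apply_eq_iff, Equiv.swap_apply_right] at h
        exact Fin.succ_ne_zero k h

lemma exists_lift_leading {q t c : ℂ} {r : ℕ} {F : (Fin n → ℂ) → (Fin m → ℂ) → ℂ}
    (hF : F ∈ epsSpan q t c n m r) : ∃ E ∈ epsSpan q t c (n + 1) m r, ∀ x y,
      ∃ p ∈ Polynomial.degreeLT ℂ r, ∀ s, E (Fin.cons s x) y = F x y * s ^ r + p.eval s := by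
  induction hF using Submodule.span_induction with
  | mem F hF =>
    obtain ⟨v, rfl⟩ := hF
    refine ⟨(-1 : ℂ) ^ r • epsProd q t c (Finsupp.equivFunOnFinite.symm fun a => v a + 1),
      Submodule.smul_mem _ _ (epsProd_mem_epsSpan _ _ _ _), fun x y => ?_⟩
    have := prod_linear_sub_mem_degreeLT (fun a => eps q t c (v a + 1) x y)
      fun a => -eps q t c (v a) x y
    refine ⟨_, Submodule.smul_mem _ ((-1 : ℂ) ^ r) this, fun s => ?_⟩
    have h1 : (-1 : ℂ) ^ r * (-1) ^ r = 1 := by rw [← mul_pow]; simp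
    have h2 : ∏ a, -eps q t c (v a) x y = (-1) ^ r * epsProd q t c v x y := by
      rw [epsProd, prod_neg]
      simp
    rw [h2]
    simp only [Pi.smul_apply, smul_eq_mul, epsProd, Finsupp.equivFunOnFinite_symm_apply_apply,
      eps_cons, Polynomial.eval_smul, Polynomial.eval_sub, Polynomial.eval_prod,
      Polynomial.eval_add, Polynomial.eval_mul, Polynomial.eval_C, Polynomial.eval_X,
      Polynomial.eval_pow, neg_mul, ← sub_eq_add_neg]
    linear_combination (s ^ r * ∏ a, eps q t c (v a) x y) * h1
  | zero => exact ⟨0, Submodule.zero_mem _, fun x y => ⟨0, Submodule.zero_mem _, by simp⟩⟩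
  | add F G _ _ hF hG =>
    obtain ⟨E, hE, h⟩ := hF
    obtain ⟨E', hE', h'⟩ := hG
    refine ⟨E + E', Submodule.add_mem _ hE hE', fun x y => ?_⟩
    obtain ⟨p, hp, h⟩ := h x y
    obtain ⟨p', hp', h'⟩ := h' x y
    refine ⟨p + p', Submodule.add_mem _ hp hp', fun s => ?_⟩
    simp only [Pi.add_apply, h, h', Polynomial.eval_add]
    ring
  | smul z F _ hF =>
    obtain ⟨E, hE, h⟩ := hF
    refine ⟨z • E, Submodule.smul_mem _ _ hE, fun x y => ?_⟩
    obtain ⟨p, hp, h⟩ := h x y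
    refine ⟨z • p, Submodule.smul_mem _ _ hp, fun s => ?_⟩
    simp only [Pi.smul_apply, h, Polynomial.eval_smul, smul_eq_mul]
    ring

lemma mem_epsSpan_step {q t c : ℂ} (hc : c ≠ 0) (ht : ∀ k, t ^ (k + 1) ≠ 1) {r : ℕ}
    (h1 : ∀ P : (Fin n → ℂ) → (Fin m → ℂ) → ℂ, IsLam q t c (r + 1) P → P ∈ epsSpan q t c n m r)
    (h2 : ∀ P : (Fin (n + 1) → ℂ) → (Fin m → ℂ) → ℂ, IsLam q t c r P →
      P ∈ epsSpan q t c (n + 1) m r)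
    (P : (Fin (n + 1) → ℂ) → (Fin m → ℂ) → ℂ) (hP : IsLam q t c (r + 1) P) :
    P ∈ epsSpan q t c (n + 1) m r := by
  obtain ⟨w, hw⟩ := exists_coeff_weights (r + 1)
  obtain ⟨E, hE, hlead⟩ := exists_lift_leading (h1 _ (IsLam.sum (range (r + 1)) (w r)
    fun b : ℕ => hP.cons (b : ℂ)))
  have hR : P - E ∈ epsSpan q t c (n + 1) m r := by
    refine h2 _ ((hP.sub (isLam_of_mem_epsSpan hc ht hE)).of_cons fun x y => ?_)
    obtain ⟨p, hp, h⟩ := hP.deg 0 (Fin.cons 0 x) y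
    simp only [Fin.update_cons_zero] at h
    obtain ⟨p', hp', h'⟩ := hlead x y
    refine ⟨p - Polynomial.C (p.coeff r) * Polynomial.X ^ r - p',
      Submodule.sub_mem _ ?_ hp', fun s => ?_⟩
    · rw [Polynomial.mem_degreeLT] at hp ⊢
      rw [Polynomial.degree_lt_iff_coeff_zero] at hp ⊢
      intro k hk
      rw [Polynomial.coeff_sub, Polynomial.coeff_C_mul_X_pow]
      split_ifs with h
      · rw [h, sub_self]
      · rw [hp k (by omega), sub_zero]
    · rw [hw p hp r]
      simp only [Pi.sub_apply, h, h', Polynomial.eval_sub, Polynomial.eval_mul, Polynomial.eval_C,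
        Polynomial.eval_pow, Polynomial.eval_X]
      ring
  simpa using Submodule.add_mem _ hR hE

end Step

section Extraction

variable {m : ℕ}

/-- A triangular system of linear equations with only the trivial solution. -/
lemma eq_zero_of_antidiagonal_relations {q t : ℝ} (hq : 0 < q) (hq1 : q < 1) (ht : 0 < t)
    (ht1 : t < 1) {η : ℂ} (hη : η ≠ 0) : ∀ (m : ℕ) (p : ℕ → (Fin m → ℕ) → ℂ) (τ : Fin m → ℝ),
    (∀ j, 0 < τ j) → (∀ j, τ j < 1) → (∀ a b, m ≤ a → p a b = 0) →
    (∀ j e b, ∑ k ∈ antidiagonal e, ((τ j : ℂ) * q ^ k.1 * t ^ k.2 - 1) * η ^ k.2 *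
      p k.1 (Function.update b j k.2) = 0) → ∀ a b, p a b = 0 := by
  intro m
  induction m with
  | zero => exact fun p τ _ _ h _ a b => h a b (Nat.zero_le _)
  | succ m ih =>
    intro p τ hτ hτ1 hp hrel
    have key : ∀ k a (b : Fin m → ℕ), p a (Fin.cons k b : Fin (m + 1) → ℕ) = 0 := by
      intro k
      induction k using Nat.strong_induction_on with
      | _ k ihk =>
        have h0 : ∀ b : Fin m → ℕ, p 0 (Fin.cons k b : Fin (m + 1) → ℕ) = 0 := by
          intro b
          have h := hrel 0 k (Fin.cons 0 b)
          simp only [Fin.update_cons_zero] at h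
          rw [sum_eq_single (0, k)] at h
          · have hlt : τ 0 * t ^ k < 1 := mul_lt_one_of_nonneg_of_lt_one_left (hτ 0).le (hτ1 0)
              (pow_le_one₀ ht.le ht1.le)
            have hne : (τ 0 : ℂ) * q ^ 0 * t ^ k - 1 ≠ 0 := by
              rw [pow_zero, mul_one, sub_ne_zero]
              exact_mod_cast hlt.ne
            exact (mul_eq_zero.1 h).resolve_left (mul_ne_zero hne (pow_ne_zero _ hη))
          · intro x hx hxk
            have hx' := HasAntidiagonal.mem_antidiagonal.1 hx
            have hlt : x.2 < k := by
              rcases Nat.eq_zero_or_pos x.1 with h | h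
              · exact absurd (Prod.ext h (by omega)) hxk
              · omega
            rw [ihk _ hlt, mul_zero]
          · simp
        have h1 := ih (fun a b => p (a + 1) (Fin.cons k b : Fin (m + 1) → ℕ))
          (fun j => τ j.succ * q) (fun j => mul_pos (hτ _) hq)
          (fun j => mul_lt_one_of_nonneg_of_lt_one_left (hτ _).le (hτ1 _) hq1.le)
          (fun a b h => hp _ _ (by omega)) fun j e b => by
            have h := hrel j.succ (e + 1) (Fin.cons k b)
            simp only [← Fin.cons_update] at h
            rw [Nat.sum_antidiagonal_succ, h0, mul_zero, zero_add] at h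
            rw [← h]
            refine sum_congr rfl fun x _ => ?_
            push_cast
            ring
        intro a b
        cases a with
        | zero => exact h0 b
        | succ a => exact h1 a b
    intro a b
    rw [← Fin.cons_self_tail b]
    exact key _ _ _

/-- The polynomial obtained by multiplying the variable `j` by `u`. -/
def scalePoly (u : ℂ) (j : Fin m) (f : MvPolynomial (Fin m) ℂ) : MvPolynomial (Fin m) ℂ :=
  ∑ d ∈ f.support, MvPolynomial.monomial d (u ^ d j * f.coeff d)

lemma coeff_scalePoly (u : ℂ) (j : Fin m) (f : MvPolynomial (Fin m) ℂ) (d : Fin m →₀ ℕ) :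
    (scalePoly u j f).coeff d = u ^ d j * f.coeff d := by
  classical
  rw [scalePoly, MvPolynomial.coeff_sum]
  simp only [MvPolynomial.coeff_monomial, sum_ite_eq']
  split_ifs with h
  · rfl
  · rw [MvPolynomial.notMem_support_iff.1 h, mul_zero]

lemma eval_scalePoly (u : ℂ) (j : Fin m) (f : MvPolynomial (Fin m) ℂ) (y : Fin m → ℂ) :
    MvPolynomial.eval y (scalePoly u j f) =
      MvPolynomial.eval (Function.update y j (u * y j)) f := by
  rw [MvPolynomial.eval_eq' _ f, scalePoly, map_sum]
  refine sum_congr rfl fun d _ => ?_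
  rw [MvPolynomial.eval_monomial, Finsupp.prod_fintype _ _ (by simp),
    ← mul_prod_erase univ (fun i => Function.update y j (u * y j) i ^ d i) (mem_univ j),
    ← mul_prod_erase univ (fun i => y i ^ d i) (mem_univ j), Function.update_self, mul_pow,
    prod_congr rfl fun k hk => congrArg (· ^ d k)
      (Function.update_of_ne (mem_erase.1 hk).1 (u * y j) y)]
  ring

end Extraction

section SingleVariable

variable {m : ℕ}

lemma IsLam.eq_zero_of_vanish {q t c : ℝ} (hpar : IsParam q t c) {r : ℕ} (hr : r ≤ m)
    {P : (Fin 1 → ℂ) → (Fin m → ℂ) → ℂ} (hP : IsLam (q : ℂ) t c r P)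
    (hv : ∀ x y j, y j = 0 → P x y = 0) : P = 0 := by
  have hc : (c : ℂ) ≠ 0 := by exact_mod_cast hpar.c_pos.ne'
  obtain ⟨w, hw⟩ := exists_coeff_weights r
  choose f hf using fun b : ℕ => hP.poly fun _ => (b : ℂ)
  have hupd : ∀ s : ℂ, Function.update (0 : Fin 1 → ℂ) 0 s = fun _ => s := fun s => by
    funext i
    rw [Subsingleton.elim i 0, Function.update_self]
  choose g hg hPg using fun y => hP.deg 0 0 y
  simp only [hupd] at hPg
  let ρ : ℕ → MvPolynomial (Fin m) ℂ := fun a => ∑ b ∈ range r, MvPolynomial.C (w a b) * f b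
  have hρ : ∀ a y, MvPolynomial.eval y (ρ a) = (g y).coeff a := fun a y => by
    rw [hw _ (hg y)]
    simp only [ρ, map_sum, map_mul, MvPolynomial.eval_C, ← hf, hPg]
  have hρ0 : ∀ a, r ≤ a → ρ a = 0 := fun a ha => MvPolynomial.funext fun y => by
    rw [hρ, map_zero]
    have := hg y
    rw [Polynomial.mem_degreeLT, Polynomial.degree_lt_iff_coeff_zero] at this
    exact this a ha
  have hev : ∀ s y, P (fun _ => s) y = ∑ a ∈ range r, s ^ a * MvPolynomial.eval y (ρ a) := by
    intro s y
    have h0 := hg y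
    rw [Polynomial.mem_degreeLT] at h0
    rw [hPg]
    rcases Nat.eq_zero_or_pos r with rfl | hr0
    · have : g y = 0 := by
        rw [Nat.cast_zero] at h0
        exact Polynomial.degree_eq_bot.1 (WithBot.lt_coe_bot.1 h0)
      simp [this]
    · rw [Polynomial.eval_eq_sum_range' (n := r)]
      · exact sum_congr rfl fun a _ => by rw [hρ, mul_comm]
      · by_cases hz : g y = 0
        · rwa [hz, Polynomial.natDegree_zero]
        · exact (Polynomial.natDegree_lt_iff_degree_lt hz).2 h0
  have hpoly : ∀ j, ∑ a ∈ range r, MvPolynomial.X j ^ a *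
      (MvPolynomial.C ((q : ℂ) ^ a) * scalePoly (t * (c : ℂ)⁻¹) j (ρ a) -
        scalePoly (c : ℂ)⁻¹ j (ρ a)) = 0 := fun j => MvPolynomial.funext fun y => by
    have h := hP.rel 0 j 0 y (y j)
    rw [hupd, hupd, hev, hev, ← sub_eq_zero, ← sum_sub_distrib] at h
    rw [map_zero, ← h, map_sum]
    refine sum_congr rfl fun a _ => ?_
    simp only [map_mul, map_sub, map_pow, MvPolynomial.eval_X, MvPolynomial.eval_C,
      eval_scalePoly]
    ring
  have hcoef : ∀ j e (b : Fin m → ℕ), ∑ k ∈ antidiagonal e,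
      (((q : ℂ) ^ k.1 * t ^ k.2 - 1) * (c : ℂ)⁻¹ ^ k.2) *
        (ρ k.1).coeff (Finsupp.equivFunOnFinite.symm (Function.update b j k.2)) = 0 := by
    intro j e b
    have h := congrArg (MvPolynomial.coeff
      (Finsupp.equivFunOnFinite.symm (Function.update b j e))) (hpoly j)
    rw [MvPolynomial.coeff_sum, MvPolynomial.coeff_zero] at h
    have hterm : ∀ a, MvPolynomial.coeff (Finsupp.equivFunOnFinite.symm (Function.update b j e))
        (MvPolynomial.X j ^ a * (MvPolynomial.C ((q : ℂ) ^ a) *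
          scalePoly (t * (c : ℂ)⁻¹) j (ρ a) - scalePoly (c : ℂ)⁻¹ j (ρ a))) =
        if a ≤ e then (((q : ℂ) ^ a * t ^ (e - a) - 1) * (c : ℂ)⁻¹ ^ (e - a)) *
          (ρ a).coeff (Finsupp.equivFunOnFinite.symm (Function.update b j (e - a))) else 0 := by
      intro a
      rw [MvPolynomial.X_pow_eq_monomial, MvPolynomial.coeff_monomial_mul']
      have hle : Finsupp.single j a ≤ Finsupp.equivFunOnFinite.symm (Function.update b j e) ↔
          a ≤ e := by
        rw [Finsupp.single_le_iff]
        simp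
      have hsub : Finsupp.equivFunOnFinite.symm (Function.update b j e) - Finsupp.single j a =
          Finsupp.equivFunOnFinite.symm (Function.update b j (e - a)) := by
        ext k
        rcases eq_or_ne k j with rfl | hk
        · simp
        · simp [hk]
      rw [hsub, MvPolynomial.coeff_sub, MvPolynomial.coeff_C_mul, coeff_scalePoly,
        coeff_scalePoly]
      refine if_congr hle ?_ rfl
      simp only [Finsupp.equivFunOnFinite_symm_apply_apply, Function.update_self]
      ring
    simp only [hterm] at h
    rw [Nat.sum_antidiagonal_eq_sum_range_succ_mk, ← h]
    have h3 : ∀ (N : ℕ), r ≤ N → e + 1 ≤ N → ∀ G : ℕ → ℂ, (∀ a, r ≤ a → G a = 0) →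
        ∑ a ∈ range (e + 1), G a = ∑ a ∈ range r, if a ≤ e then G a else 0 := by
      intro N h1 h2 G hG
      have e1 : ∑ a ∈ range (e + 1), G a = ∑ a ∈ range N, if a ≤ e then G a else 0 := by
        rw [← sum_filter]
        refine sum_congr ?_ fun _ _ => rfl
        ext a
        simp only [mem_range, mem_filter]
        omega
      rw [e1]
      refine (sum_subset (range_subset_range.2 h1) fun a _ ha => ?_).symm
      rw [hG a (by simpa using ha), ite_self]
    exact h3 (r + (e + 1)) (by omega) (by omega) _ fun a ha => by
      rw [hρ0 a ha, MvPolynomial.coeff_zero, mul_zero]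
  have hzero : ∀ a (b : Fin m → ℕ) j, b j = 0 →
      (ρ a).coeff (Finsupp.equivFunOnFinite.symm b) = 0 := by
    intro a b j hb
    have h : scalePoly 0 j (ρ a) = 0 := MvPolynomial.funext fun y => by
      rw [eval_scalePoly, hρ, map_zero, hw _ (hg _)]
      refine sum_eq_zero fun b _ => ?_
      rw [← hPg, hv _ _ j (by simp), mul_zero]
    have h2 := coeff_scalePoly 0 j (ρ a) (Finsupp.equivFunOnFinite.symm b)
    rw [h, Finsupp.equivFunOnFinite_symm_apply_apply, hb] at h2
    simpa using h2.symm
  have hall : ∀ a (b : Fin m → ℕ),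
      (ρ a).coeff (Finsupp.equivFunOnFinite.symm fun j => b j + 1) = 0 := by
    refine eq_zero_of_antidiagonal_relations hpar.q_pos hpar.q_lt hpar.t_pos hpar.t_lt
      (inv_ne_zero hc) m (fun a b => (ρ a).coeff (Finsupp.equivFunOnFinite.symm fun j => b j + 1))
      (fun _ => t) (fun _ => hpar.t_pos) (fun _ => hpar.t_lt)
      (fun a b ha => by rw [hρ0 a (hr.trans ha), MvPolynomial.coeff_zero]) fun j e b => ?_
    have h := hcoef j (e + 1) fun j => b j + 1
    rw [Nat.sum_antidiagonal_succ', hzero _ _ j (by simp), mul_zero, zero_add] at h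
    refine (mul_eq_zero.1 (Eq.trans ?_ h)).resolve_left (inv_ne_zero hc)
    rw [mul_sum]
    refine sum_congr rfl fun k _ => ?_
    have : (fun i => Function.update b j k.2 i + 1) =
        Function.update (fun i => b i + 1) j (k.2 + 1) := by
      funext i
      rcases eq_or_ne i j with rfl | hi
      · simp
      · simp [hi]
    rw [this]
    ring
  have hρz : ∀ a, ρ a = 0 := by
    intro a
    refine MvPolynomial.ext _ _ fun d => ?_
    rw [MvPolynomial.coeff_zero]
    by_cases hd : ∃ j, d j = 0
    · obtain ⟨j, hj⟩ := hd
      have := hzero a d j hj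
      rwa [Finsupp.equivFunOnFinite_symm_coe] at this
    · push Not at hd
      have := hall a fun j => d j - 1
      rwa [show (fun j => d j - 1 + 1) = d from funext fun j => by have := hd j; omega,
        Finsupp.equivFunOnFinite_symm_coe] at this
  funext x y
  have hx : x = fun _ => x 0 := funext fun i => by rw [Subsingleton.elim i 0]
  rw [hx, hev]
  simp [hρz]

lemma IsLam.cons_zero {n : ℕ} {q t c : ℂ} {r : ℕ} {P : (Fin n → ℂ) → (Fin (m + 1) → ℂ) → ℂ}
    (hP : IsLam q t c r P) : IsLam q t c r fun x y => P x (Fin.cons 0 y : Fin (m + 1) → ℂ) where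
  symm σ τ x y := by
    refine Eq.trans ?_ (hP.symm σ (Equiv.Perm.decomposeFin.symm (0, τ)) x (Fin.cons 0 y))
    congr 1
    funext i
    refine Fin.cases ?_ (fun i => ?_) i <;> simp
  rel i j x y u := by
    simp only [Fin.cons_update]
    exact hP.rel _ _ _ _ _
  poly x := by
    obtain ⟨p, hp⟩ := hP.poly x
    refine ⟨MvPolynomial.bind₁ (Fin.cons 0 MvPolynomial.X : Fin (m + 1) → MvPolynomial (Fin m) ℂ) p,
      fun y => ?_⟩
    rw [hp, MvPolynomial.eval, MvPolynomial.eval, MvPolynomial.eval₂Hom_bind₁]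
    congr 2
    funext j
    refine Fin.cases ?_ (fun j => ?_) j <;> simp
  deg i x y := hP.deg i x _

lemma exists_lift_cons_zero {n : ℕ} {q t c : ℂ} {r : ℕ} {F : (Fin n → ℂ) → (Fin m → ℂ) → ℂ}
    (hF : F ∈ epsSpan q t c n m r) : ∃ E ∈ epsSpan q t c n (m + 1) r, ∀ x y,
      E x (Fin.cons 0 y) = F x y := by
  induction hF using Submodule.span_induction with
  | mem F hF =>
    obtain ⟨v, rfl⟩ := hF
    exact ⟨_, epsProd_mem_epsSpan _ _ _ v, fun x y => by simp only [epsProd, eps_cons_zero]⟩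
  | zero => exact ⟨0, Submodule.zero_mem _, fun x y => rfl⟩
  | add F G _ _ hF hG =>
    obtain ⟨E, hE, h⟩ := hF
    obtain ⟨E', hE', h'⟩ := hG
    exact ⟨E + E', Submodule.add_mem _ hE hE', fun x y => by simp only [Pi.add_apply, h, h']⟩
  | smul z F _ hF =>
    obtain ⟨E, hE, h⟩ := hF
    exact ⟨z • E, Submodule.smul_mem _ _ hE, fun x y => by simp only [Pi.smul_apply, h]⟩

end SingleVariable

section Generation

variable {n m : ℕ}

lemma IsLam.mem_epsSpan_zero {q t c : ℝ} (hpar : IsParam q t c) {r s : ℕ} (hr : m ≤ r)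
    {P : (Fin 0 → ℂ) → (Fin m → ℂ) → ℂ} (hP : IsLam (q : ℂ) t c s P) :
    P ∈ epsSpan (q : ℂ) t c 0 m r := by
  refine epsSpan_mono _ _ _ _ _ hr ?_
  obtain ⟨f, hf⟩ := hP.poly 0
  have hsymm : f.IsSymmetric := fun τ => MvPolynomial.funext fun y => by
    rw [MvPolynomial.eval_rename, ← hf, ← hf, ← hP.symm (Equiv.refl _) τ 0 y]
    rfl
  have hmem := mem_span_prod_of_isSymmetric (hPoly_zero (q : ℂ) t c) hpar.kapCoef_pos
    (kapCoef_zero q t c) (hPoly_rec hpar) hsymm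
  have key : ∀ f ∈ Submodule.span ℂ (Set.range fun β : Fin m → ℕ =>
      ∏ i, hPoly (q : ℂ) t c m (β i)), (fun (_ : Fin 0 → ℂ) y => MvPolynomial.eval y f) ∈
        epsSpan (q : ℂ) t c 0 m m := by
    intro f hf
    induction hf using Submodule.span_induction with
    | mem f hf =>
      obtain ⟨β, rfl⟩ := hf
      convert epsProd_mem_epsSpan (q : ℂ) t c (Finsupp.equivFunOnFinite.symm β) using 1
      funext x y
      simp [epsProd, map_prod, eval_hPoly (q : ℂ) t c _ x y]
    | zero =>
      simp only [map_zero]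
      exact Submodule.zero_mem (epsSpan (q : ℂ) t c 0 m m)
    | add f g _ _ hf hg =>
      simp only [map_add]
      exact Submodule.add_mem _ hf hg
    | smul z f _ hf =>
      simp only [MvPolynomial.smul_eval]
      exact Submodule.smul_mem _ z hf
  convert key f hmem using 1
  funext x y
  rw [Subsingleton.elim x 0, hf]

lemma mem_epsSpan_of_or {q t c : ℂ} (hc : c ≠ 0) (ht : ∀ k, t ^ (k + 1) ≠ 1)
    (H : ∀ r, (∀ P : (Fin n → ℂ) → (Fin m → ℂ) → ℂ, IsLam q t c (r + 1) P →
        P ∈ epsSpan q t c n m r) ∨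
      ∀ P : (Fin (n + 1) → ℂ) → (Fin m → ℂ) → ℂ, IsLam q t c (r + 1) P →
        P ∈ epsSpan q t c (n + 1) m r) (r : ℕ) :
    ∀ P : (Fin (n + 1) → ℂ) → (Fin m → ℂ) → ℂ, IsLam q t c (r + 1) P →
      P ∈ epsSpan q t c (n + 1) m r := by
  induction r with
  | zero =>
    rcases H 0 with h | h
    · exact mem_epsSpan_step hc ht h fun P hP => by
        rw [hP.eq_zero]; exact Submodule.zero_mem _
    · exact h
  | succ r ih =>
    rcases H (r + 1) with h | h
    · exact mem_epsSpan_step hc ht h fun P hP => epsSpan_mono _ _ _ _ _ r.le_succ (ih P hP)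
    · exact h

lemma IsLam.mem_epsSpan_one {q t c : ℝ} (hpar : IsParam q t c) (m : ℕ) :
    ∀ (r : ℕ) (P : (Fin 1 → ℂ) → (Fin m → ℂ) → ℂ), IsLam (q : ℂ) t c (r + 1) P →
      P ∈ epsSpan (q : ℂ) t c 1 m r := by
  have hc : (c : ℂ) ≠ 0 := by exact_mod_cast hpar.c_pos.ne'
  induction m with
  | zero =>
    exact mem_epsSpan_of_or hc hpar.pow_ne_one fun r => Or.inl fun P hP =>
      hP.mem_epsSpan_zero hpar (Nat.zero_le _)
  | succ m ih =>
    refine mem_epsSpan_of_or hc hpar.pow_ne_one fun r => ?_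
    rcases le_or_gt (m + 1) r with hr | hr
    · exact Or.inl fun P hP => hP.mem_epsSpan_zero hpar hr
    · refine Or.inr fun P hP => ?_
      obtain ⟨E, hE, hEP⟩ := exists_lift_cons_zero (ih r _ hP.cons_zero)
      have hR := hP.sub (isLam_of_mem_epsSpan hc hpar.pow_ne_one hE)
      have hz : P - E = 0 := hR.eq_zero_of_vanish hpar hr fun x y j hj => by
        rw [← hR.symm (Equiv.refl _) (Equiv.swap 0 j) x y]
        have : y ∘ Equiv.swap 0 j = Fin.cons 0 (Fin.tail (y ∘ Equiv.swap 0 j)) := by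
          rw [← Fin.cons_self_tail (y ∘ Equiv.swap 0 j)]
          simp [hj]
        rw [this, Pi.sub_apply, Pi.sub_apply, hEP, sub_self]
      rwa [sub_eq_zero.1 hz]

/-- Deformed invariants are spanned by products of deformed elementary symmetric functions. -/
lemma IsLam.mem_epsSpan {q t c : ℝ} (hpar : IsParam q t c) (n m : ℕ) :
    ∀ (r : ℕ) (P : (Fin (n + 1) → ℂ) → (Fin m → ℂ) → ℂ), IsLam (q : ℂ) t c (r + 1) P →
      P ∈ epsSpan (q : ℂ) t c (n + 1) m r := by
  have hc : (c : ℂ) ≠ 0 := by exact_mod_cast hpar.c_pos.ne'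
  induction n with
  | zero => exact IsLam.mem_epsSpan_one hpar m
  | succ n ih => exact mem_epsSpan_of_or hc hpar.pow_ne_one fun r => Or.inl (ih r)

lemma InLambda.isLam {q t c : ℝ} (hpar : IsParam q t c) (hsq : √q * √t = q * c)
    {P : (Fin n → ℂ) → (Fin m → ℂ) → ℂ} (hP : InLambda n m q t P) :
    ∃ r, IsLam (q : ℂ) t c (r + 1) P := by
  obtain ⟨⟨p, hp⟩, hsymm, hrel⟩ := hP
  refine ⟨p.totalDegree, hsymm, fun i j x y s => ?_, fun x => ?_, fun i x y => ?_⟩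
  · have hq : (q : ℂ) ≠ 0 := by exact_mod_cast hpar.q_pos.ne'
    have ht : (t : ℂ) ≠ 0 := by exact_mod_cast hpar.t_pos.ne'
    have hc : (c : ℂ) ≠ 0 := by exact_mod_cast hpar.c_pos.ne'
    have hst : ((√t : ℝ) : ℂ) ≠ 0 := by exact_mod_cast (Real.sqrt_pos.2 hpar.t_pos).ne'
    have hsq' : ((√q : ℝ) : ℂ) * ((√t : ℝ) : ℂ) = q * c := by exact_mod_cast hsq
    have hr : (q : ℂ) * c ^ 2 = t := by exact_mod_cast hpar.rel
    have h := hrel i j (Function.update x i s) (Function.update y j (t * (c : ℂ)⁻¹ * s)) (by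
      simp only [Function.update_self, ← hr]
      field_simp
      linear_combination s * hsq')
    simp only [Function.update_self, Function.update_idem] at h
    rw [h]
    congr 2
    field_simp
  · refine ⟨MvPolynomial.bind₁ (Sum.elim (fun i => MvPolynomial.C (x i)) MvPolynomial.X) p,
      fun y => ?_⟩
    rw [hp, MvPolynomial.eval, MvPolynomial.eval, MvPolynomial.eval₂Hom_bind₁]
    congr 2
    funext j
    cases j <;> simp
  · refine ⟨MvPolynomial.aeval (Sum.elim (Function.update (fun i => Polynomial.C (x i)) i
      Polynomial.X) fun j => Polynomial.C (y j)) p, ?_, fun s => ?_⟩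
    · rw [Polynomial.mem_degreeLT]
      refine lt_of_le_of_lt (Polynomial.degree_le_of_natDegree_le ((MvPolynomial.aeval_natDegree_le
        p le_rfl _ (n := 1) ?_).trans (mul_one _).le)) (by exact_mod_cast Nat.lt_succ_self _)
      rintro (k | j)
      · rcases eq_or_ne k i with rfl | hk
        · simp
        · simp [hk]
      · simp
    · rw [hp, ← Polynomial.coe_evalRingHom, MvPolynomial.aeval_def, MvPolynomial.hom_eval₂,
        ← MvPolynomial.eval₂_id]
      congr 1
      · ext z
        simp
      · funext k
        rcases k with k | j
        · rcases eq_or_ne k i with rfl | hk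
          · simp
          · simp [hk]
        · simp

end Generation

section Pairing

variable {N n m : ℕ} {q t c ξ ξ' : ℝ}

lemma conj_eps (k : ℕ) (x : Fin n → ℂ) (y : Fin m → ℂ) :
    starRingEnd ℂ (eps (q : ℂ) t c k x y) =
      eps (q : ℂ) t c k (fun i => starRingEnd ℂ (x i)) fun j => starRingEnd ℂ (y j) := by
  have h1 : ∀ a : ℂ, PowerSeries.map (starRingEnd ℂ) (linSeries a) =
      linSeries (starRingEnd ℂ a) := fun a => by
    simp [linSeries]
  have h2 : ∀ a : ℂ, PowerSeries.map (starRingEnd ℂ)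
      (PowerSeries.rescale a (gSeries (q : ℂ) t c)) =
        PowerSeries.rescale (starRingEnd ℂ a) (gSeries (q : ℂ) t c) := fun a => by
    ext k
    simp [gSeries, gCoef]
  rw [eps, eps, ← PowerSeries.coeff_map, epsSeries, epsSeries, map_mul, map_prod, map_prod]
  simp only [h1, h2]

lemma conj_epsProd (v : Fin N →₀ ℕ) (x : Fin n → ℂ) (y : Fin m → ℂ) :
    starRingEnd ℂ (epsProd (q : ℂ) t c v x y) =
      epsProd (q : ℂ) t c v (fun i => starRingEnd ℂ (x i)) fun j => starRingEnd ℂ (y j) := by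
  simp only [epsProd, map_prod, conj_eps]

lemma conj_gram (β γ : Fin N →₀ ℕ) :
    starRingEnd ℂ (gram n m q t c ξ ξ' β γ) = gram n m q t c ξ ξ' β γ := by
  refine conj_wInt fun x y => ?_
  rw [map_mul, conj_epsProd, conj_epsProd]
  simp only [Pi.inv_def, map_inv₀]

lemma gram_inv (β γ : Fin N →₀ ℕ) :
    gram n m q t c ξ ξ' β γ = gram n m q t c ξ⁻¹ ξ'⁻¹ γ β := by
  rw [gram, gram, ← wInt_inv]
  simp only [inv_inv, mul_comm]

lemma gram_eq_of_far (h : IsParam q t c) {ξ₁ ξ₁' ξ₂ ξ₂' : ℝ} (h1 : 0 < ξ₁) (h1' : 0 < ξ₁')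
    (h2 : 0 < ξ₂) (h2' : 0 < ξ₂') (hf1 : Far c ξ₁ ξ₁') (hf2 : Far c ξ₂ ξ₂')
    (β γ : Fin N →₀ ℕ) : gram n m q t c ξ₁ ξ₁' β γ = gram n m q t c ξ₂ ξ₂' β γ :=
  wInt_far h h1 h1' h2 h2' hf1 hf2 ((holStar_epsProd _ _ _ β).mul (holStar_epsProd _ _ _ γ).inv)

lemma gram_symm_of_or (h : IsParam q t c) (hξ : 0 < ξ) (hξ' : 0 < ξ')
    (hf : Far c ξ ξ' ∨ Far c ξ⁻¹ ξ'⁻¹) (β γ : Fin N →₀ ℕ) :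
    gram n m q t c ξ ξ' β γ = gram n m q t c ξ ξ' γ β := by
  rcases hf with hf | hf
  · exact gram_symm h hξ hξ' hf β γ
  · exact (gram_inv β γ).trans
      ((gram_symm h (inv_pos.2 hξ) (inv_pos.2 hξ') hf γ β).trans (gram_inv γ β).symm)

lemma gram_eq_of_or (h : IsParam q t c) {ξ₁ ξ₁' ξ₂ ξ₂' : ℝ} (h1 : 0 < ξ₁) (h1' : 0 < ξ₁')
    (h2 : 0 < ξ₂) (h2' : 0 < ξ₂') (hf1 : Far c ξ₁ ξ₁' ∨ Far c ξ₁⁻¹ ξ₁'⁻¹)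
    (hf2 : Far c ξ₂ ξ₂' ∨ Far c ξ₂⁻¹ ξ₂'⁻¹) (β γ : Fin N →₀ ℕ) :
    gram n m q t c ξ₁ ξ₁' β γ = gram n m q t c ξ₂ ξ₂' β γ := by
  have key : ∀ {ξ ξ' : ℝ}, 0 < ξ → 0 < ξ' → Far c ξ ξ' ∨ Far c ξ⁻¹ ξ'⁻¹ →
      ∃ r r' : ℝ, 0 < r ∧ 0 < r' ∧ Far c r r' ∧
        gram n m q t c ξ ξ' β γ = gram n m q t c r r' β γ := by
    rintro ξ ξ' hξ hξ' (hf | hf)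
    · exact ⟨ξ, ξ', hξ, hξ', hf, rfl⟩
    · refine ⟨ξ⁻¹, ξ'⁻¹, inv_pos.2 hξ, inv_pos.2 hξ', hf, ?_⟩
      rw [gram_inv, gram_symm h (inv_pos.2 hξ) (inv_pos.2 hξ') hf]
  obtain ⟨r₁, r₁', hr1, hr1', hfr1, e1⟩ := key h1 h1' hf1
  obtain ⟨r₂, r₂', hr2, hr2', hfr2, e2⟩ := key h2 h2' hf2
  rw [e1, e2]
  exact gram_eq_of_far h hr1 hr1' hr2 hr2' hfr1 hfr2 β γ

lemma Admissible.far_or (hq : 0 < q) (ht : 0 < t) (hξ : 0 < ξ) (hξ' : 0 < ξ')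
    (h : Admissible q t ξ ξ') :
    Far ((√q)⁻¹ * √t) ξ ξ' ∨ Far ((√q)⁻¹ * √t) ξ⁻¹ ξ'⁻¹ := by
  have hsq := Real.sqrt_pos.2 hq
  have hst := Real.sqrt_pos.2 ht
  have hM : 0 < Mmax q t := lt_max_of_lt_left (div_pos hsq hst)
  have key : ∀ {r r' : ℝ}, 0 < r → 0 < r' → Mmax q t < r / r' → Far ((√q)⁻¹ * √t) r r' := by
    intro r r' hr hr' hlt
    obtain ⟨h1, h2⟩ := max_lt_iff.1 hlt
    rw [div_lt_div_iff₀ hst hr'] at h1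
    rw [div_lt_div_iff₀ hsq hr'] at h2
    constructor
    · rw [mul_assoc, inv_mul_lt_iff₀ hsq]
      linarith
    · rw [mul_assoc, lt_inv_mul_iff₀ hsq]
      linarith
  refine h.imp (key hξ hξ') fun h => key (inv_pos.2 hξ) (inv_pos.2 hξ') ?_
  rw [inv_div_inv, ← inv_div]
  exact (lt_inv_comm₀ (div_pos hξ hξ') hM).1 h

lemma starFun_sum_epsProd (w : (Fin N →₀ ℕ) →₀ ℂ) (x : Fin n → ℂ) (y : Fin m → ℂ) :
    starFun (w.sum fun γ a => a • epsProd (q : ℂ) t c γ) x y =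
      ∑ γ ∈ w.support, starRingEnd ℂ (w γ) * epsProd (q : ℂ) t c γ x⁻¹ y⁻¹ := by
  simp only [starFun, Finsupp.sum, Finset.sum_apply, Pi.smul_apply, smul_eq_mul, map_sum, map_mul,
    conj_epsProd, map_inv₀, Complex.conj_conj, Pi.inv_def]

lemma pairingNM_eq_sum_gram (h : IsParam q t ((√q)⁻¹ * √t)) (hξ : 0 < ξ) (hξ' : 0 < ξ')
    (hf : Far ((√q)⁻¹ * √t) ξ ξ' ∨ Far ((√q)⁻¹ * √t) ξ⁻¹ ξ'⁻¹) (v w : (Fin N →₀ ℕ) →₀ ℂ) :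
    pairingNM n m q t
        (v.sum fun β a => a • epsProd (q : ℂ) t (((√q)⁻¹ * √t : ℝ) : ℂ) β)
        (w.sum fun γ a => a • epsProd (q : ℂ) t (((√q)⁻¹ * √t : ℝ) : ℂ) γ) ξ ξ' =
      (1 / ((n.factorial : ℂ) * (m.factorial : ℂ))) * (1 / (2 * (Real.pi : ℂ)) ^ (n + m)) *
        ∑ β ∈ v.support, ∑ γ ∈ w.support,
          v β * starRingEnd ℂ (w γ) * gram n m q t ((√q)⁻¹ * √t) ξ ξ' β γ := by
  set c := (√q)⁻¹ * √t with hc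
  have hc0 := h.c_pos
  have h12 : c * ξ ≠ ξ' ∧ c * ξ' ≠ ξ := by
    rcases hf with hf | hf
    · exact ⟨hf.2.ne', hf.1.ne⟩
    · obtain ⟨h1, h2⟩ := hf
      rw [mul_inv_lt_iff₀ hξ', inv_mul_eq_div, lt_div_iff₀ hξ] at h1
      rw [← div_eq_mul_inv, lt_div_iff₀ hξ, inv_mul_lt_iff₀ hξ'] at h2
      exact ⟨h1.ne, by rw [mul_comm]; exact h2.ne'⟩
  set F : (Fin n → ℂ) → (Fin m → ℂ) → ℂ := fun x y =>
    (∑ β ∈ v.support, v β * epsProd (q : ℂ) t c β x y) *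
      ∑ γ ∈ w.support, starRingEnd ℂ (w γ) * epsProd (q : ℂ) t c γ x⁻¹ y⁻¹
  have hF : HolStar F :=
    (HolStar.sum fun β _ => (holStar_epsProd _ _ _ β).const_mul _).mul
      (HolStar.sum fun γ _ => (holStar_epsProd _ _ _ γ).inv.const_mul _)
  have e : ∀ x y, DeltaNM n m q t x y * (v.sum fun β a => a • epsProd (q : ℂ) t (c : ℂ) β) x y *
      starFun (w.sum fun γ a => a • epsProd (q : ℂ) t (c : ℂ) γ) x y =
        wt (q : ℂ) t c x y * F x y := fun x y => by
    rw [starFun_sum_epsProd, deltaNM_eq_wt, ← hc, mul_assoc]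
    simp only [F, Finsupp.sum, Finset.sum_apply, Pi.smul_apply, smul_eq_mul]
  rw [pairingNM]
  simp only [e]
  rw [torusInt_eq_iterated (F := fun x y => wt (q : ℂ) t c x y * F x y) hξ hξ'
    ((continuousOn_wt h hξ hξ' h12.1 h12.2).mul (hF.continuousOn hξ hξ'))]
  congr 1
  exact wInt_sum_mul_sum h hξ hξ' h12.1 h12.2 _ _ _ _ (fun β _ => holStar_epsProd _ _ _ β)
    fun γ _ => (holStar_epsProd _ _ _ γ).inv

lemma InLambda.exists_sum_epsProd (h : IsParam q t ((√q)⁻¹ * √t)) (hn : 1 ≤ n)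
    {P Q : (Fin n → ℂ) → (Fin m → ℂ) → ℂ} (hP : InLambda n m q t P) (hQ : InLambda n m q t Q) :
    ∃ (r : ℕ) (v w : (Fin r →₀ ℕ) →₀ ℂ),
      P = v.sum (fun β a => a • epsProd (q : ℂ) t (((√q)⁻¹ * √t : ℝ) : ℂ) β) ∧
      Q = w.sum fun γ a => a • epsProd (q : ℂ) t (((√q)⁻¹ * √t : ℝ) : ℂ) γ := by
  obtain ⟨n, rfl⟩ := Nat.exists_eq_add_of_le' hn
  have hsq : √q * √t = q * ((√q)⁻¹ * √t) := by
    have := (Real.sqrt_pos.2 h.q_pos).ne'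
    nth_rw 2 [← Real.mul_self_sqrt h.q_pos.le]
    field_simp
  obtain ⟨r, hr⟩ := hP.isLam h hsq
  obtain ⟨r', hr'⟩ := hQ.isLam h hsq
  have hv := epsSpan_mono (q : ℂ) t (((√q)⁻¹ * √t : ℝ) : ℂ) (n + 1) m (le_max_left r r')
    (IsLam.mem_epsSpan h n m r P hr)
  have hw := epsSpan_mono (q : ℂ) t (((√q)⁻¹ * √t : ℝ) : ℂ) (n + 1) m (le_max_right r r')
    (IsLam.mem_epsSpan h n m r' Q hr')
  obtain ⟨v, hv⟩ := Finsupp.mem_span_range_iff_exists_finsupp.1 hv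
  obtain ⟨w, hw⟩ := Finsupp.mem_span_range_iff_exists_finsupp.1 hw
  exact ⟨_, v, w, hv.symm, hw.symm⟩

end Pairing

theorem statement0 (n m : ℕ) (hn : 1 ≤ n) (hm : 1 ≤ m) (q t : ℝ)
    (hq0 : 0 < q) (hq1 : q < 1) (ht0 : 0 < t) (ht1 : t < 1)
    (P Q : (Fin n → ℂ) → (Fin m → ℂ) → ℂ)
    (hP : InLambda n m q t P) (hQ : InLambda n m q t Q) :
    (∀ ξ ξ' : ℝ, 0 < ξ → 0 < ξ' → Admissible q t ξ ξ' →
        pairingNM n m q t P Q ξ ξ' = starRingEnd ℂ (pairingNM n m q t Q P ξ ξ')) ∧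
      ∀ ξ₁ ξ₁' ξ₂ ξ₂' : ℝ, 0 < ξ₁ → 0 < ξ₁' → 0 < ξ₂ → 0 < ξ₂' →
        Admissible q t ξ₁ ξ₁' → Admissible q t ξ₂ ξ₂' →
        pairingNM n m q t P Q ξ₁ ξ₁' = pairingNM n m q t P Q ξ₂ ξ₂' := by
  have hsq := Real.sqrt_pos.2 hq0
  have h : IsParam q t ((√q)⁻¹ * √t) :=
    { q_pos := hq0
      q_lt := hq1
      t_pos := ht0
      t_lt := ht1
      c_pos := mul_pos (inv_pos.2 hsq) (Real.sqrt_pos.2 ht0)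
      rel := by
        rw [mul_pow, inv_pow, Real.sq_sqrt hq0.le, Real.sq_sqrt ht0.le,
          mul_inv_cancel_left₀ hq0.ne'] }
  obtain ⟨r, v, w, rfl, rfl⟩ := hP.exists_sum_epsProd h hn hQ
  refine ⟨fun ξ ξ' hξ hξ' ha => ?_, fun ξ₁ ξ₁' ξ₂ ξ₂' h1 h1' h2 h2' ha1 ha2 => ?_⟩
  · have hf := ha.far_or hq0 ht0 hξ hξ'
    rw [pairingNM_eq_sum_gram h hξ hξ' hf, pairingNM_eq_sum_gram h hξ hξ' hf]
    simp only [map_mul, map_sum, map_div₀, map_one, map_pow, map_natCast, map_ofNat, conj_ofReal,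
      conj_gram, Complex.conj_conj]
    rw [sum_comm]
    congr 1
    refine sum_congr rfl fun γ _ => sum_congr rfl fun β _ => ?_
    rw [gram_symm_of_or h hξ hξ' hf, mul_comm (v β)]
  · have hf1 := ha1.far_or hq0 ht0 h1 h1'
    have hf2 := ha2.far_or hq0 ht0 h2 h2'
    rw [pairingNM_eq_sum_gram h h1 h1' hf1, pairingNM_eq_sum_gram h h2 h2' hf2]
    simp only [gram_eq_of_or h h1 h1' h2 h2' hf1 hf2]
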